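/- arXiv:math/0701266 — 3 statements merged into one kernel-verified Lean document; each statement's English description precedes it below -/
import Mathlib

section
/- Every irreducible complex reflection group G admits a direct product decomposition G = Z × Ĝ where Z ⊆ Z(G) and Ĝ is either trivial or indecomposable and non-abelian. In any such decomposition the subgroup Z is unique. -/
open Module LinearMap

section Defs

variable {𝕜 V : Type*} [Field 𝕜] [AddCommGroup V] [Module 𝕜 V]

/-- A (pseudo)reflection: a nontrivial finite-order linear automorphism
whose fixed subspace is a hyperplane. -/
def IsPseudoReflection (g : V ≃ₗ[𝕜] V) : Prop :=
  IsOfFinOrder g ∧ g ≠ 1 ∧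
    Module.finrank 𝕜 (LinearMap.ker ((g : V →ₗ[𝕜] V) - LinearMap.id)) + 1 = Module.finrank 𝕜 V

/-- The set of reflections of a linear group. -/
def reflectionsOf (G : Subgroup (V ≃ₗ[𝕜] V)) : Set (V ≃ₗ[𝕜] V) :=
  {g | g ∈ G ∧ IsPseudoReflection g}

/-- A reflection group: a finite linear group generated by its reflections. -/
def IsReflectionGroup (G : Subgroup (V ≃ₗ[𝕜] V)) : Prop :=
  Finite G ∧ Subgroup.closure (reflectionsOf G) = G

/-- The group `G` acts irreducibly on `V`. -/
def ActsIrreducibly (G : Subgroup (V ≃ₗ[𝕜] V)) : Prop :=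
  Nontrivial V ∧
    ∀ W : Submodule 𝕜 V, (∀ g ∈ G, W.map ((g : V ≃ₗ[𝕜] V) : V →ₗ[𝕜] V) ≤ W) → W = ⊥ ∨ W = ⊤

/-- A central automorphism: `α g ∈ g · Z(H)` for every `g`. -/
def IsCentralAut {H : Type*} [Group H] (α : MulAut H) : Prop :=
  ∀ g : H, g⁻¹ * α g ∈ Subgroup.center H

/-- An automorphism of `G` preserving the set of reflections of `G`. -/
def PreservesReflections (G : Subgroup (V ≃ₗ[𝕜] V)) (α : MulAut ↥G) : Prop :=
  ∀ g : ↥G, IsPseudoReflection ((g : V ≃ₗ[𝕜] V)) ↔ IsPseudoReflection ((α g : V ≃ₗ[𝕜] V))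

end Defs

/-- Two subgroups give an (internal) direct product decomposition of `H`. -/
def IsInternalDirectProd {H : Type*} [Group H] (A B : Subgroup H) : Prop :=
  (∀ a ∈ A, ∀ b ∈ B, a * b = b * a) ∧ A ⊓ B = ⊥ ∧ A ⊔ B = ⊤

/-- A group is indecomposable if it admits no non-trivial direct product decomposition. -/
def IndecomposableGroup (H : Type*) [Group H] : Prop :=
  ∀ A B : Subgroup H, IsInternalDirectProd A B → A = ⊥ ∨ B = ⊥

/-- A decomposition `H = Z × Ĥ` with `Z` central and `Ĥ` trivial or indecomposable
non-abelian. -/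
def IsCanonicalDecomp {H : Type*} [Group H] (Z Hhat : Subgroup H) : Prop :=
  IsInternalDirectProd Z Hhat ∧ Z ≤ Subgroup.center H ∧
    (Hhat = ⊥ ∨ ((¬ ∀ a ∈ Hhat, ∀ b ∈ Hhat, a * b = b * a) ∧ IndecomposableGroup ↥Hhat))

/-- If two mutually centralizing subgroups generate an irreducible linear group, an element of
one of them that is scalar on a nonzero subspace stable under that subgroup is a scalar. -/
theorem eq_smul_of_stable_submodule {𝕜 V : Type*} [Field 𝕜] [AddCommGroup V] [Module 𝕜 V]
    {A B : Subgroup (V ≃ₗ[𝕜] V)} (hcomm : ∀ a ∈ A, ∀ b ∈ B, a * b = b * a)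
    (hirr : ∀ W : Submodule 𝕜 V, (∀ a ∈ A, ∀ w ∈ W, a w ∈ W) → (∀ b ∈ B, ∀ w ∈ W, b w ∈ W) →
      W = ⊥ ∨ W = ⊤)
    {x : V ≃ₗ[𝕜] V} (hx : x ∈ B) {c : 𝕜} {W : Submodule 𝕜 V} {w₀ : V} (hw₀ : w₀ ∈ W)
    (hne : w₀ ≠ 0) (hW : ∀ b ∈ B, ∀ w ∈ W, b w ∈ W) (hxW : ∀ w ∈ W, x w = c • w) (v : V) :
    x v = c • v := by
  let U : Submodule 𝕜 V :=
    { carrier := {u | ∀ b ∈ B, x (b u) = c • b u}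
      zero_mem' := by simp
      add_mem' := by
        intro u u' hu hu' b hb
        simp only [Set.mem_ofPred_eq] at hu hu'
        rw [map_add, map_add, hu b hb, hu' b hb, smul_add]
      smul_mem' := by
        intro t u hu b hb
        simp only [Set.mem_ofPred_eq] at hu
        rw [map_smul, map_smul, hu b hb, smul_comm] }
  have hmem : ∀ u, u ∈ U ↔ ∀ b ∈ B, x (b u) = c • b u := fun u => Iff.rfl
  have hU : U = ⊥ ∨ U = ⊤ := by
    apply hirr
    · intro a ha u hu b hb
      have h : ∀ y ∈ B, ∀ z, y (a z) = a (y z) := fun y hy z =>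
        (LinearEquiv.congr_fun (hcomm a ha y hy) z).symm
      rw [h b hb, h x hx, (hmem u).1 hu b hb, map_smul]
    · intro b hb u hu b' hb'
      exact hu (b' * b) (B.mul_mem hb' hb)
  have hwU : w₀ ∈ U := fun b hb => hxW _ (hW b hb _ hw₀)
  rcases hU with h | h
  · rw [h, Submodule.mem_bot] at hwU
    exact absurd hwU hne
  · have : v ∈ U := h ▸ Submodule.mem_top
    exact this 1 B.one_mem

/-- A pseudoreflection has a root `e`, which is an eigenvector for an eigenvalue `γ ≠ 1`. -/
theorem IsPseudoReflection.exists_root {𝕜 V : Type*} [Field 𝕜] [CharZero 𝕜] [AddCommGroup V]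
    [Module 𝕜 V] [FiniteDimensional 𝕜 V] {s : V ≃ₗ[𝕜] V} (hs : IsPseudoReflection s) :
    ∃ (e : V) (γ : 𝕜), e ≠ 0 ∧ γ ≠ 1 ∧ s e = γ • e ∧ ∀ v, ∃ t : 𝕜, s v = v + t • e := by
  obtain ⟨hfin, hne, hrank⟩ := hs
  set f : V →ₗ[𝕜] V := (s : V →ₗ[𝕜] V) - LinearMap.id with hf
  have hfv : ∀ v, f v = s v - v := fun v => rfl
  have h1 : finrank 𝕜 (LinearMap.range f) = 1 := by
    have := LinearMap.finrank_range_add_finrank_ker f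
    omega
  obtain ⟨e, he0, he⟩ := finrank_eq_one_iff'.1 h1
  have hr : ∀ v, ∃ t : 𝕜, s v = v + t • (e : V) := by
    intro v
    obtain ⟨t, ht⟩ := he ⟨f v, v, rfl⟩
    refine ⟨t, ?_⟩
    have : t • (e : V) = f v := congrArg Subtype.val ht
    rw [this, hfv]; abel
  have he0' : (e : V) ≠ 0 := fun h => he0 (Subtype.ext h)
  obtain ⟨t, ht⟩ := hr e
  refine ⟨e, 1 + t, he0', ?_, by rw [ht, add_smul, one_smul], hr⟩
  intro h
  have ht0 : t = 0 := by simpa using h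
  rw [ht0, zero_smul, add_zero] at ht
  apply hne
  ext v
  obtain ⟨r, hr⟩ := hr v
  have hpow : ∀ n : ℕ, (s ^ n) v = v + ((n : 𝕜) * r) • (e : V) := by
    intro n
    induction n with
    | zero => simp
    | succ n ih =>
      rw [pow_succ', LinearEquiv.mul_apply, ih, map_add, map_smul, ht, hr]
      push_cast
      module
  obtain ⟨n, hn, hsn⟩ := isOfFinOrder_iff_pow_eq_one.1 hfin
  have h := hpow n
  rw [hsn] at h
  have h2 : ((n : 𝕜) * r) • (e : V) = 0 := by simpa using h
  have h3 : r = 0 := by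
    have hn' : (n : 𝕜) ≠ 0 := by exact_mod_cast hn.ne'
    simpa [he0', hn'] using h2
  rw [hr, h3]; simp

/-- In an irreducible linear group generated by two mutually centralizing subgroups, if a product
`a * b` is a pseudoreflection and `b` is a scalar, then the factor of `b` consists of scalars. -/
theorem forall_scalar_of_mul_scalar {𝕜 V : Type*} [Field 𝕜] [CharZero 𝕜] [AddCommGroup V]
    [Module 𝕜 V] [FiniteDimensional 𝕜 V]
    {A B : Subgroup (V ≃ₗ[𝕜] V)} (hcomm : ∀ a ∈ A, ∀ b ∈ B, a * b = b * a)
    (hirr : ∀ W : Submodule 𝕜 V, (∀ a ∈ A, ∀ w ∈ W, a w ∈ W) → (∀ b ∈ B, ∀ w ∈ W, b w ∈ W) →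
      W = ⊥ ∨ W = ⊤)
    {a b : V ≃ₗ[𝕜] V} (ha : a ∈ A) (hs : IsPseudoReflection (a * b)) {β : 𝕜}
    (hbs : ∀ v, b v = β • v) :
    ∀ b' ∈ B, ∃ c : 𝕜, ∀ v, b' v = c • v := by
  obtain ⟨e, γ, he, hγ, hse, hr⟩ := hs.exists_root
  have hline : ∀ b' ∈ B, ∃ c : 𝕜, b' e = c • e := by
    intro b' hb'
    have hab : ∀ v, (a * b) (b' v) = b' ((a * b) v) := by
      intro v
      have h : a (b' (β • v)) = b' (a (β • v)) := LinearEquiv.congr_fun (hcomm a ha b' hb') (β • v)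
      rw [LinearEquiv.mul_apply, LinearEquiv.mul_apply, hbs, hbs, ← map_smul, h]
    obtain ⟨t, ht⟩ := hr (b' e)
    rw [hab, hse, map_smul] at ht
    have hγ' : γ - 1 ≠ 0 := sub_ne_zero.2 hγ
    refine ⟨(γ - 1)⁻¹ * t, ?_⟩
    have h2 : (γ - 1) • b' e = t • e := by
      rw [sub_smul, ht]; module
    rw [mul_smul, ← h2, inv_smul_smul₀ hγ']
  intro b' hb'
  obtain ⟨c, hc⟩ := hline b' hb'
  refine ⟨c, eq_smul_of_stable_submodule hcomm hirr hb' (Submodule.mem_span_singleton_self e) he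
    ?_ ?_⟩
  · intro b₁ hb₁ w hw
    obtain ⟨t, rfl⟩ := Submodule.mem_span_singleton.1 hw
    obtain ⟨d, hd⟩ := hline b₁ hb₁
    rw [map_smul, hd]
    exact Submodule.smul_mem _ _ (Submodule.smul_mem _ _ (Submodule.mem_span_singleton_self e))
  · intro w hw
    obtain ⟨t, rfl⟩ := Submodule.mem_span_singleton.1 hw
    rw [map_smul, hc, smul_comm]

/-- Let `a` and `b` lie in mutually centralizing subgroups generating an irreducible linear group.
If `a * b` fixes every eigenvector of `a` for the eigenvalue `α`, then `b` is a scalar. -/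
theorem scalar_of_fixes_eigenvectors {𝕜 V : Type*} [Field 𝕜] [AddCommGroup V] [Module 𝕜 V]
    {A B : Subgroup (V ≃ₗ[𝕜] V)} (hcomm : ∀ a ∈ A, ∀ b ∈ B, a * b = b * a)
    (hirr : ∀ W : Submodule 𝕜 V, (∀ a ∈ A, ∀ w ∈ W, a w ∈ W) → (∀ b ∈ B, ∀ w ∈ W, b w ∈ W) →
      W = ⊥ ∨ W = ⊤)
    {a b : V ≃ₗ[𝕜] V} (ha : a ∈ A) (hb : b ∈ B) {α : 𝕜} {h : V} (hne : h ≠ 0)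
    (hah : a h = α • h) (hfix : ∀ v, a v = α • v → (a * b) v = v) :
    ∃ c : 𝕜, ∀ v, b v = c • v := by
  have hα : α ≠ 0 := by
    rintro rfl
    rw [zero_smul] at hah
    exact hne (a.map_eq_zero_iff.1 hah)
  have hab : ∀ b' ∈ B, ∀ v, a (b' v) = b' (a v) := fun b' hb' v =>
    LinearEquiv.congr_fun (hcomm a ha b' hb') v
  refine ⟨α⁻¹, eq_smul_of_stable_submodule hcomm hirr hb
    (W := LinearMap.ker ((a : V →ₗ[𝕜] V) - α • LinearMap.id)) (w₀ := h) ?_ hne ?_ ?_⟩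
  · simp [hah]
  · intro b' hb' w hw
    have hw' : a w = α • w := by simpa [sub_eq_zero] using hw
    simp [hab b' hb', hw']
  · intro w hw
    have hw' : a w = α • w := by simpa [sub_eq_zero] using hw
    have h1 := hfix w hw'
    rw [LinearEquiv.mul_apply, hab b hb, hw', map_smul] at h1
    rw [eq_inv_smul_iff₀ hα, h1]

/-- If an irreducible linear group containing a pseudoreflection is generated by two mutually
centralizing subgroups, then one of them consists of scalars. -/
theorem forall_scalar_or_forall_scalar {𝕜 V : Type*} [Field 𝕜] [IsAlgClosed 𝕜] [CharZero 𝕜]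
    [AddCommGroup V] [Module 𝕜 V] [FiniteDimensional 𝕜 V]
    {A B : Subgroup (V ≃ₗ[𝕜] V)} (hcomm : ∀ a ∈ A, ∀ b ∈ B, a * b = b * a)
    (hirr : ∀ W : Submodule 𝕜 V, (∀ a ∈ A, ∀ w ∈ W, a w ∈ W) → (∀ b ∈ B, ∀ w ∈ W, b w ∈ W) →
      W = ⊥ ∨ W = ⊤)
    {a b : V ≃ₗ[𝕜] V} (ha : a ∈ A) (hb : b ∈ B) (hs : IsPseudoReflection (a * b)) :
    (∀ a' ∈ A, ∃ c : 𝕜, ∀ v, a' v = c • v) ∨ (∀ b' ∈ B, ∃ c : 𝕜, ∀ v, b' v = c • v) := by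
  have hcomm' : ∀ b ∈ B, ∀ a ∈ A, b * a = a * b := fun b hb a ha => (hcomm a ha b hb).symm
  have hirr' : ∀ W : Submodule 𝕜 V, (∀ b ∈ B, ∀ w ∈ W, b w ∈ W) →
      (∀ a ∈ A, ∀ w ∈ W, a w ∈ W) → W = ⊥ ∨ W = ⊤ := fun W h₁ h₂ => hirr W h₂ h₁
  have hba : a * b = b * a := hcomm a ha b hb
  suffices h : (∃ c : 𝕜, ∀ v, a v = c • v) ∨ (∃ c : 𝕜, ∀ v, b v = c • v) by
    rcases h with ⟨c, hc⟩ | ⟨c, hc⟩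
    · exact Or.inl (forall_scalar_of_mul_scalar hcomm' hirr' hb (hba ▸ hs) hc)
    · exact Or.inr (forall_scalar_of_mul_scalar hcomm hirr ha hs hc)
  obtain ⟨e, γ, he, hγ, hse, hr⟩ := hs.exists_root
  have hγ' : γ - 1 ≠ 0 := sub_ne_zero.2 hγ
  have hline : ∀ x : V ≃ₗ[𝕜] V, (∀ v, (a * b) (x v) = x ((a * b) v)) → ∃ c : 𝕜, x e = c • e := by
    intro x hx
    obtain ⟨t, ht⟩ := hr (x e)
    rw [hx, hse, map_smul] at ht
    refine ⟨(γ - 1)⁻¹ * t, ?_⟩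
    have h2 : (γ - 1) • x e = t • e := by
      rw [sub_smul, ht]; module
    rw [mul_smul, ← h2, inv_smul_smul₀ hγ']
  have hsa : ∀ v, (a * b) (a v) = a ((a * b) v) := fun v =>
    LinearEquiv.congr_fun (show (a * b) * a = a * (a * b) by rw [mul_assoc, hba]) v
  have hsb : ∀ v, (a * b) (b v) = b ((a * b) v) := fun v =>
    LinearEquiv.congr_fun (show (a * b) * b = b * (a * b) by rw [← mul_assoc, hba]) v
  obtain ⟨α, hα⟩ := hline a hsa
  obtain ⟨β, hβ⟩ := hline b hsb
  have hαβ : γ = α * β := by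
    have : (α * β) • e = γ • e := by
      rw [← hse, LinearEquiv.mul_apply, hβ, map_smul, hα, smul_smul, mul_comm]
    exact (smul_left_injective 𝕜 he this).symm
  have hfix : ∀ (x : V ≃ₗ[𝕜] V) (μ ν : 𝕜), (∀ v, (a * b) (x v) = x ((a * b) v)) →
      x e = μ • e → ν ≠ μ → ∀ v, x v = ν • v → (a * b) v = v := by
    intro x μ ν hx hxe hνμ v hv
    obtain ⟨t, ht⟩ := hr v
    have h1 := hx v
    rw [hv, map_smul, ht, map_add, map_smul, hv, hxe] at h1
    have h2 : (ν - μ) • (t • e) = 0 := by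
      have : (ν - μ) • (t • e) = ν • (v + t • e) - (ν • v + t • μ • e) := by module
      rw [this, h1, sub_self]
    rw [ht, (smul_eq_zero.1 h2).resolve_left (sub_ne_zero.2 hνμ), add_zero]
  let H : Submodule 𝕜 V := LinearMap.ker (((a * b : V ≃ₗ[𝕜] V) : V →ₗ[𝕜] V) - LinearMap.id)
  have hH : ∀ v, v ∈ H ↔ (a * b) v = v := fun v => by
    rw [LinearMap.mem_ker, LinearMap.sub_apply, sub_eq_zero]; rfl
  by_cases hbot : H = ⊥
  · refine Or.inl ⟨α, fun v => ?_⟩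
    obtain ⟨t, ht⟩ := hr v
    have h1 : v - ((γ - 1)⁻¹ * t) • e ∈ H := by
      rw [hH, map_sub, map_smul, hse, ht]
      have h2 : ((γ - 1)⁻¹ * t) • γ • e = ((γ - 1)⁻¹ * t) • e + t • e := by
        rw [smul_smul, ← add_smul]
        congr 1
        field_simp
        ring
      rw [h2]; abel
    rw [hbot, Submodule.mem_bot, sub_eq_zero] at h1
    rw [h1, map_smul, hα, smul_comm]
  · have : Nontrivial H := Submodule.nontrivial_iff_ne_bot.2 hbot
    have hmap : ∀ x ∈ H, (a : V →ₗ[𝕜] V) x ∈ H := fun x hx => by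
      rw [hH] at hx ⊢
      exact (hsa x).trans (congrArg a hx)
    obtain ⟨α', hα'⟩ := Module.End.exists_eigenvalue ((a : V →ₗ[𝕜] V).restrict hmap)
    obtain ⟨⟨h, hhH⟩, hh⟩ := hα'.exists_hasEigenvector
    have hne : h ≠ 0 := fun h0 => hh.2 (Subtype.ext h0)
    have hah : a h = α' • h := congrArg Subtype.val hh.apply_eq_smul
    rw [hH] at hhH
    by_cases hαα : α' = α
    · subst hαα
      have hα0 : α' ≠ 0 := by
        rintro rfl
        rw [zero_smul] at hah
        exact hne (a.map_eq_zero_iff.1 hah)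
      have hbh : b h = α'⁻¹ • h := by
        have h1 := hhH
        rw [hba, LinearEquiv.mul_apply, hah, map_smul] at h1
        rw [eq_inv_smul_iff₀ hα0, h1]
      refine Or.inl (scalar_of_fixes_eigenvectors hcomm' hirr' hb ha hne hbh ?_)
      rw [← hba]
      refine hfix b β _ hsb hβ ?_
      rintro rfl
      exact hγ (hαβ.trans (mul_inv_cancel₀ hα0))
    · exact Or.inr (scalar_of_fixes_eigenvectors hcomm hirr ha hb hne hah
        (hfix a α α' hsa hα hαα))

/-- The center of a finite irreducible linear group is cyclic. -/
theorem ActsIrreducibly.isCyclic_center {𝕜 V : Type*} [Field 𝕜] [IsAlgClosed 𝕜] [AddCommGroup V]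
    [Module 𝕜 V] [FiniteDimensional 𝕜 V] {G : Subgroup (V ≃ₗ[𝕜] V)} [Finite G]
    (hirr : ActsIrreducibly G) : IsCyclic (Subgroup.center G) := by
  obtain ⟨hV, hirr⟩ := hirr
  have hscal : ∀ z : Subgroup.center G, ∃ c : 𝕜, ∀ v, (z : G).1 v = c • v := by
    intro z
    obtain ⟨c, hc⟩ := Module.End.exists_eigenvalue (((z : G).1 : V ≃ₗ[𝕜] V) : V →ₗ[𝕜] V)
    refine ⟨c, fun v => ?_⟩
    have hstable : ∀ g ∈ G,
        (Module.End.eigenspace (((z : G).1 : V ≃ₗ[𝕜] V) : V →ₗ[𝕜] V) c).map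
          ((g : V ≃ₗ[𝕜] V) : V →ₗ[𝕜] V) ≤
        Module.End.eigenspace (((z : G).1 : V ≃ₗ[𝕜] V) : V →ₗ[𝕜] V) c := by
      rintro g hg _ ⟨u, hu, rfl⟩
      have hu' : (z : G).1 u = c • u := Module.End.mem_eigenspace_iff.1 hu
      have hz := congrArg Subtype.val (Subgroup.mem_center_iff.1 z.2 ⟨g, hg⟩)
      have hz' : g ((z : G).1 u) = (z : G).1 (g u) := LinearEquiv.congr_fun hz u
      rw [Module.End.mem_eigenspace_iff]
      change (z : G).1 (g u) = c • g u
      rw [← hz', hu', map_smul]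
    have htop := (hirr _ hstable).resolve_left hc
    exact Module.End.mem_eigenspace_iff.1 (htop ▸ Submodule.mem_top)
  choose χ hχ using hscal
  obtain ⟨v, hv⟩ := exists_ne (0 : V)
  have hinj := smul_left_injective 𝕜 hv
  let f : Subgroup.center G →* 𝕜 :=
    { toFun := χ
      map_one' := hinj <| by
        change χ 1 • v = (1 : 𝕜) • v
        rw [← hχ, one_smul]; rfl
      map_mul' := fun x y => hinj <| by
        change χ (x * y) • v = (χ x * χ y) • v
        rw [← hχ, mul_smul, ← hχ y, ← hχ x]; rfl }
  refine isCyclic_of_injective_ringHom f fun x y hxy => ?_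
  apply Subtype.ext
  apply Subtype.ext
  ext u
  have : χ x = χ y := hxy
  rw [hχ, hχ, this]

/-- The join of two mutually centralizing subgroups is the set of products. -/
theorem Subgroup.mem_sup_of_commute {H : Type*} [Group H] {A B : Subgroup H}
    (h : ∀ a ∈ A, ∀ b ∈ B, a * b = b * a) {x : H} :
    x ∈ A ⊔ B ↔ ∃ a ∈ A, ∃ b ∈ B, a * b = x := by
  constructor
  · intro hx
    have hN : A ≤ Subgroup.normalizer (B : Set H) := fun a ha => by
      rw [Subgroup.mem_normalizer_iff]
      intro b
      constructor
      · intro hb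
        rwa [h a ha b hb, mul_inv_cancel_right]
      · intro hb
        have := h a ha _ hb
        have h2 : a * b * a⁻¹ = b := by
          have h3 : a * (a * b * a⁻¹) = a * b := by rw [this]; group
          exact mul_left_cancel h3
        rwa [h2] at hb
    have : x ∈ ((A ⊔ B : Subgroup H) : Set H) := hx
    rw [Subgroup.coe_mul_of_left_le_normalizer_right A B hN] at this
    obtain ⟨a, ha, b, hb, hab⟩ := this
    exact ⟨a, ha, b, hb, hab⟩
  · rintro ⟨a, ha, b, hb, rfl⟩
    exact Subgroup.mul_mem_sup ha hb

theorem IsInternalDirectProd.exists_mul {H : Type*} [Group H] {A B : Subgroup H}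
    (h : IsInternalDirectProd A B) (x : H) : ∃ a ∈ A, ∃ b ∈ B, a * b = x :=
  (Subgroup.mem_sup_of_commute h.1).1 (h.2.2 ▸ Subgroup.mem_top x)

theorem IsInternalDirectProd.eq_one {H : Type*} [Group H] {A B : Subgroup H}
    (h : IsInternalDirectProd A B) {x : H} (hA : x ∈ A) (hB : x ∈ B) : x = 1 :=
  Subgroup.mem_bot.1 (h.2.1 ▸ Subgroup.mem_inf.2 ⟨hA, hB⟩)

theorem IsInternalDirectProd.symm {H : Type*} [Group H] {A B : Subgroup H}
    (h : IsInternalDirectProd A B) : IsInternalDirectProd B A :=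
  ⟨fun b hb a ha => (h.1 a ha b hb).symm, inf_comm A B ▸ h.2.1, sup_comm A B ▸ h.2.2⟩

/-- A factor of a direct product decomposition that commutes elementwise is central. -/
theorem IsInternalDirectProd.le_center {H : Type*} [Group H] {A B : Subgroup H}
    (h : IsInternalDirectProd A B) (hA : ∀ x ∈ A, ∀ y ∈ A, x * y = y * x) :
    A ≤ Subgroup.center H := by
  intro x hx
  rw [Subgroup.mem_center_iff]
  intro g
  obtain ⟨a, ha, b, hb, rfl⟩ := h.exists_mul g
  rw [mul_assoc, ← h.1 x hx b hb, ← mul_assoc, hA a ha x hx, mul_assoc]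

/-- A decomposition of the second factor refines a direct product decomposition. -/
theorem IsInternalDirectProd.trans {H : Type*} [Group H] {Z K : Subgroup H}
    (h : IsInternalDirectProd Z K) {A B : Subgroup K} (hAB : IsInternalDirectProd A B) :
    IsInternalDirectProd (Z ⊔ A.map K.subtype) (B.map K.subtype) := by
  have hZA : ∀ z ∈ Z, ∀ a ∈ A.map K.subtype, z * a = a * z := by
    rintro z hz _ ⟨a, -, rfl⟩
    exact h.1 z hz a a.2
  have hAB' : ∀ a ∈ A.map K.subtype, ∀ b ∈ B.map K.subtype, a * b = b * a := by
    rintro _ ⟨a, ha, rfl⟩ _ ⟨b, hb, rfl⟩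
    exact congrArg Subtype.val (hAB.1 a ha b hb)
  refine ⟨?_, ?_, ?_⟩
  · intro x hx b hb
    obtain ⟨z, hz, a, ha, rfl⟩ := (Subgroup.mem_sup_of_commute hZA).1 hx
    obtain ⟨b', -, rfl⟩ := id hb
    rw [mul_assoc, hAB' a ha _ hb, ← mul_assoc, h.1 z hz (K.subtype b') b'.2, mul_assoc]
  · rw [eq_bot_iff]
    rintro x ⟨hx, b, hb, rfl⟩
    obtain ⟨z, hz, _, ⟨a, ha, rfl⟩, hza⟩ := (Subgroup.mem_sup_of_commute hZA).1 hx
    have hzK : z ∈ K := by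
      rw [eq_mul_inv_of_mul_eq hza]
      exact K.mul_mem b.2 (K.inv_mem a.2)
    rw [h.eq_one hz hzK, one_mul] at hza
    have hab : a = b := Subtype.ext hza
    have : b = 1 := hAB.eq_one (hab ▸ ha) hb
    simp [this]
  · rw [sup_assoc, ← Subgroup.map_sup, hAB.2.2, ← MonoidHom.range_eq_map, Subgroup.range_subtype,
      h.2.2]

/-- A finite group all of whose direct product decompositions have a central factor splits off
a central subgroup with trivial or indecomposable non-abelian complement. -/
theorem exists_isCanonicalDecomp {H : Type*} [Group H] [Finite H]
    (hH : ∀ A B : Subgroup H, IsInternalDirectProd A B →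
      A ≤ Subgroup.center H ∨ B ≤ Subgroup.center H) :
    ∃ Z K : Subgroup H, IsCanonicalDecomp Z K := by
  obtain ⟨K, ⟨Z, hZK, hZ⟩, hmin⟩ := (wellFounded_lt (α := Subgroup H)).has_min
    {K | ∃ Z, IsInternalDirectProd Z K ∧ Z ≤ Subgroup.center H}
    ⟨⊤, ⊥, ⟨by simp, by simp, by simp⟩, bot_le⟩
  by_cases hK : ∀ a ∈ K, ∀ b ∈ K, a * b = b * a
  · have hKc := hZK.symm.le_center hK
    have htop : Subgroup.center H = ⊤ := top_le_iff.1 (hZK.2.2 ▸ sup_le hZ hKc)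
    exact ⟨⊤, ⊥, ⟨by simp, by simp, by simp⟩, htop.ge, Or.inl rfl⟩
  refine ⟨Z, K, hZK, hZ, Or.inr ⟨hK, fun A B hAB => ?_⟩⟩
  have key : ∀ A B : Subgroup K, IsInternalDirectProd A B →
      Z ⊔ A.map K.subtype ≤ Subgroup.center H → A = ⊥ := by
    intro A B hAB hc
    have hBK : B.map K.subtype = K :=
      (Subgroup.map_subtype_le B).eq_of_not_lt (hmin _ ⟨_, hZK.trans hAB, hc⟩)
    have hB : B = ⊤ := by
      rw [← Subgroup.map_subtype_inj, hBK, ← MonoidHom.range_eq_map, Subgroup.range_subtype]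
    rw [← hAB.2.1, hB, inf_top_eq]
  rcases hH _ _ (hZK.trans hAB) with hc | hc
  · exact Or.inl (key A B hAB hc)
  · exact Or.inr (key B A hAB.symm (sup_le hZ hc))

/-- Elements of a finite cyclic group generating disjoint subgroups are powers of their
product. -/
theorem IsCyclic.mem_zpowers_mul_of_disjoint {C : Type*} [Group C] [Finite C] [IsCyclic C]
    {a b : C} (h : Disjoint (Subgroup.zpowers a) (Subgroup.zpowers b)) :
    b ∈ Subgroup.zpowers (a * b) := by
  let _ : CommGroup C := IsCyclic.commGroup
  let f : Subgroup.zpowers a × Subgroup.zpowers b →* C :=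
    (Subgroup.zpowers a).subtype.coprod (Subgroup.zpowers b).subtype
  have hf : Function.Injective f := Subgroup.mul_injective_of_disjoint h
  have := isCyclic_of_injective f hf
  have hco := coprime_card_of_isCyclic_prod (Subgroup.zpowers a) (Subgroup.zpowers b)
  rw [Nat.card_zpowers, Nat.card_zpowers] at hco
  have h1 : (a * b) ^ orderOf a ∈ Subgroup.zpowers (a * b) := Subgroup.npow_mem_zpowers _ _
  rw [mul_pow, pow_orderOf_eq_one, one_mul] at h1
  obtain ⟨m, hm⟩ := exists_pow_eq_self_of_coprime hco
  have h2 := Subgroup.pow_mem _ h1 m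
  rwa [hm] at h2

/-- In a finite group with cyclic center, the central factor of one canonical decomposition is
contained in that of any other. -/
theorem IsCanonicalDecomp.central_le {H : Type*} [Group H] [Finite H]
    [IsCyclic (Subgroup.center H)] {Z₁ K₁ Z₂ K₂ : Subgroup H}
    (h₁ : IsCanonicalDecomp Z₁ K₁) (h₂ : IsCanonicalDecomp Z₂ K₂) : Z₁ ≤ Z₂ := by
  obtain ⟨hd₁, hc₁, -⟩ := h₁
  obtain ⟨hd₂, hc₂, hK₂⟩ := h₂
  have hsplit : ∀ z ∈ Z₁, ∃ a ∈ Z₁ ⊓ Z₂, ∃ b ∈ Z₁ ⊓ K₂, a * b = z := by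
    intro z hz
    obtain ⟨a, ha, b, hb, rfl⟩ := hd₂.exists_mul z
    have hbc : b ∈ Subgroup.center H := by
      have := mul_mem (inv_mem (hc₂ ha)) (hc₁ hz)
      rwa [inv_mul_cancel_left] at this
    have hbZ : b ∈ Z₁ := by
      let a' : Subgroup.center H := ⟨a, hc₂ ha⟩
      let b' : Subgroup.center H := ⟨b, hbc⟩
      have hdisj : Disjoint (Subgroup.zpowers a') (Subgroup.zpowers b') := by
        rw [Subgroup.disjoint_def]
        rintro x ⟨m, rfl⟩ ⟨n, hn⟩
        have hn' : b ^ n = a ^ m := congrArg Subtype.val hn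
        apply Subtype.ext
        refine hd₂.eq_one (x := a ^ m) (Z₂.zpow_mem ha m) ?_
        rw [← hn']
        exact K₂.zpow_mem hb n
      obtain ⟨n, hn⟩ := IsCyclic.mem_zpowers_mul_of_disjoint hdisj
      have hn' : (a * b) ^ n = b := congrArg Subtype.val hn
      exact hn' ▸ Z₁.zpow_mem hz n
    have haZ : a ∈ Z₁ := by
      have := Z₁.mul_mem hz (Z₁.inv_mem hbZ)
      rwa [mul_inv_cancel_right] at this
    exact ⟨a, ⟨haZ, ha⟩, b, ⟨hbZ, hb⟩, rfl⟩
  suffices hbot : Z₁ ⊓ K₂ = ⊥ by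
    intro z hz
    obtain ⟨a, ha, b, hb, rfl⟩ := hsplit z hz
    rw [hbot, Subgroup.mem_bot] at hb
    rw [hb, mul_one]
    exact ha.2
  rcases hK₂ with hK₂ | ⟨hna, hind⟩
  · rw [hK₂, inf_bot_eq]
  have hcomm : ∀ y ∈ Z₁ ⊓ Z₂, ∀ k ∈ K₁, y * k = k * y := fun y hy k hk => hd₁.1 y hy.1 k hk
  have hdecomp : IsInternalDirectProd ((Z₁ ⊓ K₂).subgroupOf K₂)
      (((Z₁ ⊓ Z₂) ⊔ K₁).subgroupOf K₂) := by
    refine ⟨?_, ?_, ?_⟩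
    · intro x hx y _
      exact Subtype.ext (Subgroup.mem_center_iff.1 (hc₁ hx.1) y).symm
    · rw [eq_bot_iff]
      rintro x ⟨hx, hx'⟩
      obtain ⟨y, hy, k, hk, hyk⟩ := (Subgroup.mem_sup_of_commute hcomm).1 hx'
      replace hyk : y * k = x := hyk
      have hkZ : k ∈ Z₁ := by
        rw [eq_inv_mul_of_mul_eq hyk]
        exact Z₁.mul_mem (Z₁.inv_mem hy.1) hx.1
      rw [hd₁.eq_one hkZ hk, mul_one] at hyk
      exact Subtype.ext (hd₂.eq_one (hyk ▸ hy.2) x.2)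
    · rw [eq_top_iff]
      rintro x -
      obtain ⟨z, hz, k, hk, hzk⟩ := hd₁.exists_mul (x : H)
      obtain ⟨a, ha, b, hb, rfl⟩ := hsplit z hz
      have hx : (⟨b, hb.2⟩ : K₂) * (⟨b, hb.2⟩⁻¹ * x) = x := mul_inv_cancel_left _ _
      rw [← hx]
      refine Subgroup.mul_mem_sup hb ?_
      have hak : b⁻¹ * (x : H) = a * k := by
        rw [← hzk, (Subgroup.mem_center_iff.1 (hc₁ hb.1) a), mul_assoc, inv_mul_cancel_left]
      change b⁻¹ * (x : H) ∈ (Z₁ ⊓ Z₂) ⊔ K₁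
      rw [hak]
      exact Subgroup.mul_mem_sup ha hk
  rcases hind _ _ hdecomp with h | h
  · rw [eq_bot_iff]
    intro x hx
    have hx' : (⟨x, hx.2⟩ : K₂) ∈ (Z₁ ⊓ K₂).subgroupOf K₂ := hx
    rw [h, Subgroup.mem_bot] at hx'
    exact congrArg Subtype.val hx'
  · refine absurd (fun x hx y _ => ?_) hna
    have htop := hdecomp.2.2
    rw [h, sup_bot_eq] at htop
    have hx' : (⟨x, hx⟩ : K₂) ∈ (Z₁ ⊓ K₂).subgroupOf K₂ := htop ▸ Subgroup.mem_top _
    exact (Subgroup.mem_center_iff.1 (hc₁ hx'.1) y).symm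

/-- If two mutually centralizing subgroups generate an irreducible reflection group, then one of
them is central. -/
theorem IsReflectionGroup.le_center_or_le_center {𝕜 V : Type*} [Field 𝕜] [IsAlgClosed 𝕜]
    [CharZero 𝕜] [AddCommGroup V] [Module 𝕜 V] [FiniteDimensional 𝕜 V]
    {G : Subgroup (V ≃ₗ[𝕜] V)} (hG : IsReflectionGroup G) (hirr : ActsIrreducibly G)
    {A B : Subgroup G} (hAB : IsInternalDirectProd A B) :
    A ≤ Subgroup.center G ∨ B ≤ Subgroup.center G := by
  have hcenter : ∀ S : Subgroup G,
      (∀ x ∈ S.map G.subtype, ∃ c : 𝕜, ∀ v, x v = c • v) → S ≤ Subgroup.center G := by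
    intro S hS x hx
    obtain ⟨c, hc⟩ := hS x ⟨x, hx, rfl⟩
    rw [Subgroup.mem_center_iff]
    intro g
    apply Subtype.ext
    ext v
    change g.1 (x.1 v) = x.1 (g.1 v)
    rw [hc, hc, map_smul]
  by_cases hr : ∃ s, s ∈ reflectionsOf G
  · obtain ⟨s, hsG, hs⟩ := hr
    obtain ⟨a, ha, b, hb, hab⟩ := hAB.exists_mul ⟨s, hsG⟩
    have hab' : (a : V ≃ₗ[𝕜] V) * b = s := congrArg Subtype.val hab
    refine (forall_scalar_or_forall_scalar (A := A.map G.subtype) (B := B.map G.subtype) ?_ ?_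
      ⟨a, ha, rfl⟩ ⟨b, hb, rfl⟩ (hab'.symm ▸ hs)).imp (hcenter A) (hcenter B)
    · rintro _ ⟨x, hx, rfl⟩ _ ⟨y, hy, rfl⟩
      exact congrArg Subtype.val (hAB.1 x hx y hy)
    · intro W hWA hWB
      apply hirr.2
      rintro g hg _ ⟨w, hw, rfl⟩
      obtain ⟨x, hx, y, hy, hxy⟩ := hAB.exists_mul ⟨g, hg⟩
      have hxy' : (x : V ≃ₗ[𝕜] V) * y = g := congrArg Subtype.val hxy
      rw [← hxy']
      exact hWA x ⟨x, hx, rfl⟩ _ (hWB y ⟨y, hy, rfl⟩ w hw)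
  · have hbot : G = ⊥ := by
      rw [← hG.2, Set.eq_empty_iff_forall_notMem.2 (not_exists.1 hr), Subgroup.closure_empty]
    subst hbot
    exact Or.inl fun x _ => by
      rw [Subsingleton.elim x 1]
      exact Subgroup.one_mem _

/-- **Proposition 9 (Marin–Michel).** Every irreducible complex reflection group `G`
decomposes as `G = Z × Ĝ` with `Z ⊆ Z(G)` and `Ĝ` trivial or indecomposable non-abelian,
and in any such decomposition the central factor `Z` is unique. -/
theorem irreducible_reflection_group_canonical_decomposition
    {V : Type} [AddCommGroup V] [Module ℂ V] [FiniteDimensional ℂ V]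
    (G : Subgroup (V ≃ₗ[ℂ] V)) (hG : IsReflectionGroup G) (hirr : ActsIrreducibly G) :
    (∃ Z Ghat : Subgroup ↥G, IsCanonicalDecomp Z Ghat) ∧
    (∀ Z₁ Ghat₁ Z₂ Ghat₂ : Subgroup ↥G,
      IsCanonicalDecomp Z₁ Ghat₁ → IsCanonicalDecomp Z₂ Ghat₂ → Z₁ = Z₂) := by
  have : Finite G := hG.1
  have : IsCyclic (Subgroup.center G) := hirr.isCyclic_center
  exact ⟨exists_isCanonicalDecomp fun _ _ hAB => hG.le_center_or_le_center hirr hAB,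
    fun _ _ _ _ h₁ h₂ => le_antisymm (h₁.central_le h₂) (h₂.central_le h₁)⟩
end

section
/- Every automorphism of the group G(de,e,r) is the composition of an automorphism which preserves the set of reflections with a central automorphism, except when G(de,e,r) is G(1,1,6) ≅ S_6 or the non-irreducible group G(2,2,2) ≅ S_2 × S_2. -/
open Module LinearMap

/-- The set of monomial matrices constituting `G(de,e,r)` (given here by the parameters
`d`, `e`, `r`): the nonzero entries are `de`-th roots of unity and their product is a
`d`-th root of unity. -/
def monomialSet (d e r : ℕ) : Set (Matrix.GeneralLinearGroup (Fin r) ℂ) :=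
  {A | ∃ σ : Equiv.Perm (Fin r),
    (∀ i j, ((A : Matrix (Fin r) (Fin r) ℂ) i j ≠ 0 ↔ i = σ j)) ∧
    (∀ j, ((A : Matrix (Fin r) (Fin r) ℂ) (σ j) j) ^ (d * e) = 1) ∧
    (∏ j, (A : Matrix (Fin r) (Fin r) ℂ) (σ j) j) ^ d = 1}

/-- The imprimitive complex reflection group `G(de,e,r)`. -/
def Gdeer (d e r : ℕ) : Subgroup (Matrix.GeneralLinearGroup (Fin r) ℂ) :=
  Subgroup.closure (monomialSet d e r)

/-- A matrix is a (pseudo)reflection iff it fixes a hyperplane pointwise,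
i.e. `rank (A - 1) = 1`. -/
def IsMatrixReflection {r : ℕ} (A : Matrix.GeneralLinearGroup (Fin r) ℂ) : Prop :=
  ((A : Matrix (Fin r) (Fin r) ℂ) - 1).rank = 1

/-- An automorphism of a matrix group preserving its set of reflections. -/
def PreservesMatrixReflections {r : ℕ} (G : Subgroup (Matrix.GeneralLinearGroup (Fin r) ℂ))
    (α : MulAut ↥G) : Prop :=
  ∀ g : ↥G, IsMatrixReflection (g : Matrix.GeneralLinearGroup (Fin r) ℂ) ↔
    IsMatrixReflection ((α g : ↥G) : Matrix.GeneralLinearGroup (Fin r) ℂ)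

/-! ### An abstract model of `G(de,e,r)` -/

/-- Pairs `(a, σ)` consisting of a `U`-valued vector `a` with `(∏ a)^d = 1` and a permutation,
an abstract model for the group of monomial matrices `G(de,e,r)` when `U = μ_{de}`. -/
def monomialGroup (U : Type*) [CommGroup U] (n : Type*) [Fintype n] (d : ℕ) :
    Subgroup ((n → U) ⋊[mulAutArrow] Equiv.Perm n) where
  carrier := {g | (∏ i, g.left i) ^ d = 1}
  one_mem' := by simp
  mul_mem' := by
    intro a b ha hb
    have h : ∏ i, mulAutArrow a.right b.left i = ∏ i, b.left i :=
      Equiv.prod_comp (a.right⁻¹ : Equiv.Perm n) b.left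
    simp only [Set.mem_ofPred_eq, SemidirectProduct.mul_left, Pi.mul_apply,
      Finset.prod_mul_distrib, h, mul_pow] at *
    rw [ha, hb, one_mul]
  inv_mem' := by
    intro a ha
    have h : ∏ i, mulAutArrow a.right⁻¹ a.left⁻¹ i = ∏ i, a.left⁻¹ i :=
      Equiv.prod_comp ((a.right⁻¹)⁻¹ : Equiv.Perm n) a.left⁻¹
    simp only [Set.mem_ofPred_eq, SemidirectProduct.inv_left, h, Pi.inv_apply,
      Finset.prod_inv_distrib, inv_pow] at *
    rw [ha, inv_one]

namespace monomialGroup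

open Equiv

variable {U : Type*} [CommGroup U] {n : Type*} [Fintype n] {d : ℕ}

/-- The underlying permutation of a monomial element. -/
def perm : monomialGroup U n d →* Perm n :=
  SemidirectProduct.rightHom.comp (monomialGroup U n d).subtype

/-- The nonzero entry of a monomial element in row `i`. -/
def entry (g : monomialGroup U n d) (i : n) : U := g.1.left i

/-- The monomial element with given entries and permutation. -/
def mk (a : n → U) (σ : Perm n) (h : (∏ i, a i) ^ d = 1) : monomialGroup U n d := ⟨⟨a, σ⟩, h⟩

@[simp] lemma entry_mk (a : n → U) (σ : Perm n) (h : (∏ i, a i) ^ d = 1) (i : n) :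
    entry (mk a σ h) i = a i := rfl

@[simp] lemma perm_mk (a : n → U) (σ : Perm n) (h : (∏ i, a i) ^ d = 1) :
    perm (mk a σ h) = σ := rfl

lemma prod_entry (g : monomialGroup U n d) : (∏ i, entry g i) ^ d = 1 := g.2

@[simp] lemma entry_one (i : n) : entry (1 : monomialGroup U n d) i = 1 := rfl

@[simp] lemma entry_mul (g h : monomialGroup U n d) (i : n) :
    entry (g * h) i = entry g i * entry h ((perm g)⁻¹ i) := rfl

@[simp] lemma entry_inv (g : monomialGroup U n d) (i : n) :
    entry g⁻¹ i = (entry g (perm g i))⁻¹ := rfl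

lemma ext' {g h : monomialGroup U n d} (h₁ : ∀ i, entry g i = entry h i)
    (h₂ : perm g = perm h) : g = h :=
  Subtype.ext (SemidirectProduct.ext (funext h₁) h₂)

lemma entry_pow {g : monomialGroup U n d} (hg : perm g = 1) (k : ℕ) (i : n) :
    entry (g ^ k) i = entry g i ^ k := by
  induction k with
  | zero => simp
  | succ k ih => simp [pow_succ, ih, hg]

instance [Finite U] : Finite (monomialGroup U n d) := by
  classical
  have : Function.Injective fun g : monomialGroup U n d => (entry g, perm g) := by
    intro g h hgh
    simp only [Prod.mk.injEq] at hgh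
    exact ext' (congrFun hgh.1) hgh.2
  exact Finite.of_injective _ this

/-- The permutation matrices. -/
def ofPerm (σ : Perm n) : monomialGroup U n d := mk 1 σ (by simp)

@[simp] lemma entry_ofPerm (σ : Perm n) (i : n) :
    entry (ofPerm σ : monomialGroup U n d) i = 1 := rfl

@[simp] lemma perm_ofPerm (σ : Perm n) : perm (ofPerm σ : monomialGroup U n d) = σ := rfl

@[simp] lemma ofPerm_mul (σ τ : Perm n) :
    (ofPerm (σ * τ) : monomialGroup U n d) = ofPerm σ * ofPerm τ :=
  ext' (by simp) (by simp)

/-- Scalar matrices. -/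
def scalar (x : U) (hx : (x ^ Fintype.card n) ^ d = 1) : monomialGroup U n d :=
  mk (fun _ => x) 1 (by simpa using hx)

@[simp] lemma entry_scalar (x : U) (hx : (x ^ Fintype.card n) ^ d = 1) (k : n) :
    entry (scalar x hx : monomialGroup U n d) k = x := rfl

@[simp] lemma perm_scalar (x : U) (hx : (x ^ Fintype.card n) ^ d = 1) :
    perm (scalar x hx : monomialGroup U n d) = 1 := rfl

lemma mem_center_of_const {g : monomialGroup U n d} (hg : perm g = 1)
    (h : ∀ i j, entry g i = entry g j) : g ∈ Subgroup.center (monomialGroup U n d) := by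
  rw [Subgroup.mem_center_iff]
  refine fun k => ext' (fun i => ?_) (by simp [hg])
  simp only [entry_mul, hg, inv_one, Perm.coe_one, id_eq]
  rw [h _ i, mul_comm]

lemma exists_notMem {k : ℕ} (h : k < Fintype.card n) (s : Finset n) (hs : s.card ≤ k) :
    ∃ x, x ∉ s := by
  obtain ⟨x, -, hx⟩ := Finset.exists_mem_notMem_of_card_lt_card (s := s) (t := Finset.univ)
    (by simpa using hs.trans_lt h)
  exact ⟨x, hx⟩

/-- The product of the nonzero entries. -/
def prodEntry : monomialGroup U n d →* U where
  toFun g := ∏ i, entry g i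
  map_one' := by simp
  map_mul' g h := by
    simp only [entry_mul, Finset.prod_mul_distrib]
    rw [Equiv.prod_comp ((perm g)⁻¹ : Perm n) (entry h)]

lemma prodEntry_pow (g : monomialGroup U n d) : prodEntry g ^ d = 1 := prod_entry g

lemma prodEntry_apply (g : monomialGroup U n d) : prodEntry g = ∏ i, entry g i := rfl

variable [DecidableEq n]

/-- The diagonal matrix with entry `x` at `i` and all other entries equal to `1`. -/
def single (i : n) (x : U) (hx : x ^ d = 1) : monomialGroup U n d :=
  mk (Pi.mulSingle i x) 1 (by simpa using hx)

@[simp] lemma entry_single (i : n) (x : U) (hx : x ^ d = 1) (k : n) :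
    entry (single i x hx) k = if k = i then x else 1 := by
  simp [single, Pi.mulSingle_apply]

@[simp] lemma perm_single (i : n) (x : U) (hx : x ^ d = 1) : perm (single i x hx) = 1 := rfl

/-- The diagonal matrix with entry `x` at `i`, `x⁻¹` at `j` and all other entries equal to `1`. -/
def pair (i j : n) (x : U) : monomialGroup U n d :=
  mk (Pi.mulSingle i x * Pi.mulSingle j x⁻¹) 1 (by simp [Finset.prod_mul_distrib])

@[simp] lemma entry_pair (i j : n) (x : U) (k : n) :
    entry (pair i j x : monomialGroup U n d) k =
      (if k = i then x else 1) * (if k = j then x⁻¹ else 1) := by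
  simp [pair, Pi.mulSingle_apply]

@[simp] lemma perm_pair (i j : n) (x : U) : perm (pair i j x : monomialGroup U n d) = 1 := rfl

/-- Reflections whose underlying permutation is a transposition. -/
def IsSwapReflection (g : monomialGroup U n d) : Prop :=
  ∃ i j, i ≠ j ∧ perm g = swap i j ∧ entry g i * entry g j = 1 ∧
    ∀ k, k ≠ i → k ≠ j → entry g k = 1

/-- Diagonal reflections. -/
def IsDiagReflection (g : monomialGroup U n d) : Prop :=
  ∃ i, perm g = 1 ∧ entry g i ≠ 1 ∧ ∀ k, k ≠ i → entry g k = 1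

/-- The elements of `monomialGroup` which correspond to reflections. -/
def IsReflection (g : monomialGroup U n d) : Prop := IsSwapReflection g ∨ IsDiagReflection g

lemma IsSwapReflection.perm_ne_one {g : monomialGroup U n d} (hg : IsSwapReflection g) :
    perm g ≠ 1 := by
  obtain ⟨i, j, hij, hs, -⟩ := hg
  rw [hs]
  simpa [swap_eq_one_iff] using hij

lemma IsSwapReflection.sq {g : monomialGroup U n d} (hg : IsSwapReflection g) : g * g = 1 := by
  obtain ⟨i, j, hij, hs, h, hk⟩ := hg
  refine ext' (fun k => ?_) (by simp [hs])
  by_cases h1 : k = i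
  · simp [hs, h1, h]
  by_cases h2 : k = j
  · simp [hs, h2, mul_comm, h]
  simp [hs, swap_apply_of_ne_of_ne h1 h2, hk k h1 h2]

lemma IsSwapReflection.conj {g : monomialGroup U n d} (hg : IsSwapReflection g)
    (u : monomialGroup U n d) : IsSwapReflection (u * g * u⁻¹) := by
  obtain ⟨i, j, hij, hs, h, hk⟩ := hg
  have hp : perm (u * g * u⁻¹) = swap (perm u i) (perm u j) := by
    simp [hs, Equiv.swap_apply_apply]
  refine ⟨perm u i, perm u j, by simpa using hij, hp, ?_, fun k h1 h2 => ?_⟩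
  · have key : ∀ a b x y : U, a * x * b⁻¹ * (b * y * a⁻¹) = x * y := by
      intro a b x y
      rw [← mul_inv_cancel_right (x * y) a, mul_comm (x * y) a]
      group
    simp [hs]
    rw [key, h]
  · obtain ⟨l, rfl⟩ := (perm u).surjective k
    have h1' : l ≠ i := by rintro rfl; simp at h1
    have h2' : l ≠ j := by rintro rfl; simp at h2
    simp [hs, swap_apply_of_ne_of_ne h1' h2', hk l h1' h2']

lemma IsDiagReflection.exists_eq_single {g : monomialGroup U n d} (hg : IsDiagReflection g) :
    ∃ i x, ∃ hx : x ^ d = 1, x ≠ 1 ∧ g = single i x hx := by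
  obtain ⟨i, hp, hi, hk⟩ := hg
  have hx : entry g i ^ d = 1 := by
    have := prod_entry g
    rwa [Finset.prod_eq_single i (fun b _ hb => hk b hb) (by simp)] at this
  refine ⟨i, entry g i, hx, hi, ext' (fun k => ?_) (by simp [hp])⟩
  by_cases h : k = i
  · simp [h]
  · simp [h, hk k h]

lemma isDiagReflection_single {i : n} {x : U} {hx : x ^ d = 1} (h : x ≠ 1) :
    IsDiagReflection (single i x hx : monomialGroup U n d) :=
  ⟨i, by simp, by simpa using h, fun k hk => by simp [hk]⟩

lemma isSwapReflection_ofPerm {i j : n} (hij : i ≠ j) :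
    IsSwapReflection (ofPerm (swap i j) : monomialGroup U n d) :=
  ⟨i, j, hij, by simp, by simp, by simp⟩

lemma ofPerm_mul_single (σ : Perm n) (i : n) (x : U) (hx : x ^ d = 1) :
    (ofPerm σ * single i x hx : monomialGroup U n d) = single (σ i) x hx * ofPerm σ := by
  refine ext' (fun k => ?_) (by simp)
  simp [Equiv.symm_apply_eq]

/-- Any two reflections over transpositions are conjugate in rank at least three. -/
lemma IsSwapReflection.exists_conj_eq (hn : 3 ≤ Fintype.card n) {g h : monomialGroup U n d}
    (hg : IsSwapReflection g) (hh : IsSwapReflection h) : ∃ u, h = u * g * u⁻¹ := by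
  have key : ∀ g : monomialGroup U n d, IsSwapReflection g → ∀ i₀ j₀ : n, i₀ ≠ j₀ →
      ∃ u, ofPerm (swap i₀ j₀) = u * g * u⁻¹ := by
    intro g hg i₀ j₀ h₀
    have : ∃ u : monomialGroup U n d, perm (u * g * u⁻¹) = swap i₀ j₀ := by
      obtain ⟨i, j, hij, hs, -⟩ := hg
      obtain ⟨c, hc⟩ := (Perm.isConj_swap hij h₀)
      refine ⟨ofPerm c, ?_⟩
      have hc' := hc.eq
      simp only [map_mul, perm_ofPerm, map_inv, hs]
      rw [hc', mul_inv_cancel_right]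
    obtain ⟨u, hu⟩ := this
    obtain ⟨l, hl⟩ := exists_notMem (n := n) (k := 2) hn {i₀, j₀} Finset.card_le_two
    simp only [Finset.mem_insert, Finset.mem_singleton, not_or] at hl
    set g' := u * g * u⁻¹ with hg'
    have hg'r : IsSwapReflection g' := hg.conj u
    obtain ⟨i, j, hij, hs, h1, hk⟩ := hg'r
    have h2 : entry g' i₀ * entry g' j₀ = 1 := by
      have h3 := (IsSwapReflection.sq ⟨i, j, hij, hs, h1, hk⟩ : g' * g' = 1)
      have := congrArg (fun x => entry x i₀) h3
      simpa [hu] using this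
    have h3 : ∀ k, k ≠ i₀ → k ≠ j₀ → entry g' k = 1 := by
      intro k hki hkj
      have h4 : swap i j k = k := by
        rw [← hs, hu, swap_apply_of_ne_of_ne hki hkj]
      apply hk
      · rintro rfl; simp [hij.symm] at h4
      · rintro rfl; simp [hij] at h4
    refine ⟨pair l i₀ (entry g' i₀) * u, ?_⟩
    have : pair l i₀ (entry g' i₀) * u * g * (pair l i₀ (entry g' i₀) * u)⁻¹ =
      pair l i₀ (entry g' i₀) * g' * (pair l i₀ (entry g' i₀))⁻¹ := by rw [hg']; group
    rw [this]
    refine ext' (fun k => ?_) (by simp [hu])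
    by_cases k1 : k = i₀
    · subst k1; simp [hu, h₀.symm, Ne.symm hl.1, Ne.symm hl.2]
    by_cases k2 : k = j₀
    · subst k2; simp [hu, Ne.symm hl.1, Ne.symm hl.2, k1, mul_comm, h2]
    simp [hu, k1, swap_apply_of_ne_of_ne k1 k2, h3 k k1 k2]
  obtain ⟨i, j, hij, -⟩ := id hg
  obtain ⟨u, hu⟩ := key g hg i j hij
  obtain ⟨v, hv⟩ := key h hh i j hij
  refine ⟨v⁻¹ * u, ?_⟩
  have : h = v⁻¹ * (v * h * v⁻¹) * v := by group
  rw [this, ← hv, hu]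
  group

/-- If `φ` maps the elements of `R` into `R` up to a central-valued homomorphism `z`,
then `φ` decomposes as an `R`-preserving automorphism times a central one. -/
lemma exists_decomposition {G : Type*} [Group G] [Finite G] (R : G → Prop) (φ : MulAut G)
    (z : G →* G) (hz : ∀ g, z g ∈ Subgroup.center G)
    (hR : ∀ g, R g → R (φ g * (z g)⁻¹)) (hinj : ∀ g, φ g = z g → g = 1) :
    ∃ β α : MulAut G, (∀ g, R g ↔ R (β g)) ∧
      (∀ g, g⁻¹ * α g ∈ Subgroup.center G) ∧ φ = β * α := by
  have hzc : ∀ g h, h * z g = z g * h := fun g h => Subgroup.mem_center_iff.1 (hz g) h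
  have hzc' : ∀ g h, h * (z g)⁻¹ = (z g)⁻¹ * h := fun g h =>
    Subgroup.mem_center_iff.1 (inv_mem (hz g)) h
  let ψ : G →* G := MonoidHom.mk' (fun g => φ g * (z g)⁻¹) (by
    intro g h
    rw [map_mul, map_mul, mul_inv_rev, hzc' g, mul_assoc (φ g), ← mul_assoc (φ h),
      mul_assoc (φ g), hzc' g, mul_assoc])
  have hψ : Function.Injective ψ := by
    rw [injective_iff_map_eq_one]
    intro g hg
    exact hinj g (mul_inv_eq_one.1 hg)
  let β : MulAut G := MulEquiv.ofBijective ψ (Finite.injective_iff_bijective.1 hψ)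
  have hβ : ∀ g, β g = φ g * (z g)⁻¹ := fun g => rfl
  have hfin : (Set.ncard {g | R g}) = Set.ncard (β '' {g | R g}) :=
    (Set.ncard_image_of_injective _ β.injective).symm
  have himg : β '' {g | R g} = {g | R g} :=
    Set.eq_of_subset_of_ncard_le (by rintro _ ⟨g, hg, rfl⟩; exact hR g hg) hfin.le
  refine ⟨β, β⁻¹ * φ, fun g => ⟨hR g, fun h => ?_⟩, fun g => ?_, by group⟩
  · have h' : β g ∈ β '' {g | R g} := himg.symm ▸ (h : β g ∈ {g | R g})
    obtain ⟨g', hg', he⟩ := h'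
    exact β.injective he ▸ hg'
  · have h1 : β (g⁻¹ * (β⁻¹ * φ) g) = z g := by
      rw [MulAut.mul_apply, map_mul, MulAut.apply_inv_self, map_inv, hβ, mul_inv_rev, inv_inv,
        inv_mul_cancel_right]
    rw [Subgroup.mem_center_iff]
    intro k
    apply β.injective
    rw [map_mul β k, map_mul β _ k, h1, hzc]

@[simp] lemma prodEntry_single (i : n) (x : U) (hx : x ^ d = 1) :
    prodEntry (single i x hx) = x := by
  simp [prodEntry_apply]

/-- The sign character with values in `{1, w}` for an element `w` of order dividing two. -/
def signHom (w : U) (hw : w * w = 1) : monomialGroup U n d →* U :=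
  (MonoidHom.mk' (fun u : ℤˣ => if u = 1 then 1 else w) (by
    intro a b
    rcases Int.units_eq_one_or a with rfl | rfl <;>
    rcases Int.units_eq_one_or b with rfl | rfl <;> simp [hw])).comp (Perm.sign.comp perm)

lemma signHom_of_perm_eq_one (w : U) (hw : w * w = 1) {g : monomialGroup U n d}
    (hg : perm g = 1) : signHom w hw g = 1 := by simp [signHom, hg]

lemma signHom_of_isSwapReflection (w : U) (hw : w * w = 1) {g : monomialGroup U n d}
    (hg : IsSwapReflection g) : signHom w hw g = w := by
  obtain ⟨i, j, hij, hs, -⟩ := hg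
  simp [signHom, hs, Perm.sign_swap hij]

/-- Scalar matrices with entries given by a character. -/
def scalarHom (χ : monomialGroup U n d →* U) (hχ : ∀ g, (χ g ^ Fintype.card n) ^ d = 1) :
    monomialGroup U n d →* monomialGroup U n d :=
  MonoidHom.mk' (fun g => scalar (χ g) (hχ g)) (fun g h => ext' (by simp) (by simp))

/-- Suppose `φ` maps transposition-type reflections to reflections up to the scalar `w`, and the
diagonal reflections based at `i₀` to diagonal reflections up to a scalar given by the character
`χ`. Then `φ` decomposes. -/
lemma decomposition_of_characters [Finite U] (hn : 2 ≤ Fintype.card n)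
    (hcenter : ∀ g ∈ Subgroup.center (monomialGroup U n d), perm g = 1)
    (φ : MulAut (monomialGroup U n d)) (w : U) (hw : w * w = 1)
    (hwd : (w ^ Fintype.card n) ^ d = 1)
    (hswap : ∀ g, IsSwapReflection g →
      ∃ g', IsSwapReflection g' ∧ φ g = scalar w hwd * g')
    (i₀ : n) (χ : monomialGroup U n d →* U) (hχ : ∀ g, (χ g ^ Fintype.card n) ^ d = 1)
    (hχd : ∀ g, perm g = 1 → prodEntry g = 1 → χ g = 1)
    (hχs : ∀ g, IsSwapReflection g → χ g = 1)
    (hdiag : ∀ x, ∀ hx : x ^ d = 1, ∃ q y, ∃ hy : y ^ d = 1,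
      φ (single i₀ x hx) = scalar (χ (single i₀ x hx)) (hχ _) * single q y hy) :
    ∃ β α : MulAut (monomialGroup U n d), (∀ g, IsReflection g ↔ IsReflection (β g)) ∧
      (∀ g, g⁻¹ * α g ∈ Subgroup.center (monomialGroup U n d)) ∧ φ = β * α := by
  have hconj : ∀ i x (hx : x ^ d = 1), ∃ u : monomialGroup U n d,
      single i x hx = u * single i₀ x hx * u⁻¹ := by
    intro i x hx
    refine ⟨ofPerm (swap i₀ i), ?_⟩
    rw [ofPerm_mul_single, mul_inv_cancel_right, swap_apply_left]
  have hscc : ∀ (x : U) hx (u : monomialGroup U n d), u * scalar x hx = scalar x hx * u :=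
    fun x hx u => Subgroup.mem_center_iff.1 (mem_center_of_const (by simp) (by simp)) u
  have hsingle : ∀ q y (hy : y ^ d = 1) (u : monomialGroup U n d),
      u * single q y hy * u⁻¹ = single (perm u q) y hy := by
    intro q y hy u
    refine ext' (fun k => ?_) (by simp)
    by_cases hk : k = perm u q
    · simp [hk]
    · have : (perm u)⁻¹ k ≠ q := by rintro rfl; simp at hk
      simp only [entry_mul, entry_single, this, hk, if_false, mul_one, perm_single, entry_inv,
        mul_inv_eq_one, map_mul]
      simp
  have hdiag' : ∀ x, ∀ hx : x ^ d = 1, ∃ y, ∃ hy : y ^ d = 1, ∀ i, ∃ q,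
      φ (single i x hx) = scalar (χ (single i₀ x hx)) (hχ _) * single q y hy := by
    intro x hx
    obtain ⟨q, y, hy, h⟩ := hdiag x hx
    refine ⟨y, hy, fun i => ?_⟩
    obtain ⟨u, hu⟩ := hconj i x hx
    refine ⟨perm (φ u) q, ?_⟩
    rw [hu, map_mul, map_mul, h, map_inv, ← mul_assoc, hscc, mul_assoc _ (φ u), mul_assoc,
      hsingle]
  have hχi : ∀ i x (hx : x ^ d = 1), χ (single i x hx) = χ (single i₀ x hx) := by
    intro i x hx
    obtain ⟨u, hu⟩ := hconj i x hx
    rw [hu, map_mul, map_mul, map_inv, mul_comm, inv_mul_cancel_left]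
  have hζ : ∀ g, ((χ * signHom w hw : monomialGroup U n d →* U) g ^ Fintype.card n) ^ d = 1 := by
    intro g
    have : signHom w hw g = 1 ∨ signHom w hw g = w := by
      simp only [signHom, MonoidHom.comp_apply, MonoidHom.mk'_apply]
      split_ifs <;> simp
    rcases this with h | h <;> simp [mul_pow, h, hχ, hwd]
  refine exists_decomposition IsReflection φ (scalarHom (χ * signHom w hw) hζ)
    (fun g => mem_center_of_const rfl (fun i j => rfl)) ?_ ?_
  · rintro g (hg | hg)
    · left
      obtain ⟨g', hg', h⟩ := hswap g hg
      have : scalarHom (χ * signHom w hw) hζ g = scalar w hwd :=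
        ext' (fun i => by simp [scalarHom, hχs g hg, signHom_of_isSwapReflection w hw hg]) rfl
      rwa [this, h, ← hscc, mul_inv_cancel_right]
    · right
      obtain ⟨i, x, hx, hx1, rfl⟩ := hg.exists_eq_single
      obtain ⟨y, hy, h⟩ := hdiag' x hx
      obtain ⟨q, hq⟩ := h i
      have h1 : scalarHom (χ * signHom w hw) hζ (single i x hx) =
          scalar (χ (single i₀ x hx)) (hχ _) :=
        ext' (fun k => by
          simp [scalarHom, hχi i, signHom_of_perm_eq_one w hw (perm_single i x hx)]) rfl
      rw [h1, hq, ← hscc, mul_inv_cancel_right]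
      apply isDiagReflection_single
      rintro rfl
      have h2 : single i x hx ∈ Subgroup.center (monomialGroup U n d) := by
        have h3 : φ (single i x hx) ∈ Subgroup.center (monomialGroup U n d) := by
          rw [hq]; exact mem_center_of_const (by simp) (by simp)
        rw [Subgroup.mem_center_iff] at h3 ⊢
        intro u
        apply φ.injective
        rw [map_mul, map_mul, h3]
      obtain ⟨j, hj⟩ := exists_notMem (n := n) (k := 1) hn {i} (by simp)
      simp only [Finset.mem_singleton] at hj
      have h4 := congrArg (fun g => entry g j)
        (Subgroup.mem_center_iff.1 h2 (ofPerm (swap i j)))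
      simp [hj, hx1] at h4
  · intro g hg
    have hgc : g ∈ Subgroup.center (monomialGroup U n d) := by
      have h3 : φ g ∈ Subgroup.center (monomialGroup U n d) := by
        rw [hg]; exact mem_center_of_const rfl (fun i j => rfl)
      rw [Subgroup.mem_center_iff] at h3 ⊢
      intro u
      apply φ.injective
      rw [map_mul, map_mul, h3]
    have hp := hcenter g hgc
    have hconst : ∀ i, entry g i = entry g i₀ := by
      intro i
      have h4 := congrArg (fun g => entry g i)
        (Subgroup.mem_center_iff.1 hgc (ofPerm (swap i i₀)))
      simpa [hp] using h4.symm
    set l := entry g i₀ with hl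
    have hx : prodEntry g ^ d = 1 := prodEntry_pow g
    have hxl : prodEntry g = l ^ Fintype.card n := by
      simp [prodEntry_apply, hconst]
    set x := prodEntry g with hxdef
    have hχg : χ g = χ (single i₀ x hx) := by
      have h5 := hχd (g * (single i₀ x hx)⁻¹) (by simp [hp]) (by simp [hxdef])
      rwa [map_mul, map_inv, mul_inv_eq_one] at h5
    have hzg : φ g = scalar (χ (single i₀ x hx)) (hχ _) := by
      rw [hg]
      exact ext' (fun i => by simp [scalarHom, signHom_of_perm_eq_one w hw hp, hχg]) rfl
    obtain ⟨y, hy, h⟩ := hdiag' x hx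
    by_cases hx1 : x = 1
    · apply φ.injective
      have h6 : single i₀ x hx = 1 := ext' (by simp [hx1]) (by simp)
      rw [hzg, map_one]
      exact ext' (by simp [h6]) (by simp)
    choose q hq using h
    have hy1 : y = 1 := by
      by_contra hy1
      have hqinj : Function.Injective q := by
        intro i j hij
        have h7 : single i x hx = single j x hx := φ.injective (by rw [hq, hq, hij])
        by_contra hne
        have h8 := congrArg (fun g => entry g i) h7
        simp [hne, hx1] at h8
      have key : ∀ S : Finset n, ∃ T : monomialGroup U n d, perm T = 1 ∧
          (∀ i, entry T i = if i ∈ S then x else 1) ∧ perm (φ T) = 1 ∧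
          ∀ i, entry (φ T) (q i) = χ (single i₀ x hx) ^ S.card * if i ∈ S then y else 1 := by
        intro S
        induction S using Finset.induction_on with
        | empty => exact ⟨1, by simp⟩
        | insert a S ha ih =>
          obtain ⟨T, h1, h2, h3, h4⟩ := ih
          refine ⟨single a x hx * T, by simp [h1], fun i => ?_, by simp [hq, h3], fun i => ?_⟩
          · by_cases hi : i = a
            · simp [hi, h2, ha]
            · simp [hi, h2]
          · by_cases hi : i = a
            · simp [hi, h4, hq, ha, Finset.card_insert_of_notMem, pow_succ, mul_comm, mul_assoc]
              rw [mul_left_comm]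
            · simp [hi, h4, hq, ha, Finset.card_insert_of_notMem, pow_succ,
                mul_comm, mul_left_comm, hqinj.eq_iff]
      obtain ⟨T, h1, h2, h3, h4⟩ := key Finset.univ
      have hT : T = g ^ Fintype.card n :=
        ext' (fun i => by simp [h2, entry_pow hp, hconst, hxl]) (by simp [h1, hp])
      have h9 := h4 i₀
      rw [hT, map_pow, hzg, entry_pow (by simp)] at h9
      simp [Ne.symm, hy1] at h9
    have h10 : single i₀ x hx = g := φ.injective (by
      rw [hq, hzg]
      exact ext' (by simp [hy1]) (by simp))
    exfalso
    obtain ⟨j, hj⟩ := exists_notMem (n := n) (k := 1) hn {i₀} (by simp)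
    simp only [Finset.mem_singleton] at hj
    have h11 := congrArg (fun g => entry g j) h10
    have h12 := hconst j
    simp [hj] at h11
    rw [← h11] at h12
    exact hx1 (by rw [hxl, ← h12, one_pow])

lemma exists_perm_apply_eq {n : Type*} [DecidableEq n] {p q i j : n} (hpq : p ≠ q) (hij : i ≠ j) :
    ∃ σ : Perm n, σ p = i ∧ σ q = j := by
  refine ⟨swap (swap p i q) j * swap p i, ?_, by simp⟩
  have h : i ≠ swap p i q := by
    have := (swap p i).injective.ne hpq
    rwa [swap_apply_left] at this
  simp [swap_apply_of_ne_of_ne h hij]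

/-- If an automorphism maps a diagonal element to a nondiagonal one with permutation `τ`, then
`τ` acts on diagonal elements up to scalars only. -/
lemma entry_mul_eq_of_perm_ne_one (φ : MulAut (monomialGroup U n d)) {a : monomialGroup U n d}
    (ha : perm a = 1) (hτ : perm (φ a) ≠ 1) (v : n → U) (hv : (∏ i, v i) ^ d = 1) (i j : n) :
    v ((perm (φ a))⁻¹ i) * v j = v ((perm (φ a))⁻¹ j) * v i := by
  rcases eq_or_ne i j with rfl | hij
  · rfl
  obtain ⟨p, hp⟩ : ∃ p, (perm (φ a))⁻¹ p ≠ p := by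
    by_contra! h
    exact hτ (inv_eq_one.1 (Perm.ext h))
  obtain ⟨σ, h1, h2⟩ := exists_perm_apply_eq hp.symm hij
  set g : monomialGroup U n d := ofPerm σ
  set a' : monomialGroup U n d := mk v 1 hv
  set c := φ a * a' * (φ a)⁻¹ * a'⁻¹ with hc
  have hcomm : ∀ x y : monomialGroup U n d, perm x = 1 → perm y = 1 → x * y = y * x :=
    fun x y hx hy => ext' (fun i => by simp [hx, hy, mul_comm]) (by simp [hx, hy])
  have h3 := congrArg φ (hcomm (φ.symm g * a * (φ.symm g)⁻¹)
    (a * φ.symm a' * a⁻¹ * (φ.symm a')⁻¹) (by simp [ha]) (by simp [ha]))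
  simp only [map_mul, map_inv, MulEquiv.apply_symm_apply, ← hc] at h3
  have hpc : perm c = 1 := by simp [hc, a']
  have h4 := congrArg (fun x => entry x i) h3
  rw [entry_mul, entry_mul c, hpc, inv_one, Perm.one_apply, mul_comm] at h4
  have h4 := mul_right_cancel h4
  have h5 : (perm (g * φ a * g⁻¹))⁻¹ i = j := by
    rw [← h1, ← h2]
    simp [g]
  rw [h5] at h4
  simp only [hc, a', entry_mul, entry_mk, entry_inv, perm_mk, map_mul, map_inv, mul_one,
    Perm.one_apply] at h4
  have h6 : ∀ i, entry (φ a) i * v ((perm (φ a))⁻¹ i) *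
      (entry (φ a) (perm (φ a) ((perm (φ a))⁻¹ i)))⁻¹ * (v ((perm (φ a) * (perm (φ a))⁻¹)⁻¹ i))⁻¹ =
      v ((perm (φ a))⁻¹ i) * (v i)⁻¹ := by
    intro i
    simp [mul_comm]
  rw [h6, h6, ← div_eq_mul_inv, ← div_eq_mul_inv, div_eq_div_iff_mul_eq_mul] at h4
  exact h4.symm

lemma sq_eq_one_of_scalar_action {τ : Perm n}
    (H : ∀ v : n → U, (∏ i, v i) ^ d = 1 → ∀ i j, v (τ i) * v j = v (τ j) * v i)
    {p : n} (hp : τ p ≠ p) {η : U} (hη : η ^ d = 1) :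
    η ^ 2 = 1 := by
  have := H (Pi.mulSingle (τ p) η) (by simpa using hη) p (τ p)
  have h2 : τ (τ p) ≠ τ p := τ.injective.ne hp
  simpa [Pi.mulSingle_apply, hp, hp.symm, h2, pow_two] using this

lemma eq_one_of_scalar_action {τ : Perm n}
    (H : ∀ v : n → U, (∏ i, v i) ^ d = 1 → ∀ i j, v (τ i) * v j = v (τ j) * v i)
    {p k : n} (hp : τ p ≠ p) (hkp : k ≠ p) (hkq : k ≠ τ p) {η : U}
    (hη : η ^ d = 1) : η = 1 := by
  have := H (Pi.mulSingle (τ p) η) (by simpa using hη) p k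
  simpa [Pi.mulSingle_apply, hp, hp.symm, hkp, hkq] using this

lemma pow_three_eq_one_of_scalar_action {τ : Perm n}
    (H : ∀ v : n → U, (∏ i, v i) ^ d = 1 → ∀ i j, v (τ i) * v j = v (τ j) * v i)
    {p j : n} (hp : τ p ≠ p) (hjp : j ≠ p) (hjq : j ≠ τ p)
    (hcard : ∀ k, k = p ∨ k = τ p ∨ k = j) (x : U) : x ^ 3 = 1 := by
  have hv : (∏ i, (Pi.mulSingle (τ p) x * Pi.mulSingle j x⁻¹ : n → U) i) ^ d = 1 := by
    simp [Finset.prod_mul_distrib]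
  have h2 : τ (τ p) ≠ τ p := τ.injective.ne hp
  rcases eq_or_ne (τ (τ p)) j with h | h
  · have := H _ hv p (τ p)
    simp [h, hp.symm, hjp.symm, hjq, hjq.symm] at this
    rw [pow_succ, pow_two, this, inv_mul_cancel]
  · have h3 : τ (τ p) = p := by
      rcases hcard (τ (τ p)) with h | h | h <;> simp_all
    have h4 : τ j = j := by
      rcases hcard (τ j) with h | h | h
      · exact absurd (τ.injective (h.trans h3.symm)) hjq
      · exact absurd (τ.injective h) hjp
      · exact h
    have := H _ hv p j
    simp [h4, hp.symm, hjp.symm, hjq, hjq.symm] at this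
    simp [this]

lemma eq_one_or_of_scalar_action {τ : Perm n}
    (H : ∀ v : n → U, (∏ i, v i) ^ d = 1 → ∀ i j, v (τ i) * v j = v (τ j) * v i)
    {p j k : n} (hp : τ p ≠ p) (hjp : j ≠ p) (hjq : j ≠ τ p)
    (hkp : k ≠ p) (hkq : k ≠ τ p) (hkj : k ≠ j) (x : U) : x = 1 ∨ τ k = j ∧ x ^ 2 = 1 := by
  have hv : (∏ i, (Pi.mulSingle (τ p) x * Pi.mulSingle j x⁻¹ : n → U) i) ^ d = 1 := by
    simp [Finset.prod_mul_distrib]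
  have := H _ hv p k
  by_cases h : τ k = j
  · simp [h, hp.symm, hjp.symm, hjq, hjq.symm, hkq, hkj] at this
    right
    refine ⟨h, ?_⟩
    nth_rewrite 1 [pow_two, this]
    rw [inv_mul_cancel]
  · simp [h, hp.symm, hjp.symm, hjq.symm, hkp, hkq, hkj] at this
    exact .inl this

/-- The diagonal subgroup is preserved by automorphisms, apart from small exceptions. -/
lemma perm_map_eq_one_or (hn : 3 ≤ Fintype.card n) (φ : MulAut (monomialGroup U n d)) :
    (∀ a, perm a = 1 → perm (φ a) = 1) ∨ (∀ η : U, η ^ d = 1 → η = 1) ∧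
      ((Fintype.card n = 3 ∧ ∀ x : U, x ^ 3 = 1) ∨ (Fintype.card n = 4 ∧ ∀ x : U, x ^ 2 = 1) ∨
        ∀ x : U, x = 1) := by
  by_contra! hcon
  obtain ⟨⟨a, ha, hτ⟩, hcon⟩ := hcon
  have H := entry_mul_eq_of_perm_ne_one φ ha hτ
  set τ := (perm (φ a))⁻¹
  obtain ⟨p, hp⟩ : ∃ p, τ p ≠ p := by
    by_contra! h
    exact hτ (inv_eq_one.1 (Perm.ext h))
  obtain ⟨j, hj⟩ := exists_notMem (n := n) (k := 2) hn {p, τ p} Finset.card_le_two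
  simp only [Finset.mem_insert, Finset.mem_singleton, not_or] at hj
  obtain ⟨h3, h4, x, hx⟩ := hcon fun η hη => eq_one_of_scalar_action H hp hj.1 hj.2 hη
  have hcard : 4 ≤ Fintype.card n := by
    by_contra hlt
    obtain ⟨x, hx⟩ := h3 (by omega)
    refine hx (pow_three_eq_one_of_scalar_action H hp hj.1 hj.2 (fun k => ?_) x)
    by_contra! hk
    have := Finset.card_le_univ ({p, τ p, j, k} : Finset n)
    rw [Finset.card_insert_of_notMem (by simp [hp.symm, Ne.symm hj.1, hk.1.symm]),
      Finset.card_insert_of_notMem (by simp [Ne.symm hj.2, hk.2.1.symm]),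
      Finset.card_pair hk.2.2.symm] at this
    omega
  obtain ⟨k, hk⟩ := exists_notMem (n := n) (k := 3) hcard {p, τ p, j} Finset.card_le_three
  simp only [Finset.mem_insert, Finset.mem_singleton, not_or] at hk
  have h5 := fun x => eq_one_or_of_scalar_action H hp hj.1 hj.2 hk.1 hk.2.1 hk.2.2 x
  have hcard : 5 ≤ Fintype.card n := by
    by_contra hlt
    obtain ⟨x, hx⟩ := h4 (by omega)
    rcases h5 x with rfl | h <;> simp_all
  obtain ⟨l, hl⟩ := exists_notMem (n := n) (k := 4) hcard {p, τ p, j, k} Finset.card_le_four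
  simp only [Finset.mem_insert, Finset.mem_singleton, not_or] at hl
  have h6 := eq_one_or_of_scalar_action H hp hj.1 hj.2 hl.1 hl.2.1 hl.2.2.1 x
  have h5 := h5 x
  simp only [hx, false_or] at h5 h6
  exact hl.2.2.2 (τ.injective (h6.1.trans h5.1.symm))

lemma swap_mul_swap_pow_six {α : Type*} [Fintype α] [DecidableEq α] {a b c d : α} (hab : a ≠ b)
    (hcd : c ≠ d) : (swap a b * swap c d) ^ 6 = 1 := by
  have key : ∀ a b c : α, a ≠ b → a ≠ c → (swap a b * swap a c) ^ 6 = 1 := by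
    intro a b c hab hac
    rcases eq_or_ne b c with rfl | hbc
    · simp
    · have := (Perm.isThreeCycle_swap_mul_swap_same hab hac hbc).orderOf
      rw [show 6 = 3 * 2 from rfl, pow_mul, ← this, pow_orderOf_eq_one, one_pow]
  rcases eq_or_ne a c with rfl | hac
  · exact key _ _ _ hab hcd
  rcases eq_or_ne a d with rfl | had
  · rw [swap_comm c]; exact key _ _ _ hab hac
  rcases eq_or_ne b c with rfl | hbc
  · rw [swap_comm a]; exact key _ _ _ hab.symm hcd
  rcases eq_or_ne b d with rfl | hbd
  · rw [swap_comm a, swap_comm c]; exact key _ _ _ hab.symm hbc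
  have hd : Perm.Disjoint (swap a b) (swap c d) := by
    intro x
    by_cases h1 : x = a
    · subst h1; exact .inr (swap_apply_of_ne_of_ne hac had)
    by_cases h2 : x = b
    · subst h2; exact .inr (swap_apply_of_ne_of_ne hbc hbd)
    exact .inl (swap_apply_of_ne_of_ne h1 h2)
  rw [hd.commute.mul_pow, show 6 = 2 * 3 from rfl, pow_mul, pow_mul, pow_two, pow_two]
  simp

/-- An involution which is not a transposition moves two disjoint pairs. -/
lemma exists_apply_ne_of_not_isSwap {τ : Perm n} (h1 : τ ≠ 1) (h2 : τ * τ = 1)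
    (h3 : ¬ τ.IsSwap) : ∃ p p', τ p ≠ p ∧ τ p' ≠ p' ∧ p' ≠ p ∧ p' ≠ τ p := by
  obtain ⟨p, hp⟩ : ∃ p, τ p ≠ p := by
    by_contra! h
    exact h1 (Perm.ext h)
  obtain ⟨p', hp'⟩ : ∃ p', τ p' ≠ swap p (τ p) p' := by
    by_contra! h
    exact h3 ⟨p, τ p, hp.symm, Perm.ext h⟩
  have h4 : p' ≠ p := by rintro rfl; simp at hp'
  have h5 : p' ≠ τ p := by
    rintro rfl
    rw [swap_apply_right, ← Perm.mul_apply, h2] at hp'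
    exact hp' rfl
  exact ⟨p, p', hp, by rwa [swap_apply_of_ne_of_ne h4 h5] at hp', h4, h5⟩

/-- Outside of rank six, automorphisms of a symmetric group preserve transpositions. -/
lemma isSwap_map_swap (hn : 5 ≤ Fintype.card n) (hn' : Fintype.card n ≠ 6)
    (θ : MulAut (Perm n)) {i j : n} (hij : i ≠ j) : (θ (swap i j)).IsSwap := by
  by_contra hτ
  set τ := θ (swap i j) with hτdef
  have h2 : τ * τ = 1 := by rw [hτdef, ← map_mul, swap_mul_self, map_one]
  have h2' : ∀ x, τ (τ x) = x := fun x => by rw [← Perm.mul_apply, h2, Perm.one_apply]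
  have h1 : τ ≠ 1 := by
    rw [hτdef, Ne, EmbeddingLike.map_eq_one_iff, swap_eq_one_iff]
    exact hij
  have key : ∀ u : Perm n, (τ * (u * τ * u⁻¹)) ^ 6 = 1 := by
    intro u
    have : τ * (u * τ * u⁻¹) = θ (swap i j * (swap (θ.symm u i) (θ.symm u j))) := by
      rw [Equiv.swap_apply_apply]
      simp [hτdef]
    rw [this, ← map_pow, swap_mul_swap_pow_six hij (by simpa using hij), map_one]
  have happ : ∀ u : Perm n, ∀ x, (τ * (u * τ * u⁻¹)) (u x) = τ (u (τ x)) := fun u x => by simp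
  obtain ⟨a, c, ha, hc, hca, hcb⟩ := exists_apply_ne_of_not_isSwap h1 h2 hτ
  obtain ⟨b, hb⟩ : ∃ b, τ a = b := ⟨_, rfl⟩
  obtain ⟨d, hd⟩ : ∃ d, τ c = d := ⟨_, rfl⟩
  have hb' : τ b = a := by rw [← hb, h2']
  have hd' : τ d = c := by rw [← hd, h2']
  rw [hb] at ha hcb
  rw [hd] at hc
  have hda : d ≠ a := by rintro rfl; exact hcb (hd'.symm.trans hb)
  have hdb : d ≠ b := by rintro rfl; exact hca (hd'.symm.trans hb')
  have hfix : ∀ e, e ≠ a → e ≠ b → e ≠ c → e ≠ d → τ e ≠ e := by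
    intro e hea heb hec hed he
    obtain ⟨u, hu⟩ : ∃ u, u = swap b d * swap a e := ⟨_, rfl⟩
    have ua : u a = e := by simp [swap_apply_of_ne_of_ne, *]
    have ub : u b = d := by
      simp [hu, swap_apply_of_ne_of_ne ha heb.symm]
    have uc : u c = c := by
      simp [hu, swap_apply_of_ne_of_ne hca hec.symm, swap_apply_of_ne_of_ne hcb hc.symm]
    have ud : u d = b := by
      simp [hu, swap_apply_of_ne_of_ne hda hed.symm]
    have ue : u e = a := by
      simp [hu, swap_apply_of_ne_of_ne ha.symm hda.symm]
    have f1 := happ u e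
    have f2 := happ u d
    have f3 := happ u b
    have f4 := happ u a
    have f5 := happ u c
    simp only [ua, ub, uc, ud, ue, he, hb, hd, hb', hd'] at f1 f2 f3 f4 f5
    have := congrArg (fun σ : Perm n => σ a) (key u)
    simp only [pow_succ, pow_zero, one_mul, Perm.mul_apply _ (τ * (u * τ * u⁻¹)), f1, f2, f3, f4,
      f5, Perm.one_apply] at this
    exact ha this
  obtain ⟨e, he⟩ := exists_notMem (n := n) (k := 4) hn {a, b, c, d} Finset.card_le_four
  simp only [Finset.mem_insert, Finset.mem_singleton, not_or, ← ne_eq] at he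
  obtain ⟨hea, heb, hec, hed⟩ := he
  have hfe := hfix e hea heb hec hed
  obtain ⟨f, hf⟩ : ∃ f, τ e = f := ⟨_, rfl⟩
  have hf' : τ f = e := by rw [← hf, h2']
  rw [hf] at hfe
  have hfa : f ≠ a := by rintro rfl; exact heb (hf'.symm.trans hb)
  have hfb : f ≠ b := by rintro rfl; exact hea (hf'.symm.trans hb')
  have hfc : f ≠ c := by rintro rfl; exact hed (hf'.symm.trans hd)
  have hfd : f ≠ d := by rintro rfl; exact hec (hf'.symm.trans hd')
  have hcard : ({a, b, c, d, e, f} : Finset n).card = 6 := by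
    rw [Finset.card_insert_of_notMem, Finset.card_insert_of_notMem, Finset.card_insert_of_notMem,
      Finset.card_insert_of_notMem, Finset.card_pair] <;> grind
  have hcard' := Finset.card_le_univ ({a, b, c, d, e, f} : Finset n)
  obtain ⟨g, hg⟩ := exists_notMem (n := n) (k := 6) (by omega) {a, b, c, d, e, f} hcard.le
  simp only [Finset.mem_insert, Finset.mem_singleton, not_or, ← ne_eq] at hg
  obtain ⟨hga, hgb, hgc, hgd, hge, hgf⟩ := hg
  have hhg := hfix g hga hgb hgc hgd
  obtain ⟨h, hh⟩ : ∃ h, τ g = h := ⟨_, rfl⟩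
  have hh' : τ h = g := by rw [← hh, h2']
  rw [hh] at hhg
  have hha : h ≠ a := by rintro rfl; exact hgb (hh'.symm.trans hb)
  have hhb : h ≠ b := by rintro rfl; exact hga (hh'.symm.trans hb')
  have hhc : h ≠ c := by rintro rfl; exact hgd (hh'.symm.trans hd)
  have hhd : h ≠ d := by rintro rfl; exact hgc (hh'.symm.trans hd')
  have hhe : h ≠ e := by rintro rfl; exact hgf (hh'.symm.trans hf)
  have hhf : h ≠ f := by rintro rfl; exact hge (hh'.symm.trans hf')
  obtain ⟨u, hu⟩ : ∃ u, u = swap a c * swap e g * swap d h := ⟨_, rfl⟩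
  have ua : u a = c := by
    simp [hu, swap_apply_of_ne_of_ne hda.symm hha.symm, swap_apply_of_ne_of_ne hea.symm hga.symm]
  have ub : u b = b := by
    simp [hu, swap_apply_of_ne_of_ne hdb.symm hhb.symm, swap_apply_of_ne_of_ne heb.symm hgb.symm,
      swap_apply_of_ne_of_ne ha hcb.symm]
  have uc : u c = a := by
    simp [hu, swap_apply_of_ne_of_ne hc.symm hhc.symm, swap_apply_of_ne_of_ne hec.symm hgc.symm]
  have ud : u d = h := by
    simp [hu, swap_apply_of_ne_of_ne hhe hhg, swap_apply_of_ne_of_ne hha hhc]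
  have ue : u e = g := by
    simp [hu, swap_apply_of_ne_of_ne hed hhe.symm, swap_apply_of_ne_of_ne hga hgc]
  have uf : u f = f := by
    simp [hu, swap_apply_of_ne_of_ne hfd hhf.symm, swap_apply_of_ne_of_ne hfe hgf.symm,
      swap_apply_of_ne_of_ne hfa hfc]
  have ug : u g = e := by
    simp [hu, swap_apply_of_ne_of_ne hgd hhg.symm, swap_apply_of_ne_of_ne hea hec]
  have uh : u h = d := by
    simp [hu, swap_apply_of_ne_of_ne hed.symm hgd.symm, swap_apply_of_ne_of_ne hda hc]
  have f1 := happ u c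
  have f2 := happ u e
  have f3 := happ u g
  have f4 := happ u a
  simp only [ua, ub, uc, ud, ue, uf, ug, uh, hb, hd, hf, hh, hb', hd', hf', hh'] at f1 f2 f3 f4
  have := congrArg (fun σ : Perm n => σ a) (key u)
  simp only [pow_succ, pow_zero, one_mul, Perm.mul_apply _ (τ * (u * τ * u⁻¹)), f1, f2, f3, f4,
    Perm.one_apply] at this
  exact hea this

lemma perm_eq_one_of_mem_center (hn : 3 ≤ Fintype.card n) {g : monomialGroup U n d}
    (hg : g ∈ Subgroup.center (monomialGroup U n d)) : perm g = 1 := by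
  by_contra h
  obtain ⟨p, hp⟩ : ∃ p, perm g p ≠ p := by
    by_contra! h'
    exact h (Perm.ext h')
  obtain ⟨l, hl⟩ := exists_notMem (n := n) (k := 2) hn {p, perm g p} Finset.card_le_two
  simp only [Finset.mem_insert, Finset.mem_singleton, not_or, ← ne_eq] at hl
  have h1 := congrArg (fun x => perm x p)
    (Subgroup.mem_center_iff.1 hg (ofPerm (swap (perm g p) l)))
  simp [swap_apply_of_ne_of_ne hp.symm hl.1.symm] at h1
  exact hl.2 h1

lemma perm_symm_apply {g y : monomialGroup U n d} (hy : perm y = 1) (h : g * y = y * g) (i : n) :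
    entry y ((perm g)⁻¹ i) = entry y i := by
  have := congrArg (fun x => entry x i) h
  rw [entry_mul, entry_mul, hy, inv_one, Perm.one_apply, mul_comm] at this
  exact mul_right_cancel this

/-- The automorphism of the symmetric group induced by an automorphism preserving the diagonal
subgroup. -/
def permAut (φ : MulAut (monomialGroup U n d)) (hA : ∀ a, perm a = 1 → perm (φ a) = 1)
    (hA' : ∀ a, perm a = 1 → perm (φ.symm a) = 1) : MulAut (Perm n) where
  toFun σ := perm (φ (ofPerm σ))
  invFun σ := perm (φ.symm (ofPerm σ))
  left_inv σ := by
    have := hA' (φ (ofPerm σ) * (ofPerm (perm (φ (ofPerm σ))))⁻¹) (by simp)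
    rw [map_mul, map_inv, MulEquiv.symm_apply_apply, map_mul, map_inv, perm_ofPerm,
      mul_inv_eq_one] at this
    exact this.symm
  right_inv σ := by
    have := hA (φ.symm (ofPerm σ) * (ofPerm (perm (φ.symm (ofPerm σ))))⁻¹) (by simp)
    rw [map_mul, map_inv, MulEquiv.apply_symm_apply, map_mul, map_inv, perm_ofPerm,
      mul_inv_eq_one] at this
    exact this.symm
  map_mul' σ τ := by simp

section Generic

variable {φ : MulAut (monomialGroup U n d)}
  (hA : ∀ a, perm a = 1 → perm (φ a) = 1)
  (hA' : ∀ a, perm a = 1 → perm (φ.symm a) = 1)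

lemma perm_map (g : monomialGroup U n d) : perm (φ g) = permAut φ hA hA' (perm g) := by
  have := hA (g * (ofPerm (perm g))⁻¹) (by simp)
  rwa [map_mul, map_inv, map_mul, map_inv, mul_inv_eq_one] at this

lemma isSwap_permAut_swap_of_nontrivial [Nontrivial U] {i j : n} (hij : i ≠ j) :
    (permAut φ hA hA' (swap i j)).IsSwap := by
  by_contra hτ
  set τ := permAut φ hA hA' (swap i j) with hτdef
  have h2 : τ * τ = 1 := by rw [hτdef, ← map_mul, swap_mul_self, map_one]
  have h2' : ∀ x, τ (τ x) = x := fun x => by rw [← Perm.mul_apply, h2, Perm.one_apply]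
  have h1 : τ ≠ 1 := by
    rw [hτdef, Ne, EmbeddingLike.map_eq_one_iff, swap_eq_one_iff]
    exact hij
  have hinv : τ⁻¹ = τ := inv_eq_of_mul_eq_one_left h2
  obtain ⟨p, p', hp, hp', hp'p, hp'q⟩ := exists_apply_ne_of_not_isSwap h1 h2 hτ
  obtain ⟨x, hx⟩ := exists_ne (1 : U)
  set q := τ p with hq
  set q' := τ p' with hq'
  have hqp : τ q = p := h2' p
  have hq'p' : τ q' = p' := h2' p'
  have hq'p : q' ≠ p := fun h => hp'q (by rw [← hq'p', h])
  have hq'q : q' ≠ q := fun h => hp'p (τ.injective h)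
  set a : monomialGroup U n d := pair p p' x with ha
  set b : monomialGroup U n d := φ (ofPerm (swap i j)) with hb
  set t := b * a * b⁻¹ * a⁻¹ with ht
  have hbp : perm b = τ := by rw [hb, perm_map hA hA']; rfl
  have hap : perm a = 1 := rfl
  have htp : perm t = 1 := by simp [ht, hap]
  have hte : ∀ k, entry t k = entry a (τ k) * (entry a k)⁻¹ := by
    intro k
    simp only [ht, entry_mul, hbp, hap, entry_inv, map_mul, map_inv, hinv, h2',
      mul_one, h2, inv_one, Perm.one_apply]
    rw [mul_comm (entry b k), mul_inv_cancel_right]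
  have hcomm : ofPerm (swap p q') * t = t * ofPerm (swap p q') := by
    refine ext' (fun k => ?_) (by simp [htp])
    have hgoal : entry t (swap p q' k) = entry t k := by
      rcases eq_or_ne k p with rfl | hk
      · rw [swap_apply_left, hte, hte, ← hq, hq'p', ha]
        simp [hp, hp'p, hp'p.symm, hp'q.symm, hq'p, hp']
      rcases eq_or_ne k q' with rfl | hk'
      · rw [swap_apply_right, hte, hte, ← hq, hq'p', ha]
        simp [hp, hp'p, hp'p.symm, hp'q.symm, hq'p, hp']
      rw [swap_apply_of_ne_of_ne hk hk']
    simpa [htp] using hgoal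
  set h := φ.symm (ofPerm (swap p q')) with hh
  set a' := φ.symm a
  have ha'p : perm a' = 1 := hA' a hap
  set t' := φ.symm t with ht'
  have ht'e : t' = ofPerm (swap i j) * a' * (ofPerm (swap i j))⁻¹ * a'⁻¹ := by
    simp [ht', ht, hb, a']
  have ht'p : perm t' = 1 := hA' t htp
  have hcomm' : h * t' = t' * h := by rw [hh, ht', ← map_mul, hcomm, map_mul]
  have hfix := perm_symm_apply ht'p hcomm'
  have ht'v : ∀ k, entry t' k = entry a' (swap i j k) * (entry a' k)⁻¹ := by
    intro k
    simp [ht'e, ha'p]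
  have ht'ne : entry a' i ≠ entry a' j := by
    intro heq
    have h3 : t' = 1 := by
      refine ext' (fun k => ?_) (by simp [ht'p])
      rw [ht'v]
      rcases eq_or_ne k i with rfl | hk
      · simp [heq]
      rcases eq_or_ne k j with rfl | hk'
      · simp [heq]
      simp [swap_apply_of_ne_of_ne hk hk']
    have h4 : t = 1 := by simpa [ht'] using h3
    have h5 := hte p
    rw [h4, ← hq, ha] at h5
    simp [hp, hp'p.symm, hp'q.symm, hx] at h5
  have hmem : ∀ k, entry t' k ≠ 1 ↔ k = i ∨ k = j := by
    intro k
    rw [ht'v]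
    rcases eq_or_ne k i with rfl | hk
    · simp [mul_inv_eq_one, ht'ne.symm]
    rcases eq_or_ne k j with rfl | hk'
    · simp [mul_inv_eq_one, ht'ne]
    simp [swap_apply_of_ne_of_ne hk hk', hk, hk']
  have hi := (hmem ((perm h)⁻¹ i)).1 (by rw [hfix, hmem]; simp)
  have hj := (hmem ((perm h)⁻¹ j)).1 (by rw [hfix, hmem]; simp)
  have hsw : swap ((perm h)⁻¹ i) ((perm h)⁻¹ j) = swap i j := by
    have hne : (perm h)⁻¹ i ≠ (perm h)⁻¹ j := (perm h)⁻¹.injective.ne hij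
    rcases hi with hi | hi <;> rcases hj with hj | hj
    · exact absurd (hi.trans hj.symm) hne
    · rw [hi, hj]
    · rw [hi, hj, swap_comm]
    · exact absurd (hi.trans hj.symm) hne
  rw [Equiv.swap_apply_apply, inv_inv] at hsw
  have h6 := congrArg (permAut φ hA hA') hsw
  rw [map_mul, map_mul, map_inv, ← perm_map, ← hτdef, hh, MulEquiv.apply_symm_apply,
    perm_ofPerm] at h6
  have h7 := congrArg (fun σ : Perm n => σ p) h6
  simp only [swap_inv, Perm.mul_apply, swap_apply_left, hq'p', ← hq] at h7
  rw [swap_apply_of_ne_of_ne hp'p hp'.symm] at h7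
  exact hp'q h7
end Generic

/-- If one transposition-type reflection is mapped to a reflection up to a scalar, all of them
are. -/
lemma exists_scalar_of_map_swapReflection (hn : 3 ≤ Fintype.card n)
    (φ : MulAut (monomialGroup U n d)) {s : monomialGroup U n d} (hs : IsSwapReflection s)
    {k l : n} (hkl : k ≠ l) {w : U} (hw : w * w = 1) (hp : perm (φ s) = swap k l)
    (h1 : entry (φ s) k * entry (φ s) l = 1) (h2 : ∀ p, p ≠ k → p ≠ l → entry (φ s) p = w) :
    ∃ hwd : (w ^ Fintype.card n) ^ d = 1, ∀ g, IsSwapReflection g →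
      ∃ g', IsSwapReflection g' ∧ φ g = scalar w hwd * g' := by
  have hprod : ∏ i, w⁻¹ * entry (φ s) i = 1 := by
    rw [Finset.prod_eq_mul k l hkl (fun p _ hpkl => by rw [h2 p hpkl.1 hpkl.2, inv_mul_cancel])
      (by simp) (by simp), mul_mul_mul_comm, h1, ← mul_inv, hw]
    simp
  have hwd : (w ^ Fintype.card n) ^ d = 1 := by
    have h3 := prod_entry (φ s)
    rw [Finset.prod_mul_distrib, Finset.prod_const, Finset.card_univ] at hprod
    rw [inv_pow, inv_mul_eq_one] at hprod
    rwa [← hprod] at h3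
  have hφs : ∃ g', IsSwapReflection g' ∧ φ s = scalar w hwd * g' := by
    refine ⟨mk (fun i => w⁻¹ * entry (φ s) i) (swap k l) (by rw [hprod, one_pow]),
      ⟨k, l, hkl, rfl, ?_, fun p hpk hpl => ?_⟩, ext' (fun i => by simp) (by simp [hp])⟩
    · simp only [entry_mk]
      rw [mul_mul_mul_comm, h1, ← mul_inv, hw]
      simp
    · simp [h2 p hpk hpl]
  refine ⟨hwd, fun g hg => ?_⟩
  obtain ⟨u, rfl⟩ := hs.exists_conj_eq hn hg
  obtain ⟨g', hg', h⟩ := hφs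
  refine ⟨φ u * g' * (φ u)⁻¹, hg'.conj _, ?_⟩
  have hc : φ u * scalar w hwd = scalar w hwd * φ u :=
    Subgroup.mem_center_iff.1 (mem_center_of_const rfl fun i j => rfl) _
  rw [map_mul, map_mul, map_inv, h, ← mul_assoc, hc]
  group

/-- The decomposition when there are no diagonal reflections. -/
lemma decomposition_of_torsion_eq_one [Finite U] (hn : 3 ≤ Fintype.card n)
    (hU : ∀ x : U, x ^ d = 1 → x = 1)
    (φ : MulAut (monomialGroup U n d)) (w : U) (hw : w * w = 1)
    (hwd : (w ^ Fintype.card n) ^ d = 1)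
    (hswap : ∀ g, IsSwapReflection g →
      ∃ g', IsSwapReflection g' ∧ φ g = scalar w hwd * g') :
    ∃ β α : MulAut (monomialGroup U n d), (∀ g, IsReflection g ↔ IsReflection (β g)) ∧
      (∀ g, g⁻¹ * α g ∈ Subgroup.center (monomialGroup U n d)) ∧ φ = β * α := by
  obtain ⟨i₀, -⟩ := exists_notMem (n := n) (k := 0) (by omega) ∅ (by simp)
  refine decomposition_of_characters (by omega) (fun g => perm_eq_one_of_mem_center hn) φ w hw hwd
    hswap i₀ 1 (by simp) (by simp) (by simp) fun x hx => ⟨i₀, 1, by simp, ?_⟩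
  have h : (single i₀ x hx) = 1 := ext' (by simp [hU x hx]) (by simp)
  rw [h, map_one]
  exact ext' (by simp) (by simp)

/-- The character of the group given by an entry of the images of the diagonal reflections. -/
def diagChar (φ : MulAut (monomialGroup U n d)) (hA : ∀ a, perm a = 1 → perm (φ a) = 1)
    (i₀ k : n) : monomialGroup U n d →* U where
  toFun g := entry (φ (single i₀ (prodEntry g) (prodEntry_pow g))) k
  map_one' := by
    have h : single i₀ (prodEntry (1 : monomialGroup U n d)) (prodEntry_pow 1) = 1 :=
      ext' (by simp) (by simp)
    rw [h, map_one, entry_one]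
  map_mul' g h := by
    have h : (single i₀ (prodEntry (g * h)) (prodEntry_pow (g * h)) : monomialGroup U n d) =
        single i₀ (prodEntry g) (prodEntry_pow g) * single i₀ (prodEntry h) (prodEntry_pow h) :=
      ext' (fun i => by by_cases h : i = i₀ <;> simp [h]) (by simp)
    rw [h, map_mul, entry_mul, hA _ (perm_single _ _ _), inv_one, Perm.one_apply]

lemma IsSwapReflection.prodEntry_eq_one {g : monomialGroup U n d} (hg : IsSwapReflection g) :
    prodEntry g = 1 := by
  obtain ⟨i, j, hij, -, h, hk⟩ := hg
  rw [prodEntry_apply, Finset.prod_eq_mul i j hij (fun p _ hp => hk p hp.1 hp.2) (by simp)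
    (by simp), h]

/-- The decomposition when diagonal reflections are mapped to diagonal elements having at most
one exceptional entry. -/
lemma decomposition_of_diagChar [Finite U] (hn : 2 ≤ Fintype.card n)
    (hcenter : ∀ g ∈ Subgroup.center (monomialGroup U n d), perm g = 1)
    (φ : MulAut (monomialGroup U n d)) (hA : ∀ a, perm a = 1 → perm (φ a) = 1)
    (w : U) (hw : w * w = 1)
    (hwd : (w ^ Fintype.card n) ^ d = 1)
    (hswap : ∀ g, IsSwapReflection g →
      ∃ g', IsSwapReflection g' ∧ φ g = scalar w hwd * g') (i₀ k : n)
    (hdiag : ∀ x hx, ∃ q, ∀ i, i ≠ q →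
      entry (φ (single i₀ x hx)) i = entry (φ (single i₀ x hx)) k) :
    ∃ β α : MulAut (monomialGroup U n d), (∀ g, IsReflection g ↔ IsReflection (β g)) ∧
      (∀ g, g⁻¹ * α g ∈ Subgroup.center (monomialGroup U n d)) ∧ φ = β * α := by
  have hs1 : ∀ hx, single i₀ (1 : U) hx = (1 : monomialGroup U n d) :=
    fun hx => ext' (by simp) (by simp)
  have hpow : ∀ x hx i, entry (φ (single i₀ x hx : monomialGroup U n d)) i ^ d = 1 := by
    intro x hx i
    rw [← entry_pow (hA _ (perm_single _ _ _)), ← map_pow]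
    have : (single i₀ x hx : monomialGroup U n d) ^ d = 1 := by
      refine ext' (fun i => ?_) (by simp)
      rw [entry_pow (by simp), entry_single]
      split_ifs <;> simp [hx]
    rw [this, map_one, entry_one]
  have hχ1 : ∀ g, prodEntry g = 1 → diagChar φ hA i₀ k g = 1 := by
    intro g hg
    simp only [diagChar, MonoidHom.coe_mk, OneHom.coe_mk, hg, hs1, map_one, entry_one]
  refine decomposition_of_characters hn hcenter φ w hw hwd hswap i₀ (diagChar φ hA i₀ k)
    (fun g => ?_) (fun g _ hg => hχ1 g hg) (fun g hg => hχ1 g hg.prodEntry_eq_one) fun x hx => ?_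
  · have h : diagChar φ hA i₀ k g ^ d = 1 := hpow _ _ _
    rw [← pow_mul, mul_comm, pow_mul, h, one_pow]
  · obtain ⟨q, hq⟩ := hdiag x hx
    have h1 : diagChar φ hA i₀ k (single i₀ x hx) = entry (φ (single i₀ x hx)) k := by
      simp [diagChar]
    refine ⟨q, (entry (φ (single i₀ x hx)) k)⁻¹ * entry (φ (single i₀ x hx)) q,
      by rw [mul_pow, inv_pow, hpow, hpow]; simp, ext' (fun i => ?_) (by simp [hA _ (perm_single i₀ x hx)])⟩
    simp only [entry_mul, perm_scalar, inv_one, Perm.one_apply, entry_single, entry_scalar, h1]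
    split_ifs with h
    · rw [h, mul_inv_cancel_left]
    · rw [hq i h, mul_one]

/-- The decomposition in rank at least three for automorphisms which preserve the diagonal
subgroup and induce an automorphism of the symmetric group preserving the transpositions. -/
lemma decomposition_of_permAut [Finite U] (hn : 3 ≤ Fintype.card n)
    {φ : MulAut (monomialGroup U n d)} (hA : ∀ a, perm a = 1 → perm (φ a) = 1)
    (hA' : ∀ a, perm a = 1 → perm (φ.symm a) = 1)
    (hsw : ∀ i j, i ≠ j → (permAut φ hA hA' (swap i j)).IsSwap)
    (hsw' : ∀ i j, i ≠ j → ((permAut φ hA hA').symm (swap i j)).IsSwap) :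
    ∃ β α : MulAut (monomialGroup U n d), (∀ g, IsReflection g ↔ IsReflection (β g)) ∧
      (∀ g, g⁻¹ * α g ∈ Subgroup.center (monomialGroup U n d)) ∧ φ = β * α := by
  obtain ⟨i₀, -⟩ := exists_notMem (n := n) (k := 0) (by omega) ∅ (by simp)
  obtain ⟨i, hi⟩ := exists_notMem (n := n) (k := 1) (by omega) {i₀} (by simp)
  obtain ⟨j, hj⟩ := exists_notMem (n := n) (k := 2) (by omega) {i₀, i} Finset.card_le_two
  simp only [Finset.mem_insert, Finset.mem_singleton, not_or, ← ne_eq] at hi hj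
  obtain ⟨k, l, hkl, hθ⟩ := hsw i j hj.2.symm
  set θ := permAut φ hA hA' with hθdef
  set s : monomialGroup U n d := ofPerm (swap i j)
  set c := φ s with hc
  have hcp : perm c = swap k l := hθ
  have hcc : c * c = 1 := by
    rw [hc, ← map_mul, (isSwapReflection_ofPerm hj.2.symm).sq, map_one]
  obtain ⟨p₀, hp₀⟩ := exists_notMem (n := n) (k := 2) (by omega) {k, l} Finset.card_le_two
  simp only [Finset.mem_insert, Finset.mem_singleton, not_or, ← ne_eq] at hp₀
  have h1 : entry c k * entry c l = 1 := by
    simpa [hcp] using congrArg (fun x => entry x k) hcc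
  have hw : entry c p₀ * entry c p₀ = 1 := by
    simpa [hcp, swap_apply_of_ne_of_ne hp₀.1 hp₀.2] using congrArg (fun x => entry x p₀) hcc
  have h2 : ∀ p, p ≠ k → p ≠ l → entry c p = entry c p₀ := by
    intro p hpk hpl
    have hcomm : θ.symm (swap p p₀) * swap i j = swap i j * θ.symm (swap p p₀) := by
      apply θ.injective
      rw [map_mul, map_mul, MulEquiv.apply_symm_apply, hθ, mul_swap_eq_swap_mul,
        swap_apply_of_ne_of_ne hpk.symm hp₀.1.symm, swap_apply_of_ne_of_ne hpl.symm hp₀.2.symm]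
    set g := φ (ofPerm (θ.symm (swap p p₀))) with hg
    have hgp : perm g = swap p p₀ := by
      rw [hg, perm_map hA hA', perm_ofPerm, ← hθdef, MulEquiv.apply_symm_apply]
    have hgc : g * c = c * g := by
      rw [hg, hc, ← map_mul, ← ofPerm_mul, hcomm, ofPerm_mul, map_mul]
    have := congrArg (fun x => entry x p) hgc
    simp only [entry_mul, hgp, hcp, swap_inv, swap_apply_left, swap_apply_of_ne_of_ne hpk hpl]
      at this
    rw [mul_comm] at this
    exact (mul_right_cancel this).symm
  obtain ⟨hwd, hswap⟩ := exists_scalar_of_map_swapReflection hn φ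
    (isSwapReflection_ofPerm hj.2.symm) hkl hw hcp h1 h2
  refine decomposition_of_diagChar (by omega) (fun g => perm_eq_one_of_mem_center hn) φ hA _ hw hwd
    hswap i₀ k fun x hx => ?_
  set y := φ (single i₀ x hx) with hy
  have hyp : perm y = 1 := hA _ (perm_single _ _ _)
  have hfix : ∀ σ : Perm n, σ i₀ = i₀ → ∀ m, entry y ((θ σ)⁻¹ m) = entry y m := by
    intro σ hσ m
    have h3 : perm (φ (ofPerm σ)) = θ σ := rfl
    rw [← h3]
    refine perm_symm_apply hyp ?_ m
    rw [hy, ← map_mul, ofPerm_mul_single, hσ, map_mul]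
  have hykl : entry y k = entry y l := by
    have := hfix (swap i j) (swap_apply_of_ne_of_ne hi.symm hj.1.symm) l
    rwa [hθ, swap_inv, swap_apply_right] at this
  by_contra! hcon
  obtain ⟨p, hpk, hp⟩ := hcon k
  obtain ⟨q, hqp, hq⟩ := hcon p
  have hqk : q ≠ k := by rintro rfl; exact hq rfl
  have hpl : p ≠ l := by rintro rfl; exact hp hykl.symm
  have hql : q ≠ l := by rintro rfl; exact hq hykl.symm
  have key : ∀ p k, p ≠ k → entry y p ≠ entry y k →
      ∃ j, j ≠ i₀ ∧ θ.symm (swap p k) = swap i₀ j := by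
    intro p k hpk hne
    have h3 : θ.symm (swap p k) i₀ ≠ i₀ := by
      intro h3
      have := hfix _ h3 k
      rw [MulEquiv.apply_symm_apply, swap_inv, swap_apply_right] at this
      exact hne this
    obtain ⟨a, b, hab, h⟩ := hsw' p k hpk
    rw [h] at h3
    rcases eq_or_ne a i₀ with rfl | ha
    · exact ⟨b, hab.symm, h⟩
    rcases eq_or_ne b i₀ with rfl | hb
    · exact ⟨a, ha, by rw [h, swap_comm]⟩
    exact absurd (swap_apply_of_ne_of_ne ha.symm hb.symm) h3
  obtain ⟨j₁, hj₁, h3⟩ := key p k hpk hp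
  obtain ⟨j₂, hj₂, h4⟩ := key q l hql (hykl ▸ hq)
  have hcomm : swap i₀ j₁ * swap i₀ j₂ = swap i₀ j₂ * swap i₀ j₁ := by
    rw [← h3, ← h4, ← map_mul, ← map_mul, mul_swap_eq_swap_mul,
      swap_apply_of_ne_of_ne hqp hqk, swap_apply_of_ne_of_ne hpl.symm hkl.symm]
  have hne : j₁ ≠ j₂ := by
    rintro rfl
    have := congrArg (fun σ : Perm n => σ p) (θ.symm.injective (h3.trans h4.symm))
    simp only [swap_apply_left, swap_apply_of_ne_of_ne hqp.symm hpl] at this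
    exact hpk this.symm
  have := congrArg (fun σ : Perm n => σ i₀) hcomm
  simp only [Perm.mul_apply, swap_apply_left, swap_apply_of_ne_of_ne hj₁ hne,
    swap_apply_of_ne_of_ne hj₂ hne.symm] at this
  exact hne this.symm

lemma univ_eq_of_card_eq_four (hn : Fintype.card n = 4) {a b c d : n} (hab : a ≠ b) (hac : a ≠ c)
    (had : a ≠ d) (hbc : b ≠ c) (hbd : b ≠ d) (hcd : c ≠ d) :
    (Finset.univ : Finset n) = {a, b, c, d} := by
  refine (Finset.eq_univ_of_card _ ?_).symm
  rw [hn, Finset.card_insert_of_notMem, Finset.card_insert_of_notMem, Finset.card_pair hcd] <;>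
    simp [*]

lemma forall_apply_ne_of_not_isSwap (hn : Fintype.card n ≤ 4) {τ : Perm n} (h1 : τ ≠ 1)
    (h2 : τ * τ = 1) (h3 : ¬ τ.IsSwap) : Fintype.card n = 4 ∧ ∀ x, τ x ≠ x := by
  obtain ⟨p, p', hp, hp', h4, h5⟩ := exists_apply_ne_of_not_isSwap h1 h2 h3
  have h2' : ∀ x, τ (τ x) = x := fun x => by rw [← Perm.mul_apply, h2, Perm.one_apply]
  have h6 : τ p' ≠ p := fun h => h5 (by rw [← h, h2'])
  have h7 : τ p' ≠ τ p := τ.injective.ne h4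
  have hc : ({p, τ p, p', τ p'} : Finset n).card = 4 := by
    rw [Finset.card_insert_of_notMem, Finset.card_insert_of_notMem, Finset.card_pair hp'.symm] <;>
      simp [hp.symm, h4.symm, h5.symm, h6.symm, h7.symm]
  have hn' : Fintype.card n = 4 := le_antisymm hn (hc ▸ Finset.card_le_univ _)
  refine ⟨hn', fun x => ?_⟩
  have hx := Finset.mem_univ x
  rw [← Finset.eq_univ_of_card _ (hc.trans hn'.symm)] at hx
  simp only [Finset.mem_insert, Finset.mem_singleton] at hx
  rcases hx with rfl | rfl | rfl | rfl
  · exact hp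
  · exact fun h => hp (τ.injective h)
  · exact hp'
  · exact fun h => hp' (τ.injective h)

lemma mul_mul_mul_eq_one_of_card_eq_four (hn : Fintype.card n = 4) {f g : Perm n}
    (hf : f * f = 1) (hg : g * g = 1) (hf' : ∀ x, f x ≠ x) (hg' : ∀ x, g x ≠ x) :
    (f * g) * (f * g) = 1 := by
  have hff : ∀ x, f (f x) = x := fun x => by rw [← Perm.mul_apply, hf, Perm.one_apply]
  have hgg : ∀ x, g (g x) = x := fun x => by rw [← Perm.mul_apply, hg, Perm.one_apply]
  refine Perm.ext fun x => ?_
  simp only [Perm.mul_apply, Perm.one_apply]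
  rcases eq_or_ne (f (g x)) x with h | h
  · rw [h, h]
  set y := f (g x) with hy
  have hyg : y ≠ g x := hf' _
  have hfy : f y = g x := hff _
  have h1 : g y ≠ x := fun h' => hyg (by rw [← h', hgg])
  have h2 : g y ≠ g x := g.injective.ne h
  have hmem := Finset.mem_univ (f (g y))
  rw [univ_eq_of_card_eq_four hn (hg' x).symm h.symm h1.symm hyg.symm h2.symm (hg' y).symm] at hmem
  simp only [Finset.mem_insert, Finset.mem_singleton] at hmem
  rcases hmem with h' | h' | h' | h'
  · exact h'
  · exact absurd (f.injective (h'.trans hfy.symm)) (hg' y)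
  · exact absurd (f.injective (h'.trans hy)) h2
  · exact absurd h' (hf' _)

lemma decomposition_of_card_eq_three [Finite U] (hn : Fintype.card n = 3)
    (hU : ∀ x : U, x ^ d = 1 → x = 1) (hU' : ∀ x : U, x ^ 3 = 1)
    (φ : MulAut (monomialGroup U n d)) :
    ∃ β α : MulAut (monomialGroup U n d), (∀ g, IsReflection g ↔ IsReflection (β g)) ∧
      (∀ g, g⁻¹ * α g ∈ Subgroup.center (monomialGroup U n d)) ∧ φ = β * α := by
  refine decomposition_of_torsion_eq_one hn.ge hU φ 1 (by simp) (by simp) fun g hg => ?_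
  refine ⟨φ g, ?_, ?_⟩
  swap
  · have h : scalar 1 (by simp) = (1 : monomialGroup U n d) := ext' (by simp) (by simp)
    rw [h, one_mul]
  have hsq : φ g * φ g = 1 := by rw [← map_mul, hg.sq, map_one]
  have hx : ∀ x : U, x * x = 1 → x = 1 := fun x hx => by
    have := hU' x
    rwa [pow_succ, pow_two, hx, one_mul] at this
  have hp : perm (φ g) * perm (φ g) = 1 := by rw [← map_mul, hsq, map_one]
  have hp1 : perm (φ g) ≠ 1 := by
    intro h1
    have : φ g = 1 := by
      refine ext' (fun i => hx _ ?_) (by simpa using h1)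
      simpa [h1] using congrArg (fun y => entry y i) hsq
    rw [EmbeddingLike.map_eq_one_iff] at this
    exact hg.perm_ne_one (by simp [this])
  obtain ⟨k, l, hkl, h⟩ : (perm (φ g)).IsSwap := by
    by_contra h
    have := (forall_apply_ne_of_not_isSwap (by omega) hp1 hp h).1
    omega
  refine ⟨k, l, hkl, h, ?_, fun m hmk hml => hx _ ?_⟩
  · simpa [h] using congrArg (fun y => entry y k) hsq
  · simpa [h, swap_apply_of_ne_of_ne hmk hml] using congrArg (fun y => entry y m) hsq

lemma decomposition_of_card_eq_four [Finite U] (hn : Fintype.card n = 4)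
    (hU : ∀ x : U, x ^ d = 1 → x = 1) (hU' : ∀ x : U, x ^ 2 = 1)
    (φ : MulAut (monomialGroup U n d)) :
    ∃ β α : MulAut (monomialGroup U n d), (∀ g, IsReflection g ↔ IsReflection (β g)) ∧
      (∀ g, g⁻¹ * α g ∈ Subgroup.center (monomialGroup U n d)) ∧ φ = β * α := by
  obtain ⟨i, -⟩ := exists_notMem (n := n) (k := 0) (by omega) ∅ (by simp)
  obtain ⟨j, hj⟩ := exists_notMem (n := n) (k := 1) (by omega) {i} (by simp)
  obtain ⟨m, hm⟩ := exists_notMem (n := n) (k := 2) (by omega) {i, j} Finset.card_le_two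
  simp only [Finset.mem_insert, Finset.mem_singleton, not_or, ← ne_eq] at hj hm
  have hij := hj.symm
  have hrs := isSwapReflection_ofPerm (U := U) (d := d) hij
  set s : monomialGroup U n d := ofPerm (swap i j) with hs
  have hsq : φ s * φ s = 1 := by rw [← map_mul, hrs.sq, map_one]
  have hp : perm (φ s) * perm (φ s) = 1 := by rw [← map_mul, hsq, map_one]
  have hconj : ∃ u : monomialGroup U n d, ofPerm (swap i m) = u * s * u⁻¹ :=
    hrs.exists_conj_eq (by omega) (isSwapReflection_ofPerm hm.1.symm)
  obtain ⟨u, hu⟩ := hconj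
  have h3 := Perm.isThreeCycle_swap_mul_swap_same hij hm.1.symm hm.2.symm
  set y : monomialGroup U n d := s * (u * s * u⁻¹) with hy
  have hy' : y = ofPerm (swap i j * swap i m) := by rw [hy, ← hu, ofPerm_mul]
  have hy3 : y ^ 3 = 1 := by
    have h4 : (swap i j * swap i m) ^ 3 = 1 := by rw [← h3.orderOf, pow_orderOf_eq_one]
    rw [hy', pow_succ, pow_two, ← ofPerm_mul, ← ofPerm_mul, ← pow_two, ← pow_succ, h4]
    exact ext' (by simp) (by simp)
  have hy1 : y ≠ 1 := by
    intro h
    have h5 := congrArg perm h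
    rw [hy', perm_ofPerm, map_one] at h5
    exact Perm.IsThreeCycle.ne_one h3 h5
  have hyp : ¬ perm ((φ y) ^ 2) = 1 := by
    intro h
    have h6 : (φ y ^ 2) ^ 2 = 1 := ext' (fun k => by rw [entry_pow h, hU', entry_one])
      (by rw [map_pow, h, one_pow, map_one])
    rw [← pow_mul, ← map_pow, EmbeddingLike.map_eq_one_iff, pow_succ, hy3, one_mul] at h6
    exact hy1 h6
  have hp1 : perm (φ s) ≠ 1 := by
    intro h
    exact hyp (by simp [hy, h])
  obtain ⟨k, l, hkl, h⟩ : (perm (φ s)).IsSwap := by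
    by_contra h
    have h7 := (forall_apply_ne_of_not_isSwap hn.le hp1 hp h).2
    apply hyp
    rw [pow_two, hy, map_mul, map_mul, map_mul]
    refine mul_mul_mul_eq_one_of_card_eq_four hn hp ?_ h7 fun x hx => h7 (perm (φ u⁻¹) x) ?_
    · rw [← map_mul, ← map_mul, (hrs.conj u).sq, map_one, map_one]
    · rw [map_mul, map_mul, map_mul, map_mul, map_inv, map_inv, Perm.mul_apply, Perm.mul_apply,
        ← Perm.eq_inv_iff_eq] at hx
      rw [map_inv, map_inv]
      exact hx
  obtain ⟨p₀, hp₀⟩ := exists_notMem (n := n) (k := 2) (by omega) {k, l} Finset.card_le_two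
  simp only [Finset.mem_insert, Finset.mem_singleton, not_or, ← ne_eq] at hp₀
  have h1 : entry (φ s) k * entry (φ s) l = 1 := by
    simpa [h] using congrArg (fun x => entry x k) hsq
  obtain ⟨hwd, hswap⟩ := exists_scalar_of_map_swapReflection (by omega) φ hrs hkl
    (w := entry (φ s) p₀) (by rw [← pow_two, hU']) h h1 fun p hpk hpl => by
      rcases eq_or_ne p p₀ with rfl | hpp
      · rfl
      have h8 := hU _ (prod_entry (φ s))
      rw [univ_eq_of_card_eq_four hn hkl hpk.symm hp₀.1.symm hpl.symm hp₀.2.symm hpp,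
        Finset.prod_insert (by simp [hkl, hpk.symm, hp₀.1.symm]),
        Finset.prod_insert (by simp [hpl.symm, hp₀.2.symm]), Finset.prod_pair hpp, ← mul_assoc, h1,
        one_mul] at h8
      have h9 := hU' (entry (φ s) p₀)
      rw [pow_two] at h9
      exact mul_right_cancel (h8.trans h9.symm)
  exact decomposition_of_torsion_eq_one (by omega) hU φ _ (by rw [← pow_two, hU']) hwd hswap

lemma decomposition_of_three_le_card [Finite U] (hn : 3 ≤ Fintype.card n)
    (h6 : ¬ ((∀ x : U, x = 1) ∧ Fintype.card n = 6)) (φ : MulAut (monomialGroup U n d)) :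
    ∃ β α : MulAut (monomialGroup U n d), (∀ g, IsReflection g ↔ IsReflection (β g)) ∧
      (∀ g, g⁻¹ * α g ∈ Subgroup.center (monomialGroup U n d)) ∧ φ = β * α := by
  by_cases h3 : (∀ η : U, η ^ d = 1 → η = 1) ∧ Fintype.card n = 3 ∧ ∀ x : U, x ^ 3 = 1
  · exact decomposition_of_card_eq_three h3.2.1 h3.1 h3.2.2 φ
  by_cases h4 : (∀ η : U, η ^ d = 1 → η = 1) ∧ Fintype.card n = 4 ∧ ∀ x : U, x ^ 2 = 1
  · exact decomposition_of_card_eq_four h4.2.1 h4.1 h4.2.2 φ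
  have hA : ∀ ψ : MulAut (monomialGroup U n d), ∀ a, perm a = 1 → perm (ψ a) = 1 := by
    intro ψ
    rcases perm_map_eq_one_or hn ψ with h | ⟨h, h' | h' | h'⟩
    · exact h
    · exact absurd ⟨h, h'⟩ h3
    · exact absurd ⟨h, h'⟩ h4
    · intro a ha
      have : a = 1 := ext' (fun i => h' _) (by simpa using ha)
      simp [this]
  have hsw : ∀ ψ : MulAut (monomialGroup U n d), ∀ i j, i ≠ j →
      (permAut ψ (hA ψ) (hA ψ.symm) (swap i j)).IsSwap := by
    intro ψ i j hij
    rcases subsingleton_or_nontrivial U with hU | hU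
    · have h1 : ∀ x : U, x = 1 := fun x => Subsingleton.elim _ _
      refine isSwap_map_swap ?_ (fun h => h6 ⟨h1, h⟩) _ hij
      by_contra hlt
      rcases (by omega : Fintype.card n = 3 ∨ Fintype.card n = 4) with h | h
      · exact h3 ⟨fun _ _ => h1 _, h, fun _ => h1 _⟩
      · exact h4 ⟨fun _ _ => h1 _, h, fun _ => h1 _⟩
    · exact isSwap_permAut_swap_of_nontrivial _ _ hij
  exact decomposition_of_permAut hn (hA φ) (hA φ.symm) (hsw φ) (hsw φ.symm)

lemma decomposition_of_commute {G : Type*} [Group G] (h : ∀ x y : G, x * y = y * x)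
    (R : G → Prop) (φ : MulAut G) :
    ∃ β α : MulAut G, (∀ g, R g ↔ R (β g)) ∧ (∀ g, g⁻¹ * α g ∈ Subgroup.center G) ∧
      φ = β * α :=
  ⟨1, φ, by simp, fun g => Subgroup.mem_center_iff.2 fun _ => h _ _, by simp⟩

lemma perm_eq_swap_of_ne_one {g : monomialGroup U (Fin 2) d} (h : perm g ≠ 1) :
    perm g = swap 0 1 := by
  revert h
  generalize perm g = σ
  revert σ
  decide

lemma isSwapReflection_of_mul_self {g : monomialGroup U (Fin 2) d} (h : perm g ≠ 1)
    (hg : g * g = 1) : IsSwapReflection g := by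
  have hp := perm_eq_swap_of_ne_one h
  refine ⟨0, 1, by simp, hp, ?_, fun k h0 h1 => by omega⟩
  simpa [hp] using congrArg (fun y => entry y 0) hg

lemma decomposition_of_rank_two [Finite U]
    (hU : ∀ x y : U, x * x = 1 → y * y = 1 → x = 1 ∨ y = 1 ∨ x = y)
    (φ : MulAut (monomialGroup U (Fin 2) d)) :
    ∃ β α : MulAut (monomialGroup U (Fin 2) d), (∀ g, IsReflection g ↔ IsReflection (β g)) ∧
      (∀ g, g⁻¹ * α g ∈ Subgroup.center (monomialGroup U (Fin 2) d)) ∧ φ = β * α := by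
  by_cases hab : ∀ x y : monomialGroup U (Fin 2) d, x * y = y * x
  · exact decomposition_of_commute hab _ φ
  have hcenter : ∀ g ∈ Subgroup.center (monomialGroup U (Fin 2) d), perm g = 1 := by
    intro g hg
    by_contra hp
    have hps := perm_eq_swap_of_ne_one hp
    have hdiag : ∀ y : monomialGroup U (Fin 2) d, perm y = 1 →
        y ∈ Subgroup.center (monomialGroup U (Fin 2) d) := by
      intro y hy
      have h := perm_symm_apply hy (Subgroup.mem_center_iff.1 hg y).symm
      rw [hps] at h
      have h0 : entry y 1 = entry y 0 := by simpa using h 0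
      refine mem_center_of_const hy fun i j => ?_
      fin_cases i <;> fin_cases j <;> simp [h0]
    have hall : ∀ y : monomialGroup U (Fin 2) d,
        y ∈ Subgroup.center (monomialGroup U (Fin 2) d) := by
      intro y
      by_cases hy : perm y = 1
      · exact hdiag y hy
      · have := hdiag (y * g⁻¹) (by simp [perm_eq_swap_of_ne_one hy, hps])
        simpa using mul_mem this hg
    exact hab fun x y => Subgroup.mem_center_iff.1 (hall y) x
  have hsingle : ∀ i (x : U) (hx : x ^ d = 1), x ≠ 1 →
      single i x hx ∉ Subgroup.center (monomialGroup U (Fin 2) d) := by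
    intro i x hx hx1 h
    have h1 := perm_symm_apply (perm_single i x hx)
      (Subgroup.mem_center_iff.1 h (ofPerm (swap 0 1))) i
    fin_cases i <;> simp [hx1.symm] at h1
  by_cases hsq : ∀ η : U, η ^ d = 1 → η ^ 2 = 1
  · have hR : ∀ g : monomialGroup U (Fin 2) d,
        IsReflection g ↔ g * g = 1 ∧ g ∉ Subgroup.center (monomialGroup U (Fin 2) d) := by
      refine fun g => ⟨?_, fun ⟨hg, hgc⟩ => ?_⟩
      · rintro (hg | hg)
        · exact ⟨hg.sq, fun h => hg.perm_ne_one (hcenter g h)⟩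
        · obtain ⟨i, x, hx, hx1, rfl⟩ := hg.exists_eq_single
          refine ⟨ext' (fun k => ?_) (by simp), hsingle i x hx hx1⟩
          have := hsq x hx
          rw [pow_two] at this
          by_cases hk : k = i <;> simp [hk, this]
      · by_cases hp : perm g = 1
        · right
          have h := fun i => by simpa [hp] using congrArg (fun y => entry y i) hg
          rcases hU _ _ (h 0) (h 1) with h0 | h0 | h0
          · refine ⟨1, hp, fun h1 => hgc (mem_center_of_const hp fun i j => ?_), fun k hk => ?_⟩
            · fin_cases i <;> fin_cases j <;> simp [h0, h1]
            · rwa [show k = 0 by omega]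
          · refine ⟨0, hp, fun h1 => hgc (mem_center_of_const hp fun i j => ?_), fun k hk => ?_⟩
            · fin_cases i <;> fin_cases j <;> simp [h0, h1]
            · rwa [show k = 1 by omega]
          · refine absurd (mem_center_of_const hp fun i j => ?_) hgc
            fin_cases i <;> fin_cases j <;> simp [h0]
        · exact .inl (isSwapReflection_of_mul_self hp hg)
    refine ⟨φ, 1, fun g => ?_, by simp, by simp⟩
    rw [hR, hR, ← map_mul, EmbeddingLike.map_eq_one_iff]
    refine and_congr_right fun _ => not_congr ?_
    simp only [Subgroup.mem_center_iff]
    refine ⟨fun h k => ?_, fun h k => φ.injective (by rw [map_mul, map_mul, h])⟩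
    obtain ⟨k, rfl⟩ := φ.surjective k
    rw [← map_mul, ← map_mul, h]
  · push Not at hsq
    obtain ⟨η, hη, hη2⟩ := hsq
    have hA : ∀ ψ : MulAut (monomialGroup U (Fin 2) d), ∀ a, perm a = 1 → perm (ψ a) = 1 := by
      intro ψ a ha
      by_contra hτ
      obtain ⟨p, hp⟩ : ∃ p, (perm (ψ a))⁻¹ p ≠ p := by
        by_contra! h
        exact hτ (inv_eq_one.1 (Perm.ext h))
      exact hη2 (sq_eq_one_of_scalar_action (entry_mul_eq_of_perm_ne_one ψ ha hτ) hp hη)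
    refine decomposition_of_diagChar (by simp) hcenter φ (hA φ) 1 (by simp) (by simp)
      (fun g hg => ⟨φ g, isSwapReflection_of_mul_self (fun h => ?_) ?_, ?_⟩) 0 1
      fun x hx => ⟨0, fun i hi => by rw [show i = 1 by omega]⟩
    · have := hA φ.symm _ h
      rw [MulEquiv.symm_apply_apply] at this
      exact hg.perm_ne_one this
    · rw [← map_mul, hg.sq, map_one]
    · exact ext' (by simp) (by simp)

lemma decomposition_of_rank_one (φ : MulAut (monomialGroup U (Fin 1) d)) :
    ∃ β α : MulAut (monomialGroup U (Fin 1) d), (∀ g, IsReflection g ↔ IsReflection (β g)) ∧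
      (∀ g, g⁻¹ * α g ∈ Subgroup.center (monomialGroup U (Fin 1) d)) ∧ φ = β * α :=
  decomposition_of_commute
    (fun x y => ext' (fun i => by simp [Subsingleton.elim _ i, mul_comm]) (Subsingleton.elim _ _))
    _ φ

/-! ### Monomial matrices -/

lemma rank_eq_one_of_eq_vecMulVec {m K : Type*} [Fintype m] [Field K]
    {B : Matrix m m K} {w v : m → K} (h : B = Matrix.vecMulVec w v) {i j : m} (hij : B i j ≠ 0) :
    B.rank = 1 := by
  refine le_antisymm (h ▸ Matrix.rank_vecMulVec_le w v) ?_
  have hdet : (B.submatrix ![i] ![j]).det ≠ 0 := by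
    rwa [Matrix.det_fin_one]
  exact (Matrix.rank_of_det_ne_zero hdet).symm.le.trans <| B.rank_submatrix_le ![i] ![j]

lemma mul_eq_mul_of_rank_eq_one {m K : Type*} [Fintype m] [Field K]
    {B : Matrix m m K} (h : B.rank = 1) (i j k l : m) : B i k * B j l = B i l * B j k := by
  by_contra hne
  have hdet : (B.submatrix ![i, j] ![k, l]).det ≠ 0 := by
    rwa [Matrix.det_fin_two, sub_ne_zero]
  have := B.rank_submatrix_le ![i, j] ![k, l]
  rw [Matrix.rank_of_det_ne_zero hdet, h, Fintype.card_fin] at this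
  omega

variable {K : Type*} [Field K] {N : ℕ}

/-- The monomial matrix attached to an element of the abstract model. -/
def toMatrix : monomialGroup (rootsOfUnity N K) n d →* Matrix n n K where
  toFun g := Matrix.of fun i j => if i = perm g j then (((entry g i : rootsOfUnity N K) : Kˣ) : K) else 0
  map_one' := by
    ext i j
    simp [Matrix.one_apply]
  map_mul' g h := by
    ext i j
    rw [Matrix.mul_apply, Finset.sum_eq_single ((perm g)⁻¹ i)]
    · by_cases hi : i = perm g (perm h j)
      · simp [hi]
      · have : (perm g).symm i ≠ perm h j := fun h' => hi (by simp [← h'])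
        simp [hi, this]
    · intro k _ hk
      have : i ≠ perm g k := by rintro rfl; simp at hk
      simp [this]
    · simp

lemma toMatrix_apply (g : monomialGroup (rootsOfUnity N K) n d) (i j : n) :
    toMatrix g i j = if i = perm g j then (((entry g i : rootsOfUnity N K) : Kˣ) : K) else 0 := rfl

lemma toMatrix_ne_zero_iff (g : monomialGroup (rootsOfUnity N K) n d) (i j : n) :
    toMatrix g i j ≠ 0 ↔ i = perm g j := by
  simp [toMatrix_apply]

lemma toMatrix_injective :
    Function.Injective (toMatrix : monomialGroup (rootsOfUnity N K) n d →* Matrix n n K) := by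
  intro g h hgh
  have hp : perm g = perm h := by
    ext j
    have h1 := (toMatrix_ne_zero_iff g (perm g j) j).2 rfl
    rw [hgh] at h1
    exact (toMatrix_ne_zero_iff h _ j).1 h1
  refine ext' (fun i => ?_) hp
  have h1 := congrFun (congrFun hgh i) ((perm g)⁻¹ i)
  rw [toMatrix_apply, toMatrix_apply, ← hp] at h1
  ext
  simpa using h1

lemma rank_toMatrix_sub_one_of_isReflection {g : monomialGroup (rootsOfUnity N K) n d}
    (hg : IsReflection g) : (toMatrix g - 1).rank = 1 := by
  rcases hg with ⟨p, q, hpq, hs, h1, hk⟩ | ⟨p, hs, hp, hk⟩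
  · have h1' : (((entry g p : rootsOfUnity N K) : Kˣ) : K) * (((entry g q : rootsOfUnity N K) : Kˣ) : K) = 1 := by
      simpa using congrArg (fun x : rootsOfUnity N K => ((x : Kˣ) : K)) h1
    refine rank_eq_one_of_eq_vecMulVec
      (w := fun i => if i = p then -1 else if i = q then (((entry g q : rootsOfUnity N K) : Kˣ) : K) else 0)
      (v := fun j => if j = p then 1 else if j = q then -(((entry g p : rootsOfUnity N K) : Kˣ) : K) else 0)
      (i := p) (j := p) ?_ ?_
    · ext i j
      rw [Matrix.vecMulVec_apply, Matrix.sub_apply, toMatrix_apply, Matrix.one_apply, hs]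
      by_cases j1 : j = p
      · subst j1
        by_cases i1 : i = j
        · simp [i1, hpq]
        by_cases i2 : i = q
        · simp [i2, hpq.symm]
        simp [i1, i2]
      by_cases j2 : j = q
      · subst j2
        by_cases i1 : i = p
        · simp [i1, hpq, hpq.symm]
        by_cases i2 : i = j
        · simp [i2, hpq.symm, mul_comm, h1']
        simp [i1, i2]
      rw [swap_apply_of_ne_of_ne j1 j2]
      by_cases i1 : i = j
      · simp [i1, j1, j2, hk]
      simp [i1, j1, j2]
    · simp [toMatrix_apply, hs, hpq]
  · have hp' : (((entry g p : rootsOfUnity N K) : Kˣ) : K) ≠ 1 := by simpa using hp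
    refine rank_eq_one_of_eq_vecMulVec
      (w := fun i => if i = p then (((entry g p : rootsOfUnity N K) : Kˣ) : K) - 1 else 0)
      (v := fun j => if j = p then 1 else 0) (i := p) (j := p) ?_ ?_
    · ext i j
      rw [Matrix.vecMulVec_apply, Matrix.sub_apply, toMatrix_apply, Matrix.one_apply, hs]
      by_cases j1 : j = p
      · subst j1
        by_cases i1 : i = j <;> simp [i1]
      by_cases i1 : i = j
      · simp [i1, j1, hk]
      simp [i1, j1]
    · simpa [toMatrix_apply, hs, sub_eq_zero] using hp

lemma isReflection_of_rank_toMatrix_sub_one {g : monomialGroup (rootsOfUnity N K) n d}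
    (hg : (toMatrix g - 1).rank = 1) : IsReflection g := by
  have hminor := mul_eq_mul_of_rank_eq_one hg
  simp only [Matrix.sub_apply, toMatrix_apply, Matrix.one_apply] at hminor
  by_cases hs : perm g = 1
  · right
    obtain ⟨p, hp⟩ : ∃ p, entry g p ≠ 1 := by
      by_contra! h
      rw [ext' (h := 1) h hs] at hg
      simp at hg
    refine ⟨p, hs, hp, fun k hk => ?_⟩
    have hp' : (((entry g p : rootsOfUnity N K) : Kˣ) : K) - 1 ≠ 0 := by simpa [sub_eq_zero] using hp
    have := hminor p k p k
    simp only [hs, Perm.coe_one, id_eq, if_true, if_neg hk, if_neg hk.symm, sub_zero, mul_zero,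
      mul_eq_zero, hp', false_or, sub_eq_zero] at this
    simpa using this
  · left
    obtain ⟨p, hp⟩ : ∃ p, perm g p ≠ p := by
      by_contra! h
      exact hs (Equiv.ext h)
    obtain ⟨q, hq⟩ : ∃ q, perm g p = q := ⟨_, rfl⟩
    have hqp : q ≠ p := hq ▸ hp
    have hfix : ∀ k, k ≠ p → k ≠ q → perm g k = k ∧ entry g k = 1 := by
      intro k hkp hkq
      have := hminor q k p k
      simp only [hq, hqp, hkp, hkq, if_true, if_false, sub_zero, mul_zero, mul_eq_zero,
        Units.ne_zero, false_or] at this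
      by_cases hk : k = perm g k
      · rw [if_pos hk, sub_eq_zero] at this
        exact ⟨hk.symm, by simpa using this⟩
      · simp [hk] at this
    have hqq : perm g q = p := by
      by_contra h
      by_cases h' : perm g q = q
      · exact hqp ((perm g).injective (h'.trans hq.symm))
      · exact h' ((perm g).injective (hfix _ h h').1)
    have hswap : perm g = swap p q := by
      ext k
      by_cases h1 : k = p
      · simp [h1, hq]
      by_cases h2 : k = q
      · simp [h2, hqq]
      rw [swap_apply_of_ne_of_ne h1 h2, (hfix k h1 h2).1]
    refine ⟨p, q, hqp.symm, hswap, ?_, fun k h1 h2 => (hfix k h1 h2).2⟩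
    have := hminor p q p q
    simp only [hq, hqq, hqp, hqp.symm, if_true, if_false, zero_sub, sub_zero, mul_neg,
      mul_one, neg_neg] at this
    ext
    simpa using this.symm

lemma toMatrix_sub_one_rank_eq_one_iff (g : monomialGroup (rootsOfUnity N K) n d) :
    (toMatrix g - 1).rank = 1 ↔ IsReflection g :=
  ⟨isReflection_of_rank_toMatrix_sub_one, rank_toMatrix_sub_one_of_isReflection⟩

/-- The monomial matrices form a subgroup isomorphic to the abstract model. -/
noncomputable def equivGdeer (d e r : ℕ) [NeZero (d * e)] :
    monomialGroup (rootsOfUnity (d * e) ℂ) (Fin r) d ≃* Gdeer d e r :=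
  have hinj : Function.Injective
      (toMatrix.toHomUnits : monomialGroup (rootsOfUnity (d * e) ℂ) (Fin r) d →* _) :=
    fun _ _ h => toMatrix_injective (congrArg Units.val h)
  (MonoidHom.ofInjective hinj).trans <| MulEquiv.subgroupCongr <| by
    refine (Subgroup.closure_eq _).symm.trans (congrArg Subgroup.closure ?_)
    ext A
    constructor
    · rintro ⟨g, rfl⟩
      refine ⟨perm g, fun i j => toMatrix_ne_zero_iff g i j, fun j => ?_, ?_⟩
      · have := (mem_rootsOfUnity' _ _).1 (entry g (perm g j)).2
        simpa [toMatrix_apply] using this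
      · have := congrArg (fun x : rootsOfUnity (d * e) ℂ => ((x : ℂˣ) : ℂ)) (prod_entry g)
        simp only [MonoidHom.coe_toHomUnits, toMatrix_apply, if_true]
        rw [Equiv.prod_comp (perm g) fun i => (((entry g i : rootsOfUnity (d * e) ℂ) : ℂˣ) : ℂ)]
        simpa using this
    · rintro ⟨σ, h1, h2, h3⟩
      have h2' : ∀ i, (A : Matrix (Fin r) (Fin r) ℂ) i (σ⁻¹ i) ^ (d * e) = 1 := fun i => by
        simpa using h2 (σ⁻¹ i)
      refine ⟨mk (fun i => rootsOfUnity.mkOfPowEq _ (h2' i)) σ ?_, ?_⟩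
      · rw [← Equiv.prod_comp σ]
        ext
        simpa [rootsOfUnity.coe_mkOfPowEq] using h3
      · ext i j
        rw [MonoidHom.coe_toHomUnits, toMatrix_apply]
        by_cases hij : i = σ j
        · simp [hij]
        · have := (h1 i j).not.2 hij
          simp only [not_not] at this
          simp [hij, this]

lemma isMatrixReflection_equivGdeer_iff {d e r : ℕ} [NeZero (d * e)]
    (g : monomialGroup (rootsOfUnity (d * e) ℂ) (Fin r) d) :
    IsMatrixReflection (equivGdeer d e r g : Matrix.GeneralLinearGroup (Fin r) ℂ) ↔
      IsReflection g :=
  toMatrix_sub_one_rank_eq_one_iff g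

lemma decomposition (d e r : ℕ) [NeZero (d * e)] (hr : 1 ≤ r)
    (h116 : ¬ (d = 1 ∧ e = 1 ∧ r = 6))
    (φ : MulAut (monomialGroup (rootsOfUnity (d * e) ℂ) (Fin r) d)) :
    ∃ β α : MulAut (monomialGroup (rootsOfUnity (d * e) ℂ) (Fin r) d),
      (∀ g, IsReflection g ↔ IsReflection (β g)) ∧
      (∀ g, g⁻¹ * α g ∈ Subgroup.center _) ∧ φ = β * α := by
  obtain rfl | rfl | h3 : r = 1 ∨ r = 2 ∨ 3 ≤ r := by omega
  · exact decomposition_of_rank_one φ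
  · refine decomposition_of_rank_two (fun x y hx hy => ?_) φ
    have key : ∀ x : rootsOfUnity (d * e) ℂ, x * x = 1 → ((x : ℂˣ) : ℂ) = 1 ∨
        ((x : ℂˣ) : ℂ) = -1 := fun x hx => by
      have := congrArg (fun z : rootsOfUnity (d * e) ℂ => ((z : ℂˣ) : ℂ)) hx
      exact mul_self_eq_one_iff.1 (by simpa using this)
    rcases key x hx with h | h
    · exact .inl (by ext; simpa using h)
    rcases key y hy with h' | h'
    · exact .inr (.inl (by ext; simpa using h'))
    · exact .inr (.inr (by ext; simp [h, h']))
  · refine decomposition_of_three_le_card (by simpa using h3) (fun ⟨hU, h6⟩ => h116 ?_) φ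
    have hcard := Complex.card_rootsOfUnity (d * e)
    have : Subsingleton (rootsOfUnity (d * e) ℂ) := ⟨fun x y => (hU x).trans (hU y).symm⟩
    rw [Nat.card_unique, eq_comm, mul_eq_one] at hcard
    exact ⟨hcard.1, hcard.2, by simpa using h6⟩

end monomialGroup

/-- **Proposition 12 (Marin–Michel).** Every automorphism of `G(de,e,r)` is the composition
of an automorphism preserving the reflections with a central automorphism, except for
`G(1,1,6) ≅ 𝔖₆` and the non-irreducible group `G(2,2,2) ≅ 𝔖₂ × 𝔖₂`. -/
theorem automorphisms_of_Gdeer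
    (d e r : ℕ) (hd : 1 ≤ d) (he : 1 ≤ e) (hr : 1 ≤ r)
    (h116 : ¬ (d = 1 ∧ e = 1 ∧ r = 6))
    (h222 : ¬ (d = 1 ∧ e = 2 ∧ r = 2)) :
    ∀ φ : MulAut ↥(Gdeer d e r), ∃ β α : MulAut ↥(Gdeer d e r),
      PreservesMatrixReflections (Gdeer d e r) β ∧ IsCentralAut α ∧ φ = β * α := by
  intro φ
  have : NeZero (d * e) := ⟨by positivity⟩
  let E := monomialGroup.equivGdeer d e r
  obtain ⟨β, α, hβ, hα, h⟩ := monomialGroup.decomposition d e r hr h116 (MulAut.congr E.symm φ)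
  refine ⟨MulAut.congr E β, MulAut.congr E α, fun g => ?_, fun g => ?_, ?_⟩
  · obtain ⟨g, rfl⟩ := E.surjective g
    have : MulAut.congr E β (E g) = E (β g) := by simp [MulAut.congr]
    rw [this, monomialGroup.isMatrixReflection_equivGdeer_iff,
      monomialGroup.isMatrixReflection_equivGdeer_iff]
    exact hβ g
  · obtain ⟨g, rfl⟩ := E.surjective g
    have : (E g)⁻¹ * MulAut.congr E α (E g) = E (g⁻¹ * α g) := by simp [MulAut.congr]
    rw [this, Subgroup.mem_center_iff]
    intro k
    obtain ⟨k, rfl⟩ := E.surjective k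
    rw [← map_mul, ← map_mul, Subgroup.mem_center_iff.1 (hα g)]
  · rw [← map_mul, ← h]
    ext g
    simp [MulAut.congr]
end

section
/- The subgroup D(de,e,r) of diagonal matrices of G = G(de,e,r) is a characteristic subgroup of G if and only if G is not one of the groups G(2,2,2), G(2,1,2), G(4,2,2), G(3,3,3), G(2,2,4). -/
open Module LinearMap

/-- The set of diagonal matrices in `G(de,e,r)`. -/
def diagonalSet (d e r : ℕ) : Set (Matrix.GeneralLinearGroup (Fin r) ℂ) :=
  {A | (∀ i j, i ≠ j → (A : Matrix (Fin r) (Fin r) ℂ) i j = 0) ∧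
    (∀ i, ((A : Matrix (Fin r) (Fin r) ℂ) i i) ^ (d * e) = 1) ∧
    (∏ i, (A : Matrix (Fin r) (Fin r) ℂ) i i) ^ d = 1}

/-- The subgroup `D(de,e,r)` of diagonal matrices of `G(de,e,r)`. -/
def Ddeer (d e r : ℕ) : Subgroup (Matrix.GeneralLinearGroup (Fin r) ℂ) :=
  Subgroup.closure (diagonalSet d e r)

/-- The matrix sending the basis vector `e_j` to `w j • e_(σ j)`. -/
def monomialMatrix {r : ℕ} (w : Fin r → ℂˣ) (σ : Equiv.Perm (Fin r)) :
    Matrix (Fin r) (Fin r) ℂ :=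
  Matrix.of fun i j => if i = σ j then (w j : ℂ) else 0

theorem monomialMatrix_apply {r : ℕ} (w : Fin r → ℂˣ) (σ : Equiv.Perm (Fin r)) (i j : Fin r) :
    monomialMatrix w σ i j = if i = σ j then (w j : ℂ) else 0 := rfl

theorem monomialMatrix_mul {r : ℕ} (w v : Fin r → ℂˣ) (σ τ : Equiv.Perm (Fin r)) :
    monomialMatrix w σ * monomialMatrix v τ =
      monomialMatrix (fun j => w (τ j) * v j) (σ * τ) := by
  ext i j
  simp only [Matrix.mul_apply, monomialMatrix_apply, mul_ite, mul_zero, ite_mul, zero_mul]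
  rw [Finset.sum_ite_eq' Finset.univ (τ j)]
  simp only [Finset.mem_univ, if_true, Equiv.Perm.mul_apply]
  split_ifs <;> simp_all

theorem monomialMatrix_one {r : ℕ} :
    monomialMatrix (1 : Fin r → ℂˣ) 1 = 1 := by
  ext i j
  simp only [monomialMatrix_apply, Matrix.one_apply, Equiv.Perm.one_apply]
  split_ifs <;> simp_all

/-- The invertible monomial matrix sending `e_j` to `w j • e_(σ j)`. -/
def monomial {r : ℕ} (w : Fin r → ℂˣ) (σ : Equiv.Perm (Fin r)) :
    Matrix.GeneralLinearGroup (Fin r) ℂ where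
  val := monomialMatrix w σ
  inv := monomialMatrix (fun j => (w (σ⁻¹ j))⁻¹) σ⁻¹
  val_inv := by
    rw [monomialMatrix_mul, ← monomialMatrix_one]
    congr 1
    · ext j; simp
    · simp
  inv_val := by
    rw [monomialMatrix_mul, ← monomialMatrix_one]
    congr 1
    · ext j; simp
    · simp

theorem monomial_apply {r : ℕ} (w : Fin r → ℂˣ) (σ : Equiv.Perm (Fin r)) (i j : Fin r) :
    (monomial w σ : Matrix (Fin r) (Fin r) ℂ) i j = if i = σ j then (w j : ℂ) else 0 := rfl

theorem monomial_mul {r : ℕ} (w v : Fin r → ℂˣ) (σ τ : Equiv.Perm (Fin r)) :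
    monomial w σ * monomial v τ = monomial (fun j => w (τ j) * v j) (σ * τ) :=
  Units.ext (monomialMatrix_mul w v σ τ)

theorem monomial_one {r : ℕ} : monomial (1 : Fin r → ℂˣ) 1 = 1 :=
  Units.ext monomialMatrix_one

theorem monomial_inv {r : ℕ} (w : Fin r → ℂˣ) (σ : Equiv.Perm (Fin r)) :
    (monomial w σ)⁻¹ = monomial (fun j => (w (σ⁻¹ j))⁻¹) σ⁻¹ :=
  Units.ext rfl

theorem monomial_inj {r : ℕ} {w v : Fin r → ℂˣ} {σ τ : Equiv.Perm (Fin r)} :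
    monomial w σ = monomial v τ ↔ w = v ∧ σ = τ := by
  refine ⟨fun h => ?_, fun ⟨h, h'⟩ => by rw [h, h']⟩
  have key : ∀ j, σ j = τ j ∧ w j = v j := fun j => by
    have h1 := congrArg (fun A : Matrix.GeneralLinearGroup (Fin r) ℂ =>
      (A : Matrix (Fin r) (Fin r) ℂ) (σ j) j) h
    simp only [monomial_apply, if_true] at h1
    split_ifs at h1 with h2
    · exact ⟨h2, Units.ext h1⟩
    · exact absurd h1 (w j).ne_zero
  exact ⟨funext fun j => (key j).2, Equiv.ext fun j => (key j).1⟩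

/-- The weights of the elements of `G(de,e,r)`. -/
def IsWeight {r : ℕ} (d e : ℕ) (w : Fin r → ℂˣ) : Prop :=
  (∀ j, w j ^ (d * e) = 1) ∧ (∏ j, w j) ^ d = 1

theorem mem_monomialSet_iff {d e r : ℕ} {A : Matrix.GeneralLinearGroup (Fin r) ℂ} :
    A ∈ monomialSet d e r ↔ ∃ w σ, IsWeight d e w ∧ A = monomial w σ := by
  constructor
  · rintro ⟨σ, hσ, h1, h2⟩
    have h0 : ∀ j, (A : Matrix (Fin r) (Fin r) ℂ) (σ j) j ≠ 0 := fun j => (hσ _ _).2 rfl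
    refine ⟨fun j => Units.mk0 _ (h0 j), σ, ⟨fun j => Units.ext (by simpa using h1 j),
      Units.ext (by simpa using h2)⟩, Units.ext ?_⟩
    ext i j
    rw [monomial_apply]
    split_ifs with h
    · simp [h]
    · by_contra h'
      exact h ((hσ _ _).1 h')
  · rintro ⟨w, σ, ⟨h1, h2⟩, rfl⟩
    refine ⟨σ, fun i j => ?_, fun j => ?_, ?_⟩
    · simp [monomial_apply]
    · have := congrArg Units.val (h1 j)
      simpa [monomial_apply] using this
    · have := congrArg Units.val h2
      simpa [monomial_apply] using this

theorem mem_Gdeer_iff {d e r : ℕ} {A : Matrix.GeneralLinearGroup (Fin r) ℂ} :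
    A ∈ Gdeer d e r ↔ ∃ w σ, IsWeight d e w ∧ A = monomial w σ := by
  refine ⟨fun h => ?_, fun h => Subgroup.subset_closure (mem_monomialSet_iff.2 h)⟩
  induction h using Subgroup.closure_induction with
  | mem x hx => exact mem_monomialSet_iff.1 hx
  | one => exact ⟨1, 1, by simp [IsWeight], monomial_one.symm⟩
  | mul x y _ _ hx hy =>
    obtain ⟨w, σ, ⟨h1, h2⟩, rfl⟩ := hx
    obtain ⟨v, τ, ⟨h3, h4⟩, rfl⟩ := hy
    refine ⟨_, _, ⟨fun j => ?_, ?_⟩, monomial_mul _ _ _ _⟩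
    · rw [mul_pow, h1, h3, one_mul]
    · rw [Finset.prod_mul_distrib, Equiv.prod_comp τ w, mul_pow, h2, h4, one_mul]
  | inv x _ hx =>
    obtain ⟨w, σ, ⟨h1, h2⟩, rfl⟩ := hx
    refine ⟨_, _, ⟨fun j => ?_, ?_⟩, monomial_inv _ _⟩
    · rw [inv_pow, h1, inv_one]
    · rw [Finset.prod_inv_distrib, Equiv.prod_comp σ⁻¹ w, inv_pow, h2, inv_one]

theorem monomial_mem_Gdeer {d e r : ℕ} {w : Fin r → ℂˣ} (hw : IsWeight d e w)
    (σ : Equiv.Perm (Fin r)) : monomial w σ ∈ Gdeer d e r :=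
  mem_Gdeer_iff.2 ⟨w, σ, hw, rfl⟩

theorem isWeight_one {d e r : ℕ} : IsWeight d e (1 : Fin r → ℂˣ) := by
  simp [IsWeight]

theorem mem_Ddeer_iff {d e r : ℕ} {A : Matrix.GeneralLinearGroup (Fin r) ℂ} :
    A ∈ Ddeer d e r ↔ ∃ w, IsWeight d e w ∧ A = monomial w 1 := by
  constructor
  · intro h
    induction h using Subgroup.closure_induction with
    | mem x hx =>
      obtain ⟨h1, h2, h3⟩ := hx
      have h0 : ∀ i, (x : Matrix (Fin r) (Fin r) ℂ) i i ≠ 0 := fun i h => by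
        have hdet : (x : Matrix (Fin r) (Fin r) ℂ).det ≠ 0 :=
          ((Matrix.isUnit_iff_isUnit_det _).1 x.isUnit).ne_zero
        refine hdet (Matrix.det_eq_zero_of_row_eq_zero i fun j => ?_)
        by_cases hij : i = j
        · rw [← hij, h]
        · exact h1 i j hij
      refine ⟨fun j => Units.mk0 _ (h0 j), ⟨fun j => Units.ext (by simpa using h2 j),
        Units.ext (by simpa using h3)⟩, Units.ext ?_⟩
      ext i j
      rw [monomial_apply]
      split_ifs with h
      · simp [h]
      · exact h1 i j h
    | one => exact ⟨1, isWeight_one, monomial_one.symm⟩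
    | mul x y _ _ hx hy =>
      obtain ⟨w, ⟨h1, h2⟩, rfl⟩ := hx
      obtain ⟨v, ⟨h3, h4⟩, rfl⟩ := hy
      refine ⟨_, ⟨fun j => ?_, ?_⟩, monomial_mul _ _ _ _⟩
      · rw [mul_pow, h1, h3, one_mul]
      · rw [Finset.prod_mul_distrib, Equiv.prod_comp 1 w, mul_pow, h2, h4, one_mul]
    | inv x _ hx =>
      obtain ⟨w, ⟨h1, h2⟩, rfl⟩ := hx
      refine ⟨_, ⟨fun j => ?_, ?_⟩, monomial_inv _ _⟩
      · rw [inv_pow, h1, inv_one]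
      · rw [Finset.prod_inv_distrib, Equiv.prod_comp 1⁻¹ w, inv_pow, h2, inv_one]
  · rintro ⟨w, ⟨h1, h2⟩, rfl⟩
    refine Subgroup.subset_closure ⟨fun i j h => ?_, fun i => ?_, ?_⟩
    · simp [monomial_apply, h]
    · have := congrArg Units.val (h1 i)
      simpa [monomial_apply] using this
    · have := congrArg Units.val h2
      simpa [monomial_apply] using this

theorem monomial_mem_Ddeer_iff {d e r : ℕ} {w : Fin r → ℂˣ} {σ : Equiv.Perm (Fin r)} :
    monomial w σ ∈ Ddeer d e r ↔ IsWeight d e w ∧ σ = 1 := by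
  rw [mem_Ddeer_iff]
  constructor
  · rintro ⟨v, hv, h⟩
    obtain ⟨rfl, hσ⟩ := monomial_inj.1 h
    exact ⟨hv, hσ⟩
  · rintro ⟨hw, rfl⟩
    exact ⟨w, hw, rfl⟩

/-- A permutation of at least five points that commutes with all its conjugates is trivial. -/
theorem perm_eq_one_of_commute_conj {r : ℕ} (hr : 5 ≤ r) (σ : Equiv.Perm (Fin r))
    (h : ∀ τ : Equiv.Perm (Fin r), σ * (τ * σ * τ⁻¹) = τ * σ * τ⁻¹ * σ) : σ = 1 := by
  have avoid : ∀ s : Finset (Fin r), s.card ≤ 4 → ∃ x, x ∉ s := fun s hs => by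
    by_contra! hx
    have := Finset.card_le_card (fun x _ => hx x : Finset.univ ⊆ s)
    simp at this
    omega
  have conj : ∀ (τ : Equiv.Perm (Fin r)) (a : Fin r),
      σ (τ (σ (τ.symm a))) = τ (σ (τ.symm (σ a))) := fun τ a => by
    simpa using congrArg (fun p : Equiv.Perm (Fin r) => p a) (h τ)
  have invol : ∀ a, σ (σ a) = a := fun a => by
    by_contra hc
    have hb : σ a ≠ a := fun hb => hc (by rw [hb, hb])
    have hcb : σ (σ a) ≠ σ a := fun hb' => hb (σ.injective hb')
    obtain ⟨x, hx⟩ := avoid {a, σ a, σ (σ a)} (Finset.card_le_three.trans (by norm_num))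
    simp only [Finset.mem_insert, Finset.mem_singleton, not_or] at hx
    have := conj (Equiv.swap (σ (σ a)) x) a
    simp only [Equiv.symm_swap] at this
    rw [Equiv.swap_apply_of_ne_of_ne (Ne.symm hc) (Ne.symm hx.1),
      Equiv.swap_apply_of_ne_of_ne hcb.symm (Ne.symm hx.2.1), Equiv.swap_apply_left] at this
    exact hx.2.2 this.symm
  by_contra hσ
  obtain ⟨a, ha⟩ : ∃ a, σ a ≠ a := by
    by_contra! h'
    exact hσ (Equiv.ext h')
  have nofix : ∀ x, σ x ≠ x := fun x hx => by
    have hxa : x ≠ a := fun h' => ha (h' ▸ hx)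
    have hxb : x ≠ σ a := fun h' => by
      rw [h', invol] at hx
      exact ha hx.symm
    have := conj (Equiv.swap (σ a) x) a
    simp only [Equiv.symm_swap] at this
    rw [Equiv.swap_apply_of_ne_of_ne ha.symm hxa.symm, Equiv.swap_apply_left, hx,
      Equiv.swap_apply_right] at this
    exact hxb this
  obtain ⟨x, hx⟩ := avoid {a, σ a} (Finset.card_le_two.trans (by norm_num))
  obtain ⟨z, hz⟩ := avoid {a, σ a, x, σ x} Finset.card_le_four
  simp only [Finset.mem_insert, Finset.mem_singleton, not_or] at hx hz
  have hτa : (Equiv.swap (σ a) x * Equiv.swap x z) a = a := by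
    rw [Equiv.Perm.mul_apply, Equiv.swap_apply_of_ne_of_ne (Ne.symm hx.1) (Ne.symm hz.1),
      Equiv.swap_apply_of_ne_of_ne ha.symm (Ne.symm hx.1)]
  have hτz : (Equiv.swap (σ a) x * Equiv.swap x z) z = σ a := by
    rw [Equiv.Perm.mul_apply, Equiv.swap_apply_right, Equiv.swap_apply_right]
  have hτb : (Equiv.swap (σ a) x * Equiv.swap x z) (σ a) = x := by
    rw [Equiv.Perm.mul_apply, Equiv.swap_apply_of_ne_of_ne (Ne.symm hx.2) (Ne.symm hz.2.1),
      Equiv.swap_apply_left]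
  have hw : (Equiv.swap (σ a) x * Equiv.swap x z) (σ z) = σ z := by
    have h1 : σ z ≠ x := fun h' => hz.2.2.2 (by rw [← h', invol])
    have h2 : σ z ≠ σ a := fun h' => hz.1 (σ.injective h')
    rw [Equiv.Perm.mul_apply, Equiv.swap_apply_of_ne_of_ne h1 (nofix z),
      Equiv.swap_apply_of_ne_of_ne h2 h1]
  have := conj (Equiv.swap (σ a) x * Equiv.swap x z) a
  rw [(Equiv.symm_apply_eq _).2 hτa.symm, (Equiv.symm_apply_eq _).2 hτz.symm, hτb, hw] at this
  exact hz.2.2.1 (σ.injective this.symm)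

theorem perm_two (σ : Equiv.Perm (Fin 2)) (hσ : σ ≠ 1) : σ 0 = 1 ∧ σ 1 = 0 := by
  revert σ
  decide

theorem perm_three (σ : Equiv.Perm (Fin 3)) (hσ : σ ≠ 1)
    (h : ∀ τ : Equiv.Perm (Fin 3), σ * (τ * σ * τ⁻¹) = τ * σ * τ⁻¹ * σ) :
    σ 0 ≠ 0 ∧ σ (σ 0) ≠ 0 ∧ σ (σ 0) ≠ σ 0 := by
  revert σ
  decide

set_option synthInstance.maxHeartbeats 200000 in
set_option maxRecDepth 10000 in
theorem perm_four (σ : Equiv.Perm (Fin 4)) (hσ : σ ≠ 1)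
    (h : ∀ τ : Equiv.Perm (Fin 4), σ * (τ * σ * τ⁻¹) = τ * σ * τ⁻¹ * σ) :
    ∃ τ : Equiv.Perm (Fin 4), σ 0 ≠ 0 ∧ (τ * σ * τ⁻¹) 0 ≠ σ 0 ∧
      σ ((τ * σ * τ⁻¹) 0) ≠ σ 0 ∧ σ ((τ * σ * τ⁻¹) 0) ≠ 0 ∧
      σ ((τ * σ * τ⁻¹) 0) ≠ (τ * σ * τ⁻¹) 0 ∧ (τ * σ * τ⁻¹) 0 ≠ 0 := by
  revert σ
  decide

theorem exists_primitiveRoot_units {n : ℕ} (hn : n ≠ 0) : ∃ ζ : ℂˣ, IsPrimitiveRoot ζ n :=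
  ⟨_, (Complex.isPrimitiveRoot_exp n hn).isUnit_unit hn⟩

theorem isWeight_mulSingle_mul {d e r : ℕ} {ζ : ℂˣ} (hζ : ζ ^ (d * e) = 1) (p q : Fin r) :
    IsWeight d e (Pi.mulSingle p ζ * Pi.mulSingle q ζ⁻¹) := by
  refine ⟨fun j => ?_, ?_⟩
  · simp only [Pi.mul_apply, Pi.mulSingle_apply, mul_pow]
    split_ifs <;> simp [hζ]
  · simp [Finset.prod_mul_distrib]

theorem isWeight_mulSingle {d r : ℕ} {ζ : ℂˣ} (hζ : ζ ^ d = 1) (p : Fin r) :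
    IsWeight d 1 (Pi.mulSingle p ζ) := by
  refine ⟨fun j => ?_, ?_⟩
  · simp only [Pi.mulSingle_apply]
    split_ifs <;> simp [hζ]
  · simp [hζ]

theorem commute_diagonal {r : ℕ} (w v : Fin r → ℂˣ) :
    Commute (monomial w 1) (monomial v 1) := by
  rw [commute_iff_eq, monomial_mul, monomial_mul]
  congr 1
  ext j
  simp [mul_comm]

theorem normal_subgroupOf_Ddeer (d e r : ℕ) : ((Ddeer d e r).subgroupOf (Gdeer d e r)).Normal := by
  refine ⟨fun x hx g => ?_⟩
  rw [Subgroup.mem_subgroupOf] at hx ⊢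
  obtain ⟨w, hw, hxw⟩ := mem_Ddeer_iff.1 hx
  obtain ⟨v, τ, hv, hg⟩ := mem_Gdeer_iff.1 g.2
  obtain ⟨u, ρ, hu, hgu⟩ := mem_Gdeer_iff.1 (g * x * g⁻¹).2
  rw [hgu, monomial_mem_Ddeer_iff]
  refine ⟨hu, ?_⟩
  rw [Subgroup.coe_mul, Subgroup.coe_mul, Subgroup.coe_inv, hg, hxw, monomial_inv, monomial_mul,
    monomial_mul, monomial_inj] at hgu
  simpa using hgu.2.symm

/-- The images of a diagonal element under an automorphism commute with all their conjugates. -/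
theorem commute_conj_of_mem_Ddeer {d e r : ℕ} (α : Gdeer d e r ≃* Gdeer d e r)
    {t : Gdeer d e r} (ht : (t : Matrix.GeneralLinearGroup (Fin r) ℂ) ∈ Ddeer d e r)
    (g h : Gdeer d e r) : Commute (g * α t * g⁻¹) (h * α t * h⁻¹) := by
  obtain ⟨g, rfl⟩ := α.surjective g
  obtain ⟨h, rfl⟩ := α.surjective h
  rw [← map_inv, ← map_inv, ← map_mul, ← map_mul, ← map_mul, ← map_mul]
  refine Commute.map ?_ α
  have hn := normal_subgroupOf_Ddeer d e r
  obtain ⟨w, -, hw⟩ := mem_Ddeer_iff.1 (Subgroup.mem_subgroupOf.1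
    (hn.conj_mem t (Subgroup.mem_subgroupOf.2 ht) g))
  obtain ⟨v, -, hv⟩ := mem_Ddeer_iff.1 (Subgroup.mem_subgroupOf.1
    (hn.conj_mem t (Subgroup.mem_subgroupOf.2 ht) h))
  refine Subtype.ext ?_
  change ((g * t * g⁻¹ : Gdeer d e r) : Matrix.GeneralLinearGroup (Fin r) ℂ) *
    (h * t * h⁻¹ : Gdeer d e r) = (h * t * h⁻¹ : Gdeer d e r) * (g * t * g⁻¹ : Gdeer d e r)
  rw [hw, hv]
  exact commute_diagonal w v

theorem commute_perm_and_weight_relation {d e r : ℕ} {w : Fin r → ℂˣ} {σ : Equiv.Perm (Fin r)}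
    
    (h : ∀ g ∈ Gdeer d e r, ∀ k ∈ Gdeer d e r,
      Commute (g * monomial w σ * g⁻¹) (k * monomial w σ * k⁻¹))
    (τ : Equiv.Perm (Fin r)) :
    σ * (τ * σ * τ⁻¹) = τ * σ * τ⁻¹ * σ ∧
      ∀ v : Fin r → ℂˣ, IsWeight d e v → ∀ j,
        v (σ j) * v ((τ * σ * τ⁻¹) j) = v j * v (σ ((τ * σ * τ⁻¹) j)) := by
  have hτ : monomial 1 τ ∈ Gdeer d e r := monomial_mem_Gdeer isWeight_one τ
  obtain ⟨u, hu⟩ : ∃ u, monomial 1 τ * monomial w σ * (monomial 1 τ)⁻¹ =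
      monomial u (τ * σ * τ⁻¹) := by
    rw [monomial_inv, monomial_mul, monomial_mul]
    exact ⟨_, rfl⟩
  have h1 := (h 1 (one_mem _) _ hτ).eq
  rw [hu, one_mul, inv_one, mul_one, monomial_mul, monomial_mul, monomial_inj] at h1
  refine ⟨h1.2, fun v hv j => ?_⟩
  have h2 := (h _ (monomial_mem_Gdeer hv 1) _ hτ).eq
  rw [hu, monomial_inv] at h2
  simp only [monomial_mul, monomial_inj, inv_one, mul_one, one_mul] at h2
  have h3 := congrFun h1.1 j
  have h4 := congrFun h2.1 j
  have h5 : σ ((τ * σ * τ⁻¹) j) = (τ * σ * τ⁻¹) (σ j) :=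
    congrArg (fun p : Equiv.Perm (Fin r) => p j) h1.2
  simp only [Equiv.Perm.one_apply] at h4
  generalize τ * σ * τ⁻¹ = ρ at *
  have h6 : v (σ (ρ j)) / v (ρ j) = v (σ j) / v j := by
    refine mul_right_cancel (b := w (ρ j) * u j) ?_
    calc v (σ (ρ j)) / v (ρ j) * (w (ρ j) * u j)
        = v (σ (ρ j)) * w (ρ j) * (v (ρ j))⁻¹ * u j := by rw [div_eq_mul_inv]; ac_rfl
      _ = v (σ j) / v j * (w (ρ j) * u j) := by rw [h4, h3, div_eq_mul_inv]; ac_rfl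
  rw [div_eq_div_iff_mul_eq_mul] at h6
  rw [← h6, mul_comm]

theorem characteristic_of_not_exceptional
    (d e r : ℕ) (hd : 1 ≤ d) (he : 1 ≤ e) (hr : 1 ≤ r)
    (hex : ¬ ((d = 1 ∧ e = 2 ∧ r = 2) ∨ (d = 2 ∧ e = 1 ∧ r = 2) ∨ (d = 2 ∧ e = 2 ∧ r = 2) ∨
        (d = 1 ∧ e = 3 ∧ r = 3) ∨ (d = 1 ∧ e = 2 ∧ r = 4))) :
    ((Ddeer d e r).subgroupOf (Gdeer d e r)).Characteristic := by
  refine Subgroup.characteristic_iff_le_comap.2 fun α t ht => ?_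
  rw [Subgroup.mem_subgroupOf] at ht
  rw [Subgroup.mem_comap, Subgroup.mem_subgroupOf]
  change (α t : Matrix.GeneralLinearGroup (Fin r) ℂ) ∈ _
  obtain ⟨u, hu, htu⟩ := mem_Ddeer_iff.1 ht
  obtain ⟨w, σ, hw, hαt⟩ := mem_Gdeer_iff.1 (α t).2
  rw [hαt, monomial_mem_Ddeer_iff]
  refine ⟨hw, ?_⟩
  by_contra hσ
  have hcomm : ∀ g ∈ Gdeer d e r, ∀ k ∈ Gdeer d e r,
      Commute (g * monomial w σ * g⁻¹) (k * monomial w σ * k⁻¹) := fun g hg k hk => by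
    have := congrArg Subtype.val (commute_conj_of_mem_Ddeer α ht ⟨g, hg⟩ ⟨k, hk⟩).eq
    simpa only [Subgroup.coe_mul, Subgroup.coe_inv, hαt, commute_iff_eq] using this
  have key := commute_perm_and_weight_relation hcomm
  have hperm := fun τ => (key τ).1
  obtain ⟨ζ, hζ⟩ := exists_primitiveRoot_units (n := d * e) (by positivity)
  have hde : d * e ≠ 1 := fun hde => by
    have hu1 : u = 1 := funext fun j => by simpa [hde] using hu.1 j
    have ht1 : t = 1 := Subtype.ext (by rw [htu, hu1, monomial_one]; rfl)
    rw [ht1, map_one, Subgroup.coe_one, ← monomial_one, monomial_inj] at hαt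
    exact hσ hαt.2.symm
  have weight := fun p q => isWeight_mulSingle_mul hζ.pow_eq_one (r := r) p q
  have dvd : ∀ k, ζ ^ k = 1 → d * e ∣ k := fun k => (hζ.pow_eq_one_iff_dvd k).1
  rcases (by omega : r = 1 ∨ r = 2 ∨ r = 3 ∨ r = 4 ∨ 5 ≤ r) with rfl | rfl | rfl | rfl | hr5
  · exact hσ (Subsingleton.elim _ _)
  · obtain ⟨h0, h1⟩ := perm_two σ hσ
    have rel : ∀ v : Fin 2 → ℂˣ, IsWeight d e v → v 1 * v 1 = v 0 * v 0 := fun v hv => by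
      simpa [h0, h1] using (key 1).2 v hv 0
    have h4 := rel _ (weight 1 0)
    simp only [Pi.mul_apply, Pi.mulSingle_apply] at h4
    simp at h4
    have hde4 := dvd 4 (by
      rw [← mul_inv, eq_inv_iff_mul_eq_one] at h4
      rw [← h4]
      simp only [pow_succ, pow_zero, one_mul, mul_assoc])
    have hcases : d = 1 ∧ e = 4 ∨ d = 4 ∧ e = 1 := by
      have hd4 : d ≤ 4 := Nat.le_of_dvd (by norm_num) (dvd_of_mul_right_dvd hde4)
      have he4 : e ≤ 4 := Nat.le_of_dvd (by norm_num) (dvd_of_mul_left_dvd hde4)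
      clear * - hd he hd4 he4 hde4 hde hex
      interval_cases d <;> interval_cases e <;> omega
    rcases hcases with ⟨rfl, rfl⟩ | ⟨rfl, rfl⟩
    · have hw01 : w 0 * w 1 = 1 := by simpa using hw.2
      have hu01 : u 0 * u 1 = 1 := by simpa using hu.2
      have hα2 : α t * α t = 1 := Subtype.ext (by
        rw [Subgroup.coe_mul, hαt, monomial_mul, Subgroup.coe_one, ← monomial_one, monomial_inj]
        refine ⟨funext fun j => ?_, Equiv.ext fun j => ?_⟩ <;> fin_cases j <;>
          simp [h0, h1, hw01, mul_comm (w 1)])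
      have ht2 : t * t = 1 := α.injective (by rw [map_mul, hα2, map_one])
      have hu2 : u 0 = u 1 := by
        have := congrArg Subtype.val ht2
        rw [Subgroup.coe_mul, htu, monomial_mul, Subgroup.coe_one, ← monomial_one,
          monomial_inj] at this
        have h00 : u 0 * u 0 = 1 := congrFun this.1 0
        exact mul_left_cancel (h00.trans hu01.symm)
      have hcentral : ∀ g, Commute t g := fun g => Subtype.ext (by
        obtain ⟨v, τ, -, hv⟩ := mem_Gdeer_iff.1 g.2
        rw [Subgroup.coe_mul, Subgroup.coe_mul, htu, hv, monomial_mul, monomial_mul, monomial_inj]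
        have hconst : ∀ i, u i = u 0 := fun i => by fin_cases i <;> simp [hu2]
        refine ⟨funext fun j => ?_, by simp⟩
        simp [hconst (τ j), hconst j, mul_comm])
      obtain ⟨g, hg⟩ := α.surjective ⟨_, monomial_mem_Gdeer (weight 1 0) 1⟩
      have := congrArg Subtype.val ((hcentral g).map α).eq
      rw [hg, Subgroup.coe_mul, Subgroup.coe_mul, hαt, monomial_mul, monomial_mul,
        monomial_inj] at this
      have h2 := congrFun this.1 0
      simp [h0, mul_comm] at h2
      have := dvd 2 (by rw [sq]; exact eq_inv_iff_mul_eq_one.1 h2.symm)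
      omega
    · have h2 := rel _ (isWeight_mulSingle hζ.pow_eq_one 1)
      simp at h2
      have := dvd 2 (by rw [sq, h2])
      omega
  · obtain ⟨h0, h1, h2⟩ := perm_three σ hσ hperm
    have rel : ∀ v : Fin 3 → ℂˣ, IsWeight d e v → v (σ 0) * v (σ 0) = v 0 * v (σ (σ 0)) :=
      fun v hv => by simpa using (key 1).2 v hv 0
    have h3 := rel _ (weight (σ 0) 0)
    simp [h0, h1, h2, h0.symm] at h3
    have hde3 := (Nat.dvd_prime Nat.prime_three).1
      (dvd 3 (by rw [pow_succ, sq]; exact eq_inv_iff_mul_eq_one.1 h3))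
    rcases Nat.prime_mul_iff.1 ((hde3.resolve_left hde).symm ▸ Nat.prime_three) with
      ⟨-, rfl⟩ | ⟨-, rfl⟩
    · have h4 := rel _ (isWeight_mulSingle (by simpa using hζ.pow_eq_one) (σ 0))
      simp [h0.symm, h2] at h4
      have h5 := Nat.le_of_dvd two_pos (dvd 2 (by rw [sq, h4]))
      omega
    · omega
  · obtain ⟨τ, h0, h1, h2, h3, h4, h5⟩ := perm_four σ hσ hperm
    have rel := fun v hv => (key τ).2 v hv 0
    generalize (τ * σ * τ⁻¹) 0 = q at *
    have h6 := rel _ (weight (σ 0) 0)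
    simp [*] at h6
    have hde2 := (Nat.dvd_prime Nat.prime_two).1
      (dvd 2 (by rw [sq]; exact eq_inv_iff_mul_eq_one.1 h6))
    rcases Nat.prime_mul_iff.1 ((hde2.resolve_left hde).symm ▸ Nat.prime_two) with
      ⟨-, rfl⟩ | ⟨-, rfl⟩
    · have h7 := rel _ (isWeight_mulSingle (by simpa using hζ.pow_eq_one) (σ 0))
      simp [h0.symm, h1, h2] at h7
      exact hde (hζ.eq_orderOf.trans (by simp [h7]))
    · omega
  · exact hσ (perm_eq_one_of_commute_conj hr5 σ hperm)

theorem not_characteristic_of_conj {d e r : ℕ} (P : Matrix.GeneralLinearGroup (Fin r) ℂ)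
    (hP : ∀ w σ, IsWeight d e w → P * monomial w σ * P⁻¹ ∈ Gdeer d e r)
    (z : ℂ) (c : Matrix.GeneralLinearGroup (Fin r) ℂ) (hc : c ∈ Gdeer d e r)
    (hPP : (P * P : Matrix (Fin r) (Fin r) ℂ) = z • (c : Matrix (Fin r) (Fin r) ℂ))
    {t : Matrix.GeneralLinearGroup (Fin r) ℂ} (ht : t ∈ Ddeer d e r)
    (htP : P * t * P⁻¹ ∉ Ddeer d e r) :
    ¬ ((Ddeer d e r).subgroupOf (Gdeer d e r)).Characteristic := by
  intro hchar
  have hconj : ∀ g ∈ Gdeer d e r, P * g * P⁻¹ ∈ Gdeer d e r := fun g hg => by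
    obtain ⟨w, σ, hw, rfl⟩ := mem_Gdeer_iff.1 hg
    exact hP w σ hw
  have hnorm : P ∈ Subgroup.normalizer
      (Gdeer d e r : Set (Matrix.GeneralLinearGroup (Fin r) ℂ)) := by
    refine Subgroup.mem_normalizer_iff.2 fun g => ⟨hconj g, fun hg => ?_⟩
    have hsq : P * P * g = c * g * c⁻¹ * (P * P) := by
      refine Units.ext ?_
      rw [Units.val_mul (P * P) g, Units.val_mul (c * g * c⁻¹) (P * P), Units.val_mul P P, hPP,
        mul_smul_comm, smul_mul_assoc, ← Units.val_mul, ← Units.val_mul, inv_mul_cancel_right]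
    have h1 := hconj _ hg
    have h2 : P * (P * g * P⁻¹) * P⁻¹ = c * g * c⁻¹ := by
      rw [show P * (P * g * P⁻¹) * P⁻¹ = P * P * g * (P * P)⁻¹ by group, hsq,
        mul_inv_cancel_right]
    rw [h2] at h1
    simpa [mul_assoc] using mul_mem (mul_mem (inv_mem hc) h1) hc
  have htG : t ∈ Gdeer d e r := by
    obtain ⟨w, hw, rfl⟩ := mem_Ddeer_iff.1 ht
    exact monomial_mem_Gdeer hw 1
  have := Subgroup.characteristic_iff_le_comap.1 hchar
    (Subgroup.normalizerMonoidHom (Gdeer d e r) ⟨P, hnorm⟩)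
    (Subgroup.mem_subgroupOf.2 ht : (⟨t, htG⟩ : Gdeer d e r) ∈ _)
  exact htP this

theorem conj_eq_iff {r : ℕ} {P g g' : Matrix.GeneralLinearGroup (Fin r) ℂ} :
    P * g * P⁻¹ = g' ↔ (P * g : Matrix (Fin r) (Fin r) ℂ) = g' * P := by
  rw [mul_inv_eq_iff_eq_mul, Units.ext_iff]
  simp

/-- The invertible matrix with rows `(1, 1)` and `(1, -1)`. -/
noncomputable def hadamardTwo : Matrix.GeneralLinearGroup (Fin 2) ℂ :=
  Matrix.GeneralLinearGroup.mkOfDetNeZero !![1, 1; 1, -1] (by norm_num [Matrix.det_fin_two])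

theorem hadamardTwo_conj_monomial (a b : ℂˣ) (hab : a ^ 2 = b ^ 2) (σ : Equiv.Perm (Fin 2)) :
    ∃ v τ, (∀ j, v j = a ∨ v j = -a) ∧
      hadamardTwo * monomial ![a, b] σ * hadamardTwo⁻¹ = monomial v τ ∧
      (b = -a → σ = 1 → τ ≠ 1) := by
  simp only [conj_eq_iff]
  have hs : σ = 1 ∨ σ = Equiv.swap 0 1 := by revert σ; decide
  have hb : b = a ∨ b = -a := by
    have := sq_eq_sq_iff_eq_or_eq_neg.1 (congrArg Units.val hab)
    rcases this with h | h
    · exact Or.inl (Units.ext h.symm)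
    · exact Or.inr (Units.ext (by simp [h]))
  rcases hs with rfl | rfl <;> rcases hb with rfl | rfl
  · refine ⟨![b, b], 1, by simp, ?_, ?_⟩
    · ext i j
      fin_cases i <;> fin_cases j <;>
      simp [Matrix.mul_apply, Fin.sum_univ_two, monomial_apply, hadamardTwo,
        Matrix.GeneralLinearGroup.mkOfDetNeZero]
    · intro h
      exact absurd (congrArg Units.val h) (by simp [self_eq_neg])
  · refine ⟨![a, a], Equiv.swap 0 1, by simp, ?_, by simp⟩
    ext i j
    fin_cases i <;> fin_cases j <;>
      simp [Matrix.mul_apply, Fin.sum_univ_two, monomial_apply, hadamardTwo,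
        Matrix.GeneralLinearGroup.mkOfDetNeZero]
  · refine ⟨![b, -b], 1, by simp, ?_, by simp⟩
    ext i j
    fin_cases i <;> fin_cases j <;>
      simp [Matrix.mul_apply, Fin.sum_univ_two, monomial_apply, hadamardTwo,
        Matrix.GeneralLinearGroup.mkOfDetNeZero]
  · refine ⟨![-a, a], Equiv.swap 0 1, by simp, ?_, by simp⟩
    ext i j
    fin_cases i <;> fin_cases j <;>
      simp [Matrix.mul_apply, Fin.sum_univ_two, monomial_apply, hadamardTwo,
        Matrix.GeneralLinearGroup.mkOfDetNeZero]

theorem not_characteristic_rank_two (e : ℕ) (he : e = 1 ∨ e = 2) :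
    ¬ ((Ddeer 2 e 2).subgroupOf (Gdeer 2 e 2)).Characteristic := by
  have hw' : IsWeight 2 e ![(1 : ℂˣ), -1] := by
    refine ⟨fun j => ?_, by simp⟩
    rw [pow_mul]
    fin_cases j <;> simp
  refine not_characteristic_of_conj hadamardTwo (fun w σ hw => ?_) 2 1 (one_mem _) ?_
    (monomial_mem_Ddeer_iff.2 ⟨hw', rfl⟩) ?_
  · have hsq : w 0 ^ 2 = w 1 ^ 2 := by
      have h0 := hw.1 0
      have h1 := hw.1 1
      have h2 := hw.2
      rw [Fin.prod_univ_two, mul_pow] at h2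
      rcases he with rfl | rfl
      · rw [mul_one] at h0 h1
        rw [h0, h1]
      · rw [pow_mul, sq (w 1 ^ 2)] at h1
        exact mul_right_cancel (h2.trans h1.symm)
    obtain ⟨v, τ, hv, h, -⟩ := hadamardTwo_conj_monomial (w 0) (w 1) hsq σ
    have hw01 : ![w 0, w 1] = w := by ext j; fin_cases j <;> rfl
    rw [hw01] at h
    rw [h]
    have hvsq : ∀ j, v j ^ 2 = w 0 ^ 2 := fun j => by rcases hv j with h | h <;> simp [h]
    refine monomial_mem_Gdeer ⟨fun j => ?_, ?_⟩ τ
    · rw [pow_mul, hvsq, ← pow_mul, hw.1]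
    · have h2 := hw.2
      rw [Fin.prod_univ_two, mul_pow] at h2 ⊢
      rw [hvsq, hvsq, ← h2, hsq]
  · ext i j
    fin_cases i <;> fin_cases j <;> norm_num [Matrix.mul_apply, Fin.sum_univ_two, hadamardTwo,
        Matrix.GeneralLinearGroup.mkOfDetNeZero]
  · obtain ⟨v, τ, -, h, hτ⟩ := hadamardTwo_conj_monomial 1 (-1) (by simp) 1
    rw [h, monomial_mem_Ddeer_iff]
    exact fun h' => hτ rfl rfl h'.2

theorem monomial_eq_diagonal_mul {r : ℕ} (w : Fin r → ℂˣ) (σ : Equiv.Perm (Fin r)) :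
    monomial w σ = monomial (w ∘ σ.symm) 1 * monomial 1 σ := by
  rw [monomial_mul, monomial_inj]
  exact ⟨by ext j; simp, by simp⟩

theorem IsWeight.comp_perm {d e r : ℕ} {w : Fin r → ℂˣ} (hw : IsWeight d e w)
    (σ : Equiv.Perm (Fin r)) : IsWeight d e (w ∘ σ) :=
  ⟨fun j => hw.1 (σ j), by simpa [Equiv.prod_comp σ w] using hw.2⟩

theorem commute_scalar {r : ℕ} (a : ℂˣ) (g : Matrix.GeneralLinearGroup (Fin r) ℂ) :
    g * monomial (fun _ => a) 1 * g⁻¹ = monomial (fun _ => a) 1 := by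
  rw [conj_eq_iff]
  have : (monomial (fun _ => a) 1 : Matrix.GeneralLinearGroup (Fin r) ℂ).val =
      Matrix.scalar (Fin r) (a : ℂ) := by
    ext i j
    simp only [monomial_apply, Matrix.scalar_apply, Matrix.diagonal_apply, Equiv.Perm.one_apply]
    split_ifs <;> simp_all
  rw [this]
  exact (Matrix.scalar_commute _ (Commute.all _) _).symm.eq

theorem diagonal_pow {r : ℕ} (w : Fin r → ℂˣ) (k : ℕ) : monomial w 1 ^ k = monomial (w ^ k) 1 := by
  induction k with
  | zero => rw [pow_zero, pow_zero, monomial_one]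
  | succ k ih => rw [pow_succ, ih, monomial_mul, pow_succ]; rfl

/-- The elements `g` with `P * g * P⁻¹ ∈ G`. -/
def conjPreimage {H : Type*} [Group H] (P : H) (G : Subgroup H) : Subgroup H :=
  G.comap (MulAut.conj P).toMonoidHom

theorem mem_conjPreimage {H : Type*} [Group H] {P g : H} {G : Subgroup H} :
    g ∈ conjPreimage P G ↔ P * g * P⁻¹ ∈ G := Iff.rfl

/-- The discrete Fourier matrix of size three attached to a primitive cube root of unity. -/
theorem exists_fourierThree {ζ : ℂˣ} (hζ : IsPrimitiveRoot ζ 3) :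
    ∃ F : Matrix.GeneralLinearGroup (Fin 3) ℂ,
      F * monomial ![1, ζ, ζ ^ 2] 1 * F⁻¹ =
        monomial 1 (finRotate 3 * finRotate 3) ∧
      F * monomial 1 (finRotate 3) * F⁻¹ = monomial ![1, ζ, ζ ^ 2] 1 ∧
      F * monomial 1 (Equiv.swap 1 2) * F⁻¹ = monomial 1 (Equiv.swap 1 2) ∧
      (F * F : Matrix (Fin 3) (Fin 3) ℂ) = (3 : ℂ) •
        (monomial 1 (Equiv.swap 1 2) : Matrix.GeneralLinearGroup (Fin 3) ℂ).val := by
  have h3 : (ζ : ℂ) ^ 3 = 1 := by simpa using congrArg Units.val hζ.pow_eq_one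
  have hsum : (ζ : ℂ) ^ 2 + ζ + 1 = 0 := by
    have h1 : (ζ : ℂ) - 1 ≠ 0 := fun h =>
      hζ.ne_one (by norm_num) (Units.ext (by simpa using sub_eq_zero.1 h))
    refine mul_left_cancel₀ h1 ?_
    linear_combination h3
  let M : Matrix (Fin 3) (Fin 3) ℂ := !![1, 1, 1; 1, ζ, ζ ^ 2; 1, ζ ^ 2, ζ]
  have hdet : M.det ≠ 0 := by
    have : M.det = 3 * ((ζ : ℂ) ^ 2 - ζ) := by
      simp only [M, Matrix.det_fin_three]
      simp
      linear_combination (-ζ : ℂ) * h3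
    rw [this]
    intro h
    have h4 : (ζ : ℂ) = 1 := by
      have : (ζ : ℂ) * (ζ - 1) = 0 := by linear_combination h / 3
      rcases mul_eq_zero.1 this with h | h
      · exact absurd h ζ.ne_zero
      · linear_combination h
    exact hζ.ne_one (by norm_num) (Units.ext (by simpa using h4))
  have r0 : finRotate 3 0 = 1 := rfl
  have r1 : finRotate 3 1 = 2 := rfl
  have r2 : finRotate 3 2 = 0 := rfl
  have s0 : Equiv.swap (1 : Fin 3) 2 0 = 0 := rfl
  have h4 : (ζ : ℂ) ^ 4 = ζ := by linear_combination (ζ : ℂ) * h3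
  refine ⟨Matrix.GeneralLinearGroup.mkOfDetNeZero M hdet, conj_eq_iff.2 ?_, conj_eq_iff.2 ?_,
    conj_eq_iff.2 ?_, ?_⟩ <;> ext i j <;> fin_cases i <;> fin_cases j <;>
    simp [Matrix.mul_apply, Fin.sum_univ_three, monomial_apply, M,
      Matrix.GeneralLinearGroup.mkOfDetNeZero, r0, r1, r2, s0] <;>
    first
    | ring1
    | linear_combination hsum
    | linear_combination h3
    | linear_combination -h3
    | linear_combination h4
    | linear_combination -h4
    | linear_combination hsum + h4
    | linear_combination 2 * h3

theorem perm_three_eq (σ : Equiv.Perm (Fin 3)) :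
    ∃ i : Fin 3, ∃ j : Fin 2, σ = finRotate 3 ^ (i : ℕ) * Equiv.swap 1 2 ^ (j : ℕ) := by
  revert σ
  decide

theorem monomial_one_mul {r : ℕ} (σ τ : Equiv.Perm (Fin r)) :
    monomial 1 (σ * τ) = monomial 1 σ * monomial 1 τ := by
  rw [monomial_mul]
  congr 1
  ext j
  simp

theorem monomial_one_pow {r : ℕ} (σ : Equiv.Perm (Fin r)) (k : ℕ) :
    monomial 1 (σ ^ k) = monomial 1 σ ^ k := by
  induction k with
  | zero => rw [pow_zero, pow_zero, monomial_one]
  | succ k ih => rw [pow_succ, pow_succ, monomial_one_mul, ih]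

theorem not_characteristic_three : ¬ ((Ddeer 1 3 3).subgroupOf (Gdeer 1 3 3)).Characteristic := by
  obtain ⟨ζ, hζ⟩ := exists_primitiveRoot_units (n := 3) (by norm_num)
  obtain ⟨F, hA, hB, hC, hFF⟩ := exists_fourierThree hζ
  have hζ3 : ζ ^ 3 = 1 := hζ.pow_eq_one
  have hwt : IsWeight 1 3 ![1, ζ, ζ ^ 2] := by
    refine ⟨fun j => ?_, ?_⟩
    · fin_cases j
      · simp
      · simpa using hζ3
      · change (ζ ^ 2) ^ (1 * 3) = 1
        rw [← pow_mul, show 2 * (1 * 3) = 3 * 2 from rfl, pow_mul, hζ3, one_pow]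
    · simp [Fin.prod_univ_three, ← pow_succ', hζ3]
  have hAN : monomial ![1, ζ, ζ ^ 2] 1 ∈ conjPreimage F (Gdeer 1 3 3) := by
    rw [mem_conjPreimage, hA]
    exact monomial_mem_Gdeer isWeight_one _
  have hBN : monomial 1 (finRotate 3) ∈ conjPreimage F (Gdeer 1 3 3) := by
    rw [mem_conjPreimage, hB]
    exact monomial_mem_Gdeer hwt _
  have hCN : monomial 1 (Equiv.swap 1 2) ∈ conjPreimage F (Gdeer 1 3 3) := by
    rw [mem_conjPreimage, hC]
    exact monomial_mem_Gdeer isWeight_one _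
  have hσN : ∀ σ, monomial 1 σ ∈ conjPreimage F (Gdeer 1 3 3) := fun σ => by
    obtain ⟨i, j, rfl⟩ := perm_three_eq σ
    rw [monomial_one_mul, monomial_one_pow, monomial_one_pow]
    exact mul_mem (pow_mem hBN _) (pow_mem hCN _)
  have hdN : ∀ w, IsWeight 1 3 w → monomial w 1 ∈ conjPreimage F (Gdeer 1 3 3) := fun w hw => by
    have hw3 : ∀ j, w j ^ 3 = 1 := hw.1
    have hprod : w 0 * w 1 * w 2 = 1 := by simpa [Fin.prod_univ_three] using hw.2
    obtain ⟨k, -, hk⟩ := (IsPrimitiveRoot.coe_units_iff.2 hζ).eq_pow_of_pow_eq_one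
      (congrArg Units.val (show (w 1 / w 0) ^ 3 = 1 by rw [div_pow, hw3, hw3, div_one]))
    replace hk : ζ ^ k = w 1 / w 0 := Units.ext (by simpa using hk)
    have hw1 : w 1 = w 0 * ζ ^ k := by rw [hk, mul_div_cancel]
    have hw2 : w 2 = w 0 * (ζ ^ 2) ^ k := by
      refine mul_left_cancel (hprod.trans ?_)
      rw [hw1]
      calc (1 : ℂˣ) = w 0 ^ 3 * (ζ ^ 3) ^ k := by rw [hw3, hζ3, one_pow, one_mul]
        _ = w 0 * (w 0 * ζ ^ k) * (w 0 * (ζ ^ 2) ^ k) := by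
          rw [pow_succ ζ 2, mul_pow, pow_succ, sq (w 0)]
          ac_rfl
    have hfac : monomial w 1 = monomial (fun _ => w 0) 1 * monomial ![1, ζ, ζ ^ 2] 1 ^ k := by
      rw [diagonal_pow, monomial_mul, monomial_inj]
      refine ⟨funext fun j => ?_, by simp⟩
      fin_cases j <;> simp [hw1, hw2]
    rw [hfac]
    refine mul_mem (mem_conjPreimage.2 ?_) (pow_mem hAN k)
    rw [commute_scalar]
    exact monomial_mem_Gdeer ⟨fun _ => hw.1 0, by simpa using hw3 0⟩ 1
  refine not_characteristic_of_conj F (fun w σ hw => ?_) 3 _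
    (monomial_mem_Gdeer isWeight_one _) hFF (monomial_mem_Ddeer_iff.2 ⟨hwt, rfl⟩) ?_
  · rw [← mem_conjPreimage, monomial_eq_diagonal_mul]
    exact mul_mem (hdN _ (hw.comp_perm _)) (hσN σ)
  · rw [hA, monomial_mem_Ddeer_iff]
    exact fun h => absurd h.2 (by decide)

/-- The invertible matrix `2 - J` of size four, where all the entries of `J` are `1`. -/
noncomputable def hadamardFour : Matrix.GeneralLinearGroup (Fin 4) ℂ :=
  have h : (Matrix.of fun i j : Fin 4 => if i = j then (1 : ℂ) else -1) *
      (Matrix.of fun i j => if i = j then 1 else -1) = (4 : ℂ) • 1 := by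
    ext i j
    fin_cases i <;> fin_cases j <;> simp [Matrix.mul_apply, Fin.sum_univ_four] <;> norm_num
  { val := Matrix.of fun i j => if i = j then 1 else -1
    inv := (4 : ℂ)⁻¹ • Matrix.of fun i j => if i = j then 1 else -1
    val_inv := by rw [mul_smul_comm, h, smul_smul]; norm_num
    inv_val := by rw [smul_mul_assoc, h, smul_smul]; norm_num }

theorem hadamardFour_apply (i j : Fin 4) :
    (hadamardFour : Matrix (Fin 4) (Fin 4) ℂ) i j = if i = j then 1 else -1 := rfl

theorem hadamardFour_conj_perm (σ : Equiv.Perm (Fin 4)) :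
    hadamardFour * monomial 1 σ * hadamardFour⁻¹ = monomial 1 σ := by
  rw [conj_eq_iff]
  ext i j
  have h : ∀ k, i = σ k ↔ σ.symm i = k := fun k => (Equiv.symm_apply_eq σ).symm
  simp only [Matrix.mul_apply, monomial_apply, h, Pi.one_apply, Units.val_one, mul_ite, ite_mul,
    one_mul, zero_mul, mul_one, mul_zero, Finset.sum_ite_eq, Finset.sum_ite_eq', Finset.mem_univ,
    if_true]
  simp only [hadamardFour_apply, h]

theorem hadamardFour_conj_diagonal (a : ℂˣ) :
    hadamardFour * monomial ![a, a, -a, -a] 1 * hadamardFour⁻¹ =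
        monomial ![-a, -a, a, a] (Equiv.swap 0 1 * Equiv.swap 2 3) := by
  rw [conj_eq_iff]
  have h0 : (Equiv.swap 0 1 * Equiv.swap 2 3 : Equiv.Perm (Fin 4)) 0 = 1 := rfl
  have h1 : (Equiv.swap 0 1 * Equiv.swap 2 3 : Equiv.Perm (Fin 4)) 1 = 0 := rfl
  have h2 : (Equiv.swap 0 1 * Equiv.swap 2 3 : Equiv.Perm (Fin 4)) 2 = 3 := rfl
  have h3 : (Equiv.swap 0 1 * Equiv.swap 2 3 : Equiv.Perm (Fin 4)) 3 = 2 := rfl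
  generalize (Equiv.swap 0 1 * Equiv.swap 2 3 : Equiv.Perm (Fin 4)) = τ at h0 h1 h2 h3 ⊢
  ext i j
  fin_cases i <;> fin_cases j <;>
    simp [Matrix.mul_apply, Fin.sum_univ_four, monomial_apply, hadamardFour_apply, h0, h1, h2, h3]

theorem not_characteristic_four : ¬ ((Ddeer 1 2 4).subgroupOf (Gdeer 1 2 4)).Characteristic := by
  have hwt : ∀ a : ℂˣ, a ^ 2 = 1 → IsWeight 1 2 ![a, a, -a, -a] := fun a ha => by
    refine ⟨fun j => ?_, ?_⟩
    · fin_cases j <;> simpa using ha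
    · simp only [Fin.prod_univ_four, pow_one]
      simp [← sq, ha]
  have hwt' : ∀ a : ℂˣ, a ^ 2 = 1 → IsWeight 1 2 ![-a, -a, a, a] := fun a ha => by
    simpa using hwt (-a) (by simpa using ha)
  have hσN : ∀ σ, monomial 1 σ ∈ conjPreimage hadamardFour (Gdeer 1 2 4) := fun σ => by
    rw [mem_conjPreimage, hadamardFour_conj_perm]
    exact monomial_mem_Gdeer isWeight_one σ
  have hpN : ∀ (w) (σ : Equiv.Perm (Fin 4)),
      monomial (w ∘ σ) 1 ∈ conjPreimage hadamardFour (Gdeer 1 2 4) →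
        monomial w 1 ∈ conjPreimage hadamardFour (Gdeer 1 2 4) := fun w σ h => by
    have := mul_mem (mul_mem (hσN σ) h) (hσN σ⁻¹)
    rw [monomial_mul, monomial_mul] at this
    convert this using 2
    · ext j; simp
    · simp
  have hdN : ∀ w, IsWeight 1 2 w →
      monomial w 1 ∈ conjPreimage hadamardFour (Gdeer 1 2 4) := fun w hw => by
    have hw2 : ∀ j, w j ^ 2 = 1 := hw.1
    have hprod : w 0 * w 1 * w 2 * w 3 = 1 := by simpa [Fin.prod_univ_four] using hw.2
    have hsgn : ∀ j, w j = w 0 ∨ w j = -w 0 := fun j => by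
      have h := sq_eq_sq_iff_eq_or_eq_neg.1 (congrArg Units.val ((hw2 j).trans (hw2 0).symm))
      exact h.imp (fun h => Units.ext h) fun h => Units.ext h
    have hne : (-1 : ℂˣ) ≠ 1 := fun h => absurd (congrArg Units.val h) (by norm_num)
    have h4 : w 0 * w 0 * w 0 * w 0 = 1 := by
      rw [← sq, mul_assoc, ← sq, hw2, mul_one]
    have hpair : monomial ![w 0, w 0, -w 0, -w 0] 1 ∈
        conjPreimage hadamardFour (Gdeer 1 2 4) := by
      rw [mem_conjPreimage, hadamardFour_conj_diagonal]
      exact monomial_mem_Gdeer (hwt' _ (hw2 0)) _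
    rcases hsgn 1 with h1 | h1 <;> rcases hsgn 2 with h2 | h2 <;> rcases hsgn 3 with h3 | h3 <;>
      rw [h1, h2, h3] at hprod <;> try (simp [h4, hne] at hprod; done)
    · have hconst : w = fun _ => w 0 := by ext j; fin_cases j <;> simp [h1, h2, h3]
      rw [hconst, mem_conjPreimage, commute_scalar]
      exact monomial_mem_Gdeer (hconst ▸ hw) 1
    · convert hpair using 2
      ext j; fin_cases j <;> simp [h1, h2, h3]
    · refine hpN w (Equiv.swap 1 2) ?_
      convert hpair using 2
      ext j; fin_cases j <;> simp [h1, h2, h3, Equiv.swap_apply_def]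
    · refine hpN w (Equiv.swap 1 3) ?_
      convert hpair using 2
      ext j; fin_cases j <;> simp [h1, h2, h3, Equiv.swap_apply_def]
  refine not_characteristic_of_conj hadamardFour (fun w σ hw => ?_) 4 1 (one_mem _) ?_
    (monomial_mem_Ddeer_iff.2 ⟨hwt 1 (one_pow 2), rfl⟩) ?_
  · rw [← mem_conjPreimage, monomial_eq_diagonal_mul]
    exact mul_mem (hdN _ (hw.comp_perm _)) (hσN σ)
  · ext i j
    fin_cases i <;> fin_cases j <;>
      simp [Matrix.mul_apply, Fin.sum_univ_four, hadamardFour_apply] <;> norm_num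
  · rw [hadamardFour_conj_diagonal, monomial_mem_Ddeer_iff]
    exact fun h => absurd h.2 (by decide)

theorem exists_const_of_mem_klein {g : Matrix.GeneralLinearGroup (Fin 2) ℂ}
    (hg : g ∈ Gdeer 1 2 2) : ∃ (a : ℂˣ) (σ : Equiv.Perm (Fin 2)), (a = 1 ∨ a = -1) ∧
      g = monomial (fun _ => a) σ := by
  obtain ⟨w, σ, hw, rfl⟩ := mem_Gdeer_iff.1 hg
  have h0 : w 0 ^ 2 = 1 := hw.1 0
  have h1 : w 0 * w 1 = 1 := by simpa using hw.2
  have h2 : w 1 = w 0 := mul_left_cancel (h1.trans (h0.symm.trans (sq _)))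
  refine ⟨w 0, σ, ?_, ?_⟩
  · exact (sq_eq_sq_iff_eq_or_eq_neg.1 (congrArg Units.val (h0.trans (one_pow 2).symm))).imp
      (fun h => Units.ext h) fun h => Units.ext h
  · rw [monomial_inj]
    exact ⟨by ext j; fin_cases j <;> simp [h2], rfl⟩

theorem not_characteristic_klein : ¬ ((Ddeer 1 2 2).subgroupOf (Gdeer 1 2 2)).Characteristic := by
  intro hchar
  let S : Gdeer 1 2 2 := ⟨monomial 1 (Equiv.swap 0 1), monomial_mem_Gdeer isWeight_one _⟩
  let s : Gdeer 1 2 2 → ℂ := fun g => g.1 0 0 + g.1 0 1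
  have hσ : ∀ σ : Equiv.Perm (Fin 2), σ = 1 ∨ σ = Equiv.swap 0 1 := by decide
  have hs : ∀ (g : Gdeer 1 2 2) a σ, g.1 = monomial (fun _ => a) σ → s g = a := fun g a σ hg => by
    rcases hσ σ with rfl | rfl <;> simp [s, hg, monomial_apply]
  have hcomm : ∀ g h : Gdeer 1 2 2, g * h = h * g := fun g h => by
    obtain ⟨a, σ, -, hg⟩ := exists_const_of_mem_klein g.2
    obtain ⟨b, τ, -, hh⟩ := exists_const_of_mem_klein h.2
    have hστ : σ * τ = τ * σ := by clear hg hh; revert σ τ; decide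
    refine Subtype.ext ?_
    rw [Subgroup.coe_mul, Subgroup.coe_mul, hg, hh, monomial_mul, monomial_mul, monomial_inj]
    exact ⟨funext fun _ => mul_comm _ _, hστ⟩
  have hSS : S * S = 1 := by
    refine Subtype.ext ?_
    change monomial 1 (Equiv.swap 0 1) * monomial 1 (Equiv.swap 0 1) = 1
    rw [← monomial_one_mul, Equiv.swap_mul_self, monomial_one]
  have hsmul : ∀ g h, s (g * h) = s g * s h := fun g h => by
    obtain ⟨a, σ, -, hg⟩ := exists_const_of_mem_klein g.2
    obtain ⟨b, τ, -, hh⟩ := exists_const_of_mem_klein h.2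
    rw [hs g a σ hg, hs h b τ hh, hs (g * h) (a * b) (σ * τ), Units.val_mul]
    rw [Subgroup.coe_mul, hg, hh, monomial_mul]
  have hsS : s S = 1 := hs S 1 _ rfl
  have hsgn : ∀ g, s g = 1 ∨ s g = -1 := fun g => by
    obtain ⟨a, σ, ha, hg⟩ := exists_const_of_mem_klein g.2
    rw [hs g a σ hg]
    rcases ha with rfl | rfl <;> simp
  have hne : (-1 : ℂ) ≠ 1 := by norm_num
  let f : Gdeer 1 2 2 → Gdeer 1 2 2 := fun g => if s g = 1 then g else g * S
  have hf : Function.Involutive f := fun g => by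
    rcases hsgn g with h | h <;> simp [f, h, hne, hsmul, hsS, mul_assoc, hSS]
  have hfmul : ∀ g h, f (g * h) = f g * f h := fun g h => by
    have h1 : g * S * (h * S) = g * h := by
      rw [mul_assoc, hcomm h S, ← mul_assoc S, hSS, one_mul]
    have h2 : g * S * h = g * h * S := by rw [mul_assoc, hcomm S h, mul_assoc]
    rcases hsgn g with hg | hg <;> rcases hsgn h with hh | hh <;>
      simp [f, hg, hh, hne, hsmul, h1, h2, mul_assoc]
  have hw : IsWeight 1 2 (fun _ : Fin 2 => (-1 : ℂˣ)) := ⟨fun _ => by simp, by simp⟩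
  let t : Gdeer 1 2 2 := ⟨monomial (fun _ => -1) 1, monomial_mem_Gdeer hw 1⟩
  have ht : t ∈ (Ddeer 1 2 2).subgroupOf (Gdeer 1 2 2) :=
    Subgroup.mem_subgroupOf.2 (monomial_mem_Ddeer_iff.2 ⟨hw, rfl⟩)
  have hft : f t = t * S := if_neg (by rw [hs t (-1) 1 rfl]; exact by norm_num)
  have hD : (f t : Gdeer 1 2 2).1 ∈ Ddeer 1 2 2 :=
    Subgroup.characteristic_iff_le_comap.1 hchar (MulEquiv.mk' hf.toPerm hfmul) ht
  rw [hft] at hD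
  change monomial _ 1 * monomial 1 (Equiv.swap 0 1) ∈ _ at hD
  rw [monomial_mul, monomial_mem_Ddeer_iff] at hD
  exact absurd hD.2 (by decide)

/-- **Lemma 13 (Marin–Michel).** The subgroup `D(de,e,r)` of diagonal matrices of
`G = G(de,e,r)` is a characteristic subgroup of `G` if and only if `G` is none of
`G(2,2,2)`, `G(2,1,2)`, `G(4,2,2)`, `G(3,3,3)`, `G(2,2,4)`
(in the parameters used here: `(d,e,r) = (1,2,2), (2,1,2), (2,2,2), (1,3,3), (1,2,4)`). -/
theorem diagonal_subgroup_characteristic_iff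
    (d e r : ℕ) (hd : 1 ≤ d) (he : 1 ≤ e) (hr : 1 ≤ r) :
    Subgroup.Characteristic ((Ddeer d e r).subgroupOf (Gdeer d e r)) ↔
      ¬ ((d = 1 ∧ e = 2 ∧ r = 2) ∨ (d = 2 ∧ e = 1 ∧ r = 2) ∨ (d = 2 ∧ e = 2 ∧ r = 2) ∨
        (d = 1 ∧ e = 3 ∧ r = 3) ∨ (d = 1 ∧ e = 2 ∧ r = 4)) := by
  constructor
  · rintro h (⟨rfl, rfl, rfl⟩ | ⟨rfl, rfl, rfl⟩ | ⟨rfl, rfl, rfl⟩ | ⟨rfl, rfl, rfl⟩ |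
      ⟨rfl, rfl, rfl⟩)
    · exact not_characteristic_klein h
    · exact not_characteristic_rank_two 1 (Or.inl rfl) h
    · exact not_characteristic_rank_two 2 (Or.inr rfl) h
    · exact not_characteristic_three h
    · exact not_characteristic_four h
  · exact characteristic_of_not_exceptional d e r hd he hr
end
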